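/- arXiv:nlin/0606016 — 10 statements merged into one kernel-verified Lean document; each statement's English description precedes it below -/
import Mathlib

section
/- Let L > 0 and let f : ℝ × ℝ → ℝ be continuous, L-periodic in its first argument, and strictly increasing in its second argument (for each fixed x, y ↦ f(x,y) is strictly increasing). Then the equation φ'' = f(x, φ) has at most one L-periodic C² solution φ : ℝ → ℝ. -/
open Set

/-- A continuous periodic function attains a global maximum. -/
lemma exists_forall_le_of_continuous_of_periodic {w : ℝ → ℝ} {L : ℝ} (hL : 0 < L)
    (hw : Continuous w) (hp : Function.Periodic w L) : ∃ x₀, ∀ x, w x ≤ w x₀ := by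
  obtain ⟨x₀, -, hx₀⟩ := isCompact_Icc.exists_isMaxOn (nonempty_Icc.2 hL.le) hw.continuousOn
  refine ⟨x₀, fun x => ?_⟩
  obtain ⟨y, hy, hxy⟩ := hp.exists_mem_Ico₀ hL x
  exact hxy ▸ hx₀ (Ico_subset_Icc_self hy)

/-- The second derivative is nonpositive at a local maximum. -/
lemma deriv_deriv_nonpos_of_isLocalMax {w : ℝ → ℝ} {x₀ : ℝ} (hc : ContinuousAt w x₀)
    (hmax : IsLocalMax w x₀) : deriv (deriv w) x₀ ≤ 0 := by
  by_contra! hpos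
  have hmin : IsLocalMin w x₀ := isLocalMin_of_deriv_deriv_pos hpos hmax.deriv_eq_zero hc
  have hconst : w =ᶠ[nhds x₀] fun _ => w x₀ := by
    filter_upwards [hmin, hmax] with x h h' using le_antisymm h' h
  have hzero : deriv (deriv w) x₀ = 0 := by
    rw [hconst.deriv.deriv_eq]
    simp
  exact hpos.ne' hzero

/-- Comparison of two periodic solutions of `φ'' = f(x, φ)` when `f` is strictly increasing in its
second argument. -/
lemma le_of_periodic_of_deriv_deriv_eq {L : ℝ} (hL : 0 < L) {f : ℝ × ℝ → ℝ}
    (hmono : ∀ x : ℝ, StrictMono fun y => f (x, y)) {φ ψ : ℝ → ℝ}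
    (hφ : ContDiff ℝ 2 φ) (hψ : ContDiff ℝ 2 ψ)
    (hφ_eq : ∀ x, deriv (deriv φ) x = f (x, φ x))
    (hψ_eq : ∀ x, deriv (deriv ψ) x = f (x, ψ x))
    (hφ_per : Function.Periodic φ L) (hψ_per : Function.Periodic ψ L) : φ ≤ ψ := by
  obtain ⟨x₀, hx₀⟩ := exists_forall_le_of_continuous_of_periodic hL
    (hφ.continuous.sub hψ.continuous) (hφ_per.sub hψ_per)
  have hderiv : deriv (φ - ψ) = deriv φ - deriv ψ := funext fun x =>
    deriv_sub (hφ.differentiable two_ne_zero x) (hψ.differentiable two_ne_zero x)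
  have hderiv₂ : deriv (deriv (φ - ψ)) x₀ = f (x₀, φ x₀) - f (x₀, ψ x₀) := by
    rw [hderiv, deriv_sub (hφ.differentiable_deriv_two x₀) (hψ.differentiable_deriv_two x₀),
      hφ_eq, hψ_eq]
  have hnonpos := deriv_deriv_nonpos_of_isLocalMax
    (hφ.continuous.sub hψ.continuous).continuousAt (Filter.Eventually.of_forall hx₀)
  rw [hderiv₂, sub_nonpos] at hnonpos
  have hle : φ x₀ ≤ ψ x₀ := (hmono x₀).le_iff_le.1 hnonpos
  intro x
  have := hx₀ x
  simp only [Pi.sub_apply] at this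
  linarith

/-- If f is continuous, L-periodic in x, and strictly increasing in y, then
φ'' = f(x,φ) has at most one L-periodic C² solution. -/
theorem stmt_1 (L : ℝ) (hL : 0 < L) (f : ℝ × ℝ → ℝ)
    (hf : Continuous f) (hper : ∀ x y, f (x + L, y) = f (x, y))
    (hmono : ∀ x : ℝ, StrictMono fun y => f (x, y))
    (φ₁ φ₂ : ℝ → ℝ)
    (h₁ : ContDiff ℝ 2 φ₁) (h₂ : ContDiff ℝ 2 φ₂)
    (heq₁ : ∀ x, deriv (deriv φ₁) x = f (x, φ₁ x))
    (heq₂ : ∀ x, deriv (deriv φ₂) x = f (x, φ₂ x))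
    (hp₁ : ∀ x, φ₁ (x + L) = φ₁ x) (hp₂ : ∀ x, φ₂ (x + L) = φ₂ x) :
    φ₁ = φ₂ := by
  exact le_antisymm (le_of_periodic_of_deriv_deriv_eq hL hmono h₁ h₂ heq₁ heq₂ hp₁ hp₂)
    (le_of_periodic_of_deriv_deriv_eq hL hmono h₂ h₁ heq₂ heq₁ hp₂ hp₁)
end

section
/- Let L > 0 and let f : ℝ × ℝ → ℝ be continuous, L-periodic in its first argument, with continuous partial derivative ∂f/∂y. Let φ : [x₀, +∞) → ℝ be a bounded C² solution of φ'' = f(x, φ), and set m = inf_{x ≥ x₀} φ(x), M = sup_{x ≥ x₀} φ(x). If min{∂f/∂y (x, y) : x ∈ [0, L], y ∈ [m, M]} > 0, then there exists an L-periodic C² solution ϕ : ℝ → ℝ of the same equation such that |φ(x) − ϕ(x)| + |φ'(x) − ϕ'(x)| → 0 as x → +∞. -/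
open Set Filter

/-- A bounded function with `k² u ≤ u''` on a half-line decays exponentially. -/
lemma le_mul_exp_of_sq_mul_le_deriv_deriv {a k B : ℝ} (hk : 0 < k) {u u' u'' : ℝ → ℝ}
    (h1 : ∀ x ∈ Ici a, HasDerivAt u (u' x) x) (h2 : ∀ x ∈ Ici a, HasDerivAt u' (u'' x) x)
    (hu : ∀ x ∈ Ici a, k ^ 2 * u x ≤ u'' x) (hB : ∀ x ∈ Ici a, u x ≤ B) :
    ∀ x ∈ Ici a, u x ≤ B * Real.exp (-(k * (x - a))) := by
  have hexp (c x : ℝ) : HasDerivAt (fun y => Real.exp (c * y)) (Real.exp (c * x) * c) x := by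
    simpa using ((hasDerivAt_id x).const_mul c).exp
  have hv : MonotoneOn (fun x => (u' x + k * u x) * Real.exp (-k * x)) (Ici a) := by
    have hd (x) (hx : x ∈ Ici a) :=
      ((h2 x hx).add ((h1 x hx).const_mul k)).mul (hexp (-k) x)
    refine monotoneOn_of_hasDerivWithinAt_nonneg (convex_Ici a)
      (fun x hx => (hd x hx).continuousAt.continuousWithinAt)
      (fun x hx => (hd x (interior_subset hx)).hasDerivWithinAt) fun x hx => ?_
    have := hu x (interior_subset hx)
    have he := Real.exp_pos (-k * x)
    simp only [Pi.add_apply]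
    nlinarith [mul_nonneg he.le (sub_nonneg.2 this)]
  have hneg : ∀ x ∈ Ici a, u' x + k * u x ≤ 0 := by
    intro b hb
    by_contra! hpos
    set c := (u' b + k * u b) * Real.exp (-k * b)
    have hcpos : 0 < c := mul_pos hpos (Real.exp_pos _)
    have hsub : Ici b ⊆ Ici a := Ici_subset_Ici.2 hb
    have hmono : MonotoneOn
        (fun x => u x * Real.exp (k * x) - c / (2 * k) * Real.exp (2 * k * x)) (Ici b) := by
      have hd (x) (hx : x ∈ Ici b) :=
        ((h1 x (hsub hx)).mul (hexp k x)).sub ((hexp (2 * k) x).const_mul (c / (2 * k)))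
      refine monotoneOn_of_hasDerivWithinAt_nonneg (convex_Ici b)
        (fun x hx => (hd x hx).continuousAt.continuousWithinAt)
        (fun x hx => (hd x (interior_subset hx)).hasDerivWithinAt) fun x hx => ?_
      have hx' := interior_subset hx
      have hcx : c ≤ (u' x + k * u x) * Real.exp (-k * x) := hv hb (hsub hx') hx'
      have he := Real.exp_pos (k * x)
      have e1 : Real.exp (-k * x) * Real.exp (k * x) = 1 := by
        rw [← Real.exp_add]; simp
      have e2 : Real.exp (2 * k * x) = Real.exp (k * x) * Real.exp (k * x) := by
        rw [← Real.exp_add]; ring_nf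
      have e3 : c / (2 * k) * (Real.exp (2 * k * x) * (2 * k)) = c * Real.exp (2 * k * x) := by
        field_simp
      rw [e3, e2]
      have h4 : c * Real.exp (k * x) ≤ u' x + k * u x := by
        calc c * Real.exp (k * x)
            ≤ (u' x + k * u x) * Real.exp (-k * x) * Real.exp (k * x) := by gcongr
          _ = _ := by rw [mul_assoc, e1, mul_one]
      nlinarith [mul_le_mul_of_nonneg_right h4 he.le]
    set d := u b * Real.exp (k * b) - c / (2 * k) * Real.exp (2 * k * b)
    set q := c / (2 * k)
    have hq : 0 < q := by positivity
    have htend : Tendsto (fun x => Real.exp (k * x)) atTop atTop :=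
      Real.tendsto_exp_atTop.comp (tendsto_id.const_mul_atTop hk)
    obtain ⟨x, hx1, hx2, hxb⟩ := ((htend.eventually_ge_atTop 1).and
      ((htend.eventually_ge_atTop ((B + |d| + 1) / q)).and (eventually_ge_atTop b))).exists
    have h3 : d ≤ u x * Real.exp (k * x) - q * Real.exp (2 * k * x) :=
      hmono self_mem_Ici hxb hxb
    have e2 : Real.exp (2 * k * x) = Real.exp (k * x) * Real.exp (k * x) := by
      rw [← Real.exp_add]; ring_nf
    rw [e2] at h3
    rw [div_le_iff₀ hq] at hx2
    have h5 := hB x (hsub hxb)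
    have := neg_abs_le d
    have := abs_nonneg d
    nlinarith
  have hanti : AntitoneOn (fun x => u x * Real.exp (k * x)) (Ici a) := by
    have hd (x) (hx : x ∈ Ici a) := (h1 x hx).mul (hexp k x)
    refine antitoneOn_of_hasDerivWithinAt_nonpos (convex_Ici a)
      (fun x hx => (hd x hx).continuousAt.continuousWithinAt)
      (fun x hx => (hd x (interior_subset hx)).hasDerivWithinAt) fun x hx => ?_
    nlinarith [mul_nonneg (Real.exp_pos (k * x)).le (neg_nonneg.2 (hneg x (interior_subset hx)))]
  intro x hx
  have h3 : u x * Real.exp (k * x) ≤ u a * Real.exp (k * a) := hanti self_mem_Ici hx hx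
  have h4 : u x * Real.exp (k * x) ≤ B * Real.exp (k * a) :=
    h3.trans (by gcongr; exact hB a self_mem_Ici)
  have e : B * Real.exp (-(k * (x - a))) = B * Real.exp (k * a) / Real.exp (k * x) := by
    rw [mul_div_assoc, ← Real.exp_sub]; ring_nf
  rwa [e, le_div_iff₀ (Real.exp_pos _)]

/-- If `ψ` differs from each of its translates by multiples of `L` by at most `g`, where `g` tends
to zero, then these translates converge pointwise. -/
lemma exists_tendsto_translates {a L : ℝ} (hL : 0 < L) {ψ g : ℝ → ℝ}
    (hg : Tendsto g atTop (nhds 0))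
    (h : ∀ p : ℕ, ∀ x ∈ Ici a, |ψ (x + p * L) - ψ x| ≤ g x) :
    ∃ Ψ : ℝ → ℝ, (∀ x, Tendsto (fun n : ℕ => ψ (x + n * L)) atTop (nhds (Ψ x))) ∧
      (∀ x, Ψ (x + L) = Ψ x) ∧ ∀ x ∈ Ici a, |ψ x - Ψ x| ≤ g x := by
  have htr (x : ℝ) : Tendsto (fun n : ℕ => x + n * L) atTop atTop :=
    tendsto_atTop_add_const_left _ _ (tendsto_natCast_atTop_atTop.atTop_mul_const hL)
  have hlim (x : ℝ) : ∃ l, Tendsto (fun n : ℕ => ψ (x + n * L)) atTop (nhds l) := by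
    refine cauchySeq_tendsto_of_complete (Metric.cauchySeq_iff'.2 fun ε hε => ?_)
    obtain ⟨N, hN, hNa⟩ := (((hg.comp (htr x)).eventually_lt_const hε).and
      ((htr x).eventually_ge_atTop a)).exists
    refine ⟨N, fun n hn => ?_⟩
    have := h (n - N) (x + N * L) hNa
    rw [Nat.cast_sub hn, show x + N * L + (n - N : ℝ) * L = x + n * L by ring] at this
    exact this.trans_lt hN
  choose Ψ hΨ using hlim
  refine ⟨Ψ, hΨ, fun x => ?_, fun x hx => ?_⟩
  · refine tendsto_nhds_unique (hΨ (x + L)) ?_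
    refine ((hΨ x).comp (tendsto_add_atTop_nat 1)).congr fun n => ?_
    simp only [Function.comp, Nat.cast_add, Nat.cast_one]
    ring_nf
  · rw [abs_sub_comm]
    exact le_of_tendsto ((hΨ x).sub_const (ψ x)).abs (Eventually.of_forall fun p => h p x hx)

/-- Limits of translates can be differentiated. -/
lemma hasDerivAt_of_tendsto_translates {a L : ℝ} (hL : 0 < L) {ψ ψ' Ψ Ψ' g : ℝ → ℝ}
    (hg : Tendsto g atTop (nhds 0))
    (hd : ∀ x ∈ Ici a, HasDerivAt ψ (ψ' x) x)
    (hΨ : ∀ x, Tendsto (fun n : ℕ => ψ (x + n * L)) atTop (nhds (Ψ x)))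
    (hΨ'L : ∀ x, Ψ' (x + L) = Ψ' x)
    (hΨ' : ∀ x ∈ Ici a, |ψ' x - Ψ' x| ≤ g x) (x : ℝ) : HasDerivAt Ψ (Ψ' x) x := by
  have htr : Tendsto (fun n : ℕ => x - 1 + n * L) atTop atTop :=
    tendsto_atTop_add_const_left _ _ (tendsto_natCast_atTop_atTop.atTop_mul_const hL)
  have hmem {n : ℕ} {c y : ℝ} (hn : c ≤ x - 1 + n * L) (hy : y ∈ Ioi (x - 1)) :
      c ≤ y + n * L := hn.trans (by have := mem_Ioi.1 hy; linarith)
  refine hasDerivAt_of_tendstoUniformlyOn (f := fun (n : ℕ) y => ψ (y + n * L))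
    (f' := fun (n : ℕ) y => ψ' (y + n * L)) (l := atTop) (isOpen_Ioi (a := x - 1)) ?_ ?_
    (fun y _ => hΨ y) (by simp)
  · refine Metric.tendstoUniformlyOn_iff.2 fun ε hε => ?_
    obtain ⟨A, hA⟩ := eventually_atTop.1 (hg.eventually_lt_const hε)
    filter_upwards [htr.eventually_ge_atTop (max a A)] with n hn y hy
    have h1 := hmem hn hy
    have hp : Ψ' (y + n * L) = Ψ' y := (show Function.Periodic Ψ' L from hΨ'L).nat_mul n y
    rw [dist_comm, Real.dist_eq, ← hp]
    exact (hΨ' _ ((le_max_left _ _).trans h1)).trans_lt (hA _ ((le_max_right _ _).trans h1))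
  · filter_upwards [htr.eventually_ge_atTop a] with n hn y hy
    exact (hd _ (hmem hn hy)).comp_add_const y (n * L)

/-- A bounded solution of `|w''| ≤ K |w|`, `δ w² ≤ w w''` on a half-line decays exponentially
together with its first two derivatives, at a rate depending only on `δ`, `K` and the bound. -/
lemma decay_of_mul_sq_le_mul_deriv_deriv {a δ K C : ℝ} (hδ : 0 < δ) (hK : 0 ≤ K)
    {w w' w'' : ℝ → ℝ}
    (h1 : ∀ x ∈ Ici a, HasDerivAt w (w' x) x) (h2 : ∀ x ∈ Ici a, HasDerivAt w' (w'' x) x)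
    (hlow : ∀ x ∈ Ici a, δ * w x ^ 2 ≤ w x * w'' x) (hup : ∀ x ∈ Ici a, |w'' x| ≤ K * |w x|)
    (hC : ∀ x ∈ Ici a, |w x| ≤ C) (x : ℝ) (hx : x ∈ Ici a) :
    |w x| ≤ (K + 2) * √(C ^ 2 * Real.exp (-(√(2 * δ) * (x - a)))) ∧
    |w' x| ≤ (K + 2) * √(C ^ 2 * Real.exp (-(√(2 * δ) * (x - a)))) ∧
    |w'' x| ≤ (K + 2) * √(C ^ 2 * Real.exp (-(√(2 * δ) * (x - a)))) := by
  set G : ℝ → ℝ := fun x => √(C ^ 2 * Real.exp (-(√(2 * δ) * (x - a)))) with hG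
  have hGnn (x) : 0 ≤ G x := Real.sqrt_nonneg _
  have hGanti : Antitone G := fun x y hxy => by simp only [hG]; gcongr
  have hw : ∀ x ∈ Ici a, |w x| ≤ G x := by
    intro x hx
    refine Real.abs_le_sqrt ?_
    refine le_mul_exp_of_sq_mul_le_deriv_deriv (u := fun x => w x ^ 2)
      (u' := fun x => 2 * (w x * w' x)) (u'' := fun x => 2 * (w' x * w' x + w x * w'' x))
      (by positivity) (fun y hy => ?_) (fun y hy => ?_) (fun y hy => ?_) (fun y hy => ?_) x hx
    · exact ((h1 y hy).pow 2).congr_deriv (by push_cast; ring)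
    · exact ((h1 y hy).mul (h2 y hy)).const_mul 2
    · rw [Real.sq_sqrt (by positivity)]
      nlinarith [hlow y hy, mul_self_nonneg (w' y)]
    · exact sq_le_sq' (abs_le.1 (hC y hy)).1 (abs_le.1 (hC y hy)).2
  have hw'' : ∀ x ∈ Ici a, |w'' x| ≤ K * G x := fun x hx =>
    (hup x hx).trans (mul_le_mul_of_nonneg_left (hw x hx) hK)
  change |w x| ≤ (K + 2) * G x ∧ |w' x| ≤ (K + 2) * G x ∧ |w'' x| ≤ (K + 2) * G x
  refine ⟨by nlinarith [hw x hx, mul_nonneg hK (hGnn x), hGnn x], ?_,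
    by nlinarith [hw'' x hx, hGnn x]⟩
  have hsub {y : ℝ} (hy : y ∈ Icc x (x + 1)) : y ∈ Ici a := le_trans hx hy.1
  obtain ⟨ξ, hξ, hξw⟩ := exists_hasDerivAt_eq_slope w w' (show x < x + 1 by linarith)
    (fun y hy => (h1 y (hsub hy)).continuousAt.continuousWithinAt)
    (fun y hy => h1 y (hsub (Ioo_subset_Icc_self hy)))
  have hξ' := Ioo_subset_Icc_self hξ
  have h3 : |w' ξ - w' x| ≤ K * G x * |ξ - x| :=
    (convex_Icc x (x + 1)).norm_image_sub_le_of_norm_hasDerivWithin_le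
      (fun y hy => (h2 y (hsub hy)).hasDerivWithinAt)
      (fun y hy => (hw'' y (hsub hy)).trans (mul_le_mul_of_nonneg_left (hGanti hy.1) hK))
      (left_mem_Icc.2 (by linarith)) hξ'
  have h4 : |ξ - x| ≤ 1 := abs_le.2 ⟨by linarith [hξ.1], by linarith [hξ.2]⟩
  have h5 : |w' ξ - w' x| ≤ K * G x :=
    h3.trans (mul_le_of_le_one_right (mul_nonneg hK (hGnn x)) h4)
  have h6 : w' ξ = w (x + 1) - w x := by rw [hξw]; simp
  have hx1 : x + 1 ∈ Ici a := hsub (right_mem_Icc.2 (by linarith))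
  have h7 := (hw _ hx1).trans (hGanti (show x ≤ x + 1 by linarith))
  have h8 := hw x hx
  rw [h6] at h5
  rw [abs_le] at *
  constructor <;> nlinarith [h5.1, h5.2, h7.1, h7.2, h8.1, h8.2]

/-- One-sided Lipschitz bound from below on an interval where the derivative is at least `δ`. -/
lemma mul_sq_le_of_le_hasDerivAt {m M δ : ℝ} {h h' : ℝ → ℝ}
    (hd : ∀ y, HasDerivAt h (h' y) y) (hδ : ∀ y ∈ Icc m M, δ ≤ h' y) {y z : ℝ}
    (hy : y ∈ Icc m M) (hz : z ∈ Icc m M) : δ * (y - z) ^ 2 ≤ (y - z) * (h y - h z) := by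
  have hmono : MonotoneOn (fun y => h y - δ * y) (Icc m M) := by
    have hd' (y : ℝ) := (hd y).sub ((hasDerivAt_id y).const_mul δ)
    refine monotoneOn_of_hasDerivWithinAt_nonneg (convex_Icc m M)
      (fun x _ => (hd' x).continuousAt.continuousWithinAt)
      (fun x _ => (hd' x).hasDerivWithinAt) fun x hx => ?_
    have := hδ x (interior_subset hx)
    linarith
  rcases le_total y z with hyz | hyz
  · have : h y - δ * y ≤ h z - δ * z := hmono hy hz hyz
    nlinarith
  · have : h z - δ * z ≤ h y - δ * y := hmono hz hy hyz
    nlinarith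

/-- Abstract convergence result: a bounded C² solution on a half-line converges,
together with its derivative, to an L-periodic solution, provided
min ∂f/∂y > 0 on [0,L] × [inf φ, sup φ]. -/
theorem stmt_2 (L x₀ : ℝ) (hL : 0 < L) (f fy : ℝ × ℝ → ℝ)
    (hf : Continuous f) (hfy : Continuous fy)
    (hper : ∀ x y, f (x + L, y) = f (x, y))
    (hderiv : ∀ x y : ℝ, HasDerivAt (fun z => f (x, z)) (fy (x, y)) y)
    (φ φ' φ'' : ℝ → ℝ)
    (hd1 : ∀ x ∈ Ici x₀, HasDerivWithinAt φ (φ' x) (Ici x₀) x)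
    (hd2 : ∀ x ∈ Ici x₀, HasDerivWithinAt φ' (φ'' x) (Ici x₀) x)
    (hc : ContinuousOn φ'' (Ici x₀))
    (heq : ∀ x ∈ Ici x₀, φ'' x = f (x, φ x))
    (hbdd : ∃ C, ∀ x ∈ Ici x₀, |φ x| ≤ C)
    (hpos : 0 < sInf (fy ''
      (Icc 0 L ×ˢ Icc (sInf (φ '' Ici x₀)) (sSup (φ '' Ici x₀))))) :
    ∃ ϕ : ℝ → ℝ, ContDiff ℝ 2 ϕ ∧ (∀ x, deriv (deriv ϕ) x = f (x, ϕ x)) ∧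
      (∀ x, ϕ (x + L) = ϕ x) ∧
      Tendsto (fun x => |φ x - ϕ x| + |φ' x - deriv ϕ x|) atTop (nhds 0) := by
  set m := sInf (φ '' Ici x₀)
  set M := sSup (φ '' Ici x₀)
  set δ := sInf (fy '' (Icc 0 L ×ˢ Icc m M))
  obtain ⟨C, hC⟩ := hbdd
  have hφmem : ∀ x ∈ Ici x₀, φ x ∈ Icc m M := fun x hx =>
    ⟨csInf_le ⟨-C, by rintro _ ⟨y, hy, rfl⟩; exact (abs_le.1 (hC y hy)).1⟩ (mem_image_of_mem _ hx),
      le_csSup ⟨C, by rintro _ ⟨y, hy, rfl⟩; exact (abs_le.1 (hC y hy)).2⟩ (mem_image_of_mem _ hx)⟩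
  have hfyper (y : ℝ) : Function.Periodic (fun x => fy (x, y)) L := fun x => by
    refine (hderiv (x + L) y).unique ?_
    simpa only [hper] using hderiv x y
  have hcomp : IsCompact (Icc 0 L ×ˢ Icc m M) := isCompact_Icc.prod isCompact_Icc
  have hreduce (x y : ℝ) (hy : y ∈ Icc m M) :
      ∃ z ∈ Icc 0 L ×ˢ Icc m M, fy (x, y) = fy z := by
    obtain ⟨x', hx', hxx'⟩ := (hfyper y).exists_mem_Ico₀ hL x
    exact ⟨(x', y), ⟨Ico_subset_Icc_self hx', hy⟩, hxx'⟩
  have hδ (x y : ℝ) (hy : y ∈ Icc m M) : δ ≤ fy (x, y) := by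
    obtain ⟨z, hz, h⟩ := hreduce x y hy
    rw [h]
    exact csInf_le (hcomp.image hfy).bddBelow (mem_image_of_mem _ hz)
  obtain ⟨K, hK⟩ : ∃ K, ∀ x, ∀ y ∈ Icc m M, |fy (x, y)| ≤ K := by
    obtain ⟨K, hK⟩ := hcomp.exists_bound_of_continuousOn hfy.continuousOn
    refine ⟨K, fun x y hy => ?_⟩
    obtain ⟨z, hz, h⟩ := hreduce x y hy
    rw [h]
    exact hK z hz
  have hK0 : 0 ≤ K := (abs_nonneg _).trans (hK 0 (φ x₀) (hφmem x₀ self_mem_Ici))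
  have hfper (n : ℕ) (x y : ℝ) : f (x + n * L, y) = f (x, y) :=
    (show Function.Periodic (fun x => f (x, y)) L from fun x => hper x y).nat_mul n x
  set a := x₀ + 1
  have hnhds {x : ℝ} (hx : x ∈ Ici a) : x ∈ Ici x₀ ∧ Ici x₀ ∈ nhds x := by
    have : x₀ < x := lt_of_lt_of_le (lt_add_one x₀) hx
    exact ⟨this.le, Ici_mem_nhds this⟩
  have hD1 : ∀ x ∈ Ici a, HasDerivAt φ (φ' x) x := fun x hx =>
    (hd1 x (hnhds hx).1).hasDerivAt (hnhds hx).2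
  have hD2 : ∀ x ∈ Ici a, HasDerivAt φ' (φ'' x) x := fun x hx =>
    (hd2 x (hnhds hx).1).hasDerivAt (hnhds hx).2
  have hshift {x : ℝ} (p : ℕ) (hx : x ∈ Ici a) : x + p * L ∈ Ici a :=
    le_add_of_le_of_nonneg hx (mul_nonneg p.cast_nonneg hL.le)
  set g : ℝ → ℝ := fun x => (K + 2) * √((2 * C) ^ 2 * Real.exp (-(√(2 * δ) * (x - a)))) with hg
  have hg0 : Tendsto g atTop (nhds 0) := by
    have hs : 0 < √(2 * δ) := by positivity
    have h1 : Tendsto (fun x : ℝ => √(2 * δ) * (x - a)) atTop atTop :=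
      (tendsto_atTop_add_const_right _ (-a) tendsto_id).const_mul_atTop hs
    have h2 := ((Real.tendsto_exp_neg_atTop_nhds_zero.comp h1).const_mul
      ((2 * C) ^ 2)).sqrt.const_mul (K + 2)
    simpa [hg, Function.comp_def] using h2
  have hdecay (p : ℕ) (x : ℝ) (hx : x ∈ Ici a) : |φ (x + p * L) - φ x| ≤ g x ∧
      |φ' (x + p * L) - φ' x| ≤ g x ∧ |φ'' (x + p * L) - φ'' x| ≤ g x := by
    have hw'' (x : ℝ) (hx : x ∈ Ici a) :
        φ'' (x + p * L) - φ'' x = f (x, φ (x + p * L)) - f (x, φ x) := by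
      rw [heq _ (hnhds (hshift p hx)).1, heq _ (hnhds hx).1, hfper]
    refine decay_of_mul_sq_le_mul_deriv_deriv (w := fun x => φ (x + p * L) - φ x)
      (w' := fun x => φ' (x + p * L) - φ' x) (w'' := fun x => φ'' (x + p * L) - φ'' x)
      hpos hK0
      (fun y hy => ((hD1 _ (hshift p hy)).comp_add_const y (p * L)).sub (hD1 y hy))
      (fun y hy => ((hD2 _ (hshift p hy)).comp_add_const y (p * L)).sub (hD2 y hy))
      (fun y hy => ?_) (fun y hy => ?_) (fun y hy => ?_) x hx
    all_goals have m1 := hφmem _ (hnhds (hshift p hy)).1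
    all_goals have m2 := hφmem _ (hnhds hy).1
    · rw [hw'' y hy]
      exact mul_sq_le_of_le_hasDerivAt (hderiv y) (hδ y) m1 m2
    · rw [hw'' y hy]
      exact (convex_Icc m M).norm_image_sub_le_of_norm_hasDerivWithin_le
        (fun z _ => (hderiv y z).hasDerivWithinAt) (hK y) m2 m1
    · have b1 := abs_le.1 (hC _ (hnhds (hshift p hy)).1)
      have b2 := abs_le.1 (hC _ (hnhds hy).1)
      exact abs_le.2 ⟨by linarith [b1.1, b2.2], by linarith [b1.2, b2.1]⟩
  obtain ⟨ϕ, hϕ, hϕL, hϕg⟩ := exists_tendsto_translates hL hg0 fun p x hx => (hdecay p x hx).1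
  obtain ⟨ϕ', hϕ', hϕ'L, hϕ'g⟩ :=
    exists_tendsto_translates hL hg0 fun p x hx => (hdecay p x hx).2.1
  obtain ⟨ϕ'', hϕ'', hϕ''L, hϕ''g⟩ :=
    exists_tendsto_translates hL hg0 fun p x hx => (hdecay p x hx).2.2
  have hE1 := hasDerivAt_of_tendsto_translates hL hg0 hD1 hϕ hϕ'L hϕ'g
  have hE2 := hasDerivAt_of_tendsto_translates hL hg0 hD2 hϕ' hϕ''L hϕ''g
  have hcont : Continuous ϕ := continuous_iff_continuousAt.2 fun x => (hE1 x).continuousAt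
  have hode (x : ℝ) : ϕ'' x = f (x, ϕ x) := by
    refine tendsto_nhds_unique (hϕ'' x)
      (((hf.tendsto (x, ϕ x)).comp (tendsto_const_nhds.prodMk_nhds (hϕ x))).congr' ?_)
    have htr : Tendsto (fun n : ℕ => x + n * L) atTop atTop :=
      tendsto_atTop_add_const_left _ _ (tendsto_natCast_atTop_atTop.atTop_mul_const hL)
    filter_upwards [htr.eventually_ge_atTop x₀] with n hn
    rw [heq _ hn, hfper]
    rfl
  have hderiv1 : deriv ϕ = ϕ' := funext fun x => (hE1 x).deriv
  have hderiv2 : deriv ϕ' = fun x => f (x, ϕ x) := funext fun x => (hE2 x).deriv.trans (hode x)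
  refine ⟨ϕ, ?_, fun x => by rw [hderiv1, hderiv2], hϕL, ?_⟩
  · rw [show (2 : WithTop ℕ∞) = 1 + 1 by norm_num, contDiff_succ_iff_deriv, hderiv1,
      contDiff_one_iff_deriv, hderiv2]
    exact ⟨fun x => (hE1 x).differentiableAt, by simp, fun x => (hE2 x).differentiableAt,
      by fun_prop⟩
  · rw [hderiv1]
    refine squeeze_zero' (Eventually.of_forall fun x => by positivity) ?_
      (by simpa using hg0.add hg0)
    filter_upwards [eventually_ge_atTop a] with x hx
    exact add_le_add (hϕg x hx) (hϕ'g x hx)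
end

section
/- Let f : ℝ × ℝ → ℝ be continuous and let α, β : [x₀, +∞) → ℝ be bounded C² functions such that (1) α(x) < β(x) for all x > x₀, and (2) α''(x) > f(x, α(x)) and β''(x) < f(x, β(x)) for all x > x₀ (α is a lower solution and β is an upper solution). Then there exists a C² solution φ of φ'' = f(x, φ) on [x₀, +∞) with α(x) < φ(x) < β(x) for all x > x₀. -/
open Set

open Filter Topology

/-- The function with value `a` and slope `s` at `x₀` and second derivative `g`. -/
noncomputable def doublePrimitive (x₀ a s : ℝ) (g : ℝ → ℝ) (x : ℝ) : ℝ :=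
  a + s * (x - x₀) + ∫ t in x₀..x, (x - t) * g t

theorem doublePrimitive_congr {x₀ x : ℝ} (hx : x₀ ≤ x) (a s : ℝ) {g h : ℝ → ℝ}
    (hgh : ∀ t ∈ Icc x₀ x, g t = h t) :
    doublePrimitive x₀ a s g x = doublePrimitive x₀ a s h x := by
  refine congrArg (a + s * (x - x₀) + ·) (intervalIntegral.integral_congr fun t ht => ?_)
  rw [uIcc_of_le hx] at ht
  exact congrArg ((x - t) * ·) (hgh t ht)

theorem hasDerivAt_add_integral {g : ℝ → ℝ} (hg : Continuous g) (x₀ s x : ℝ) :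
    HasDerivAt (fun x => s + ∫ t in x₀..x, g t) (g x) x :=
  (hg.integral_hasStrictDerivAt x₀ x).hasDerivAt.const_add s

theorem hasDerivAt_doublePrimitive {g : ℝ → ℝ} (hg : Continuous g) (x₀ a s x : ℝ) :
    HasDerivAt (doublePrimitive x₀ a s g) (s + ∫ t in x₀..x, g t) x := by
  have heq : doublePrimitive x₀ a s g =
      fun x => a + s * (x - x₀) + (x * (∫ t in x₀..x, g t) - ∫ t in x₀..x, t * g t) := by
    funext x
    have hsub : ∫ t in x₀..x, (x - t) * g t =
        x * (∫ t in x₀..x, g t) - ∫ t in x₀..x, t * g t := by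
      rw [← intervalIntegral.integral_const_mul, ← intervalIntegral.integral_sub]
      · simp only [sub_mul]
      · exact (continuous_const.mul hg).intervalIntegrable _ _
      · exact (continuous_id.mul hg).intervalIntegrable _ _
    rw [doublePrimitive, hsub]
  rw [heq]
  have h₁ := (hg.integral_hasStrictDerivAt x₀ x).hasDerivAt
  have h₂ := ((continuous_id.mul hg).integral_hasStrictDerivAt x₀ x).hasDerivAt
  have h₃ : HasDerivAt (fun x => a + s * (x - x₀)) s x := by
    simpa using (((hasDerivAt_id x).sub_const x₀).const_mul s).const_add a
  refine (h₃.add (((hasDerivAt_id x).mul h₁).sub h₂)).congr_deriv ?_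
  simp

theorem abs_doublePrimitive_sub_le {g : ℝ → ℝ} (hg : Continuous g) {x₀ a s T C : ℝ}
    (hs : |s| ≤ C) (hgC : ∀ t ∈ Icc x₀ T, |g t| ≤ C) {x y : ℝ}
    (hx : x ∈ Icc x₀ T) (hy : y ∈ Icc x₀ T) :
    |doublePrimitive x₀ a s g y - doublePrimitive x₀ a s g x| ≤ (C + C * (T - x₀)) * |y - x| := by
  refine Convex.norm_image_sub_le_of_norm_hasDerivWithin_le (𝕜 := ℝ)
    (fun z _ => (hasDerivAt_doublePrimitive hg x₀ a s z).hasDerivWithinAt) ?_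
    (convex_Icc x₀ T) hx hy
  intro z hz
  have hC : 0 ≤ C := (abs_nonneg s).trans hs
  refine (norm_add_le _ _).trans (add_le_add hs ?_)
  refine (intervalIntegral.norm_integral_le_of_norm_le_const (C := C) fun t ht => ?_).trans ?_
  · rw [uIoc_of_le hz.1] at ht
    exact hgC t ⟨ht.1.le, ht.2.trans hz.2⟩
  · rw [abs_of_nonneg (by linarith [hz.1])]
    exact mul_le_mul_of_nonneg_left (by linarith [hz.2]) hC

theorem abs_integral_sub_mul_le {g : ℝ → ℝ} {x₀ x M : ℝ} (hx : x₀ ≤ x)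
    (hg : ∀ t ∈ Icc x₀ x, |g t| ≤ M) :
    |∫ t in x₀..x, (x - t) * g t| ≤ (x - x₀) * M * (x - x₀) := by
  have := intervalIntegral.norm_integral_le_of_norm_le_const (a := x₀) (b := x)
    (f := fun t => (x - t) * g t) (C := (x - x₀) * M) fun t ht => ?_
  · rwa [abs_of_nonneg (sub_nonneg.2 hx)] at this
  · rw [uIoc_of_le hx] at ht
    rw [norm_mul, Real.norm_eq_abs, Real.norm_eq_abs, abs_of_nonneg (by linarith [ht.2])]
    exact mul_le_mul (by linarith [ht.1]) (hg t ⟨ht.1.le, ht.2⟩) (abs_nonneg _) (by linarith)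

theorem Ultrafilter.exists_tendsto_of_eventually_abs_le {ι : Type*} (l : Ultrafilter ι)
    {u : ι → ℝ} {C : ℝ} (hu : ∀ᶠ n in l, |u n| ≤ C) : ∃ c, Tendsto u l (𝓝 c) := by
  obtain ⟨c, -, hc⟩ := (isCompact_Icc (a := -C) (b := C)).ultrafilter_le_nhds (l.map u)
    (le_principal_iff.2 (hu.mono fun n hn => abs_le.1 hn))
  exact ⟨c, hc⟩

theorem tendsto_intervalIntegral_of_tendstoUniformlyOn {ι : Type*} {l : Filter ι} {a b : ℝ}
    (hab : a ≤ b) {g : ι → ℝ → ℝ} {h : ℝ → ℝ} (hg : ∀ n, Continuous (g n)) (hh : Continuous h)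
    (hlim : TendstoUniformlyOn g h l (Icc a b)) :
    Tendsto (fun n => ∫ t in a..b, g n t) l (𝓝 (∫ t in a..b, h t)) := by
  rw [Metric.tendsto_nhds]
  intro ε hε
  have hδ : 0 < ε / (b - a + 1) := div_pos hε (by linarith)
  filter_upwards [Metric.tendstoUniformlyOn_iff.1 hlim _ hδ] with n hn
  rw [dist_eq_norm, ← intervalIntegral.integral_sub ((hg n).intervalIntegrable _ _)
    (hh.intervalIntegrable _ _)]
  have hle := intervalIntegral.norm_integral_le_of_norm_le_const (a := a) (b := b)
    (f := fun t => g n t - h t) (C := ε / (b - a + 1)) fun t ht => by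
      rw [uIoc_of_le hab] at ht
      rw [← dist_eq_norm, dist_comm]
      exact (hn t ⟨ht.1.le, ht.2⟩).le
  rw [abs_of_nonneg (sub_nonneg.2 hab)] at hle
  refine hle.trans_lt ?_
  calc ε / (b - a + 1) * (b - a) < ε / (b - a + 1) * (b - a + 1) :=
        mul_lt_mul_of_pos_left (by linarith) hδ
    _ = ε := div_mul_cancel₀ _ (by linarith)

/-- Compactness of approximate solutions of `φ'' = F (x, φ)` along an ultrafilter. -/
theorem exists_limit_doublePrimitive {ι : Type*} (l : Ultrafilter ι) {x₀ a : ℝ} {F : ℝ × ℝ → ℝ}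
    (hF : Continuous F) {φ ψ : ι → ℝ → ℝ} {s : ι → ℝ} (hψ : ∀ n, Continuous (ψ n))
    (hbound : ∀ T, ∃ C, ∀ᶠ n in l, |s n| ≤ C ∧ ∀ x ∈ Icc x₀ T, |F (x, ψ n x)| ≤ C)
    (hsol : ∀ T, ∀ᶠ n in l, ∀ x ∈ Icc x₀ T,
      φ n x = doublePrimitive x₀ a (s n) (fun t => F (t, ψ n t)) x)
    (hclose : ∀ T, ∀ ε > 0, ∀ᶠ n in l, ∀ x ∈ Icc x₀ T, |ψ n x - φ n x| < ε) :
    ∃ (u : ℝ → ℝ) (σ : ℝ), Continuous u ∧ (∀ x, x₀ ≤ x → Tendsto (φ · x) l (𝓝 (u x))) ∧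
      ∀ x, x₀ ≤ x → u x = doublePrimitive x₀ a σ (fun t => F (t, u t)) x := by
  have hcont : ∀ n, Continuous fun t => F (t, ψ n t) := fun n =>
    hF.comp (continuous_id.prodMk (hψ n))
  have hlip : ∀ T, ∃ K, 0 ≤ K ∧ ∀ᶠ n in l, ∀ x ∈ Icc x₀ T, ∀ y ∈ Icc x₀ T,
      |φ n y - φ n x| ≤ K * |y - x| := by
    intro T
    obtain ⟨C, hC⟩ := hbound T
    refine ⟨|C + C * (T - x₀)|, abs_nonneg _, ?_⟩
    filter_upwards [hC, hsol T] with n hn hn' x hx y hy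
    rw [hn' x hx, hn' y hy]
    exact (abs_doublePrimitive_sub_le (hcont n) hn.1 hn.2 hx hy).trans
      (mul_le_mul_of_nonneg_right (le_abs_self _) (abs_nonneg _))
  obtain ⟨σ, hσ⟩ : ∃ σ, Tendsto s l (𝓝 σ) := by
    obtain ⟨C, hC⟩ := hbound x₀
    exact l.exists_tendsto_of_eventually_abs_le (hC.mono fun n hn => hn.1)
  have hpt : ∀ x, ∃ c, x₀ ≤ x → Tendsto (φ · x) l (𝓝 c) := by
    intro x
    by_cases hx : x₀ ≤ x
    · obtain ⟨K, -, hK⟩ := hlip x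
      obtain ⟨c, hc⟩ := l.exists_tendsto_of_eventually_abs_le (u := (φ · x))
        (C := |a| + K * |x - x₀|) (by
          filter_upwards [hK, hsol x] with n hn hn'
          have h₁ := hn x₀ ⟨le_rfl, hx⟩ x ⟨hx, le_rfl⟩
          have h₂ : φ n x₀ = a := by
            rw [hn' x₀ ⟨le_rfl, hx⟩]; simp [doublePrimitive]
          rw [h₂] at h₁
          have h₃ := abs_add_le a (φ n x - a)
          rw [add_sub_cancel] at h₃
          linarith)
      exact ⟨c, fun _ => hc⟩
    · exact ⟨0, fun h => absurd h hx⟩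
  choose v hv using hpt
  have hvlip : ∀ T, ∃ K, ∀ x ∈ Icc x₀ T, ∀ y ∈ Icc x₀ T, |v y - v x| ≤ K * |y - x| := by
    intro T
    obtain ⟨K, -, hK⟩ := hlip T
    exact ⟨K, fun x hx y hy => le_of_tendsto ((hv y hy.1).sub (hv x hx.1)).abs
      (hK.mono fun n hn => hn x hx y hy)⟩
  have hvcont : ContinuousOn v (Ici x₀) := by
    intro x hx
    obtain ⟨K, hK⟩ := hvlip (x + 1)
    have hxm : x ∈ Icc x₀ (x + 1) := ⟨hx, by linarith⟩
    have h₁ : ContinuousWithinAt v (Icc x₀ (x + 1)) x := by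
      refine (LipschitzOnWith.of_dist_le_mul (K := K.toNNReal) fun y hy z hz => ?_).continuousOn
        x hxm
      exact (hK z hz y hy).trans
        (mul_le_mul_of_nonneg_right (Real.le_coe_toNNReal K) (abs_nonneg _))
    refine h₁.mono_of_mem_nhdsWithin ?_
    rw [← Ici_inter_Iic]
    exact inter_mem_nhdsWithin _ (Iic_mem_nhds (by linarith))
  set u : ℝ → ℝ := fun x => v (max x₀ x) with hu
  have huv : ∀ x, x₀ ≤ x → u x = v x := fun x hx => by rw [hu]; simp [hx]
  have hucont : Continuous u :=
    hvcont.comp_continuous (continuous_const.max continuous_id) fun x => mem_Ici.2 (le_max_left _ _)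
  have hulim : ∀ x, x₀ ≤ x → Tendsto (φ · x) l (𝓝 (u x)) := fun x hx => by
    rw [huv x hx]; exact hv x hx
  refine ⟨u, σ, hucont, hulim, fun X hX => ?_⟩
  have hψlim : ∀ x ∈ Icc x₀ X,
      Tendsto (fun p : ι × ℝ => ψ p.1 p.2) (l ×ˢ 𝓝[Icc x₀ X] x) (𝓝 (u x)) := by
    intro x hx
    obtain ⟨K, hK₀, hK⟩ := hlip X
    rw [Metric.tendsto_nhds]
    intro ε hε
    have e₁ := (hclose X (ε / 3) (by positivity)).and
      (hK.and (Metric.tendsto_nhds.1 (hulim x hx.1) (ε / 3) (by positivity)))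
    have e₂ : ∀ᶠ t in 𝓝[Icc x₀ X] x, K * |t - x| < ε / 3 := by
      have hc : Continuous fun t => K * |t - x| := by fun_prop
      exact (hc.tendsto x).mono_left nhdsWithin_le_nhds |>.eventually_lt_const (by simp; linarith)
    filter_upwards [e₁.prod_mk (e₂.and self_mem_nhdsWithin)]
    rintro ⟨n, t⟩ ⟨⟨h₁, h₂, h₃⟩, h₄, h₅⟩
    have h₆ := h₁ t h₅
    have h₇ := h₂ x hx t h₅
    rw [Real.dist_eq] at h₃ ⊢
    calc |ψ n t - u x| ≤ |ψ n t - φ n t| + |φ n t - φ n x| + |φ n x - u x| := by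
          have h := abs_add_three (ψ n t - φ n t) (φ n t - φ n x) (φ n x - u x)
          rwa [show ψ n t - φ n t + (φ n t - φ n x) + (φ n x - u x) = ψ n t - u x by ring] at h
      _ < ε := by linarith
  have hint : Tendsto (fun n => ∫ t in x₀..X, (X - t) * F (t, ψ n t)) l
      (𝓝 (∫ t in x₀..X, (X - t) * F (t, u t))) := by
    refine tendsto_intervalIntegral_of_tendstoUniformlyOn hX
      (fun n => (continuous_const.sub continuous_id).mul (hcont n))
      ((continuous_const.sub continuous_id).mul (hF.comp (continuous_id.prodMk hucont))) ?_
    rw [← tendstoLocallyUniformlyOn_iff_tendstoUniformlyOn_of_compact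
      isCompact_Icc, tendstoLocallyUniformlyOn_iff_forall_tendsto]
    intro x hx
    have hsnd : Tendsto (fun p : ι × ℝ => p.2) (l ×ˢ 𝓝[Icc x₀ X] x) (𝓝 x) :=
      tendsto_snd.mono_right nhdsWithin_le_nhds
    have h₁ := (hsnd.const_sub X).mul
      ((hF.tendsto (x, u x)).comp (hsnd.prodMk_nhds (hψlim x hx)))
    have h₂ := (hsnd.const_sub X).mul
      ((hF.tendsto (x, u x)).comp (hsnd.prodMk_nhds ((hucont.tendsto x).comp hsnd)))
    exact (h₂.prodMk_nhds h₁).mono_right (nhds_le_uniformity _)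
  refine tendsto_nhds_unique (hulim X hX) (Tendsto.congr' ?_
    (((hσ.mul_const (X - x₀)).const_add a).add hint))
  filter_upwards [hsol X] with n hn
  exact (hn X ⟨hX, le_rfl⟩).symm

/-- Tonelli's iterates for `φ'' = F (x, φ)` with delay `δ`: the `k`-th one solves the delayed
equation on `[x₀, x₀ + k δ]`. -/
noncomputable def delayedIterate (F : ℝ × ℝ → ℝ) (x₀ a δ : ℝ) : ℕ → ℝ → ℝ → ℝ
  | 0 => fun _ _ => a
  | k + 1 => fun s => doublePrimitive x₀ a s
      fun t => F (t, delayedIterate F x₀ a δ k s (max x₀ (t - δ)))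

theorem continuous_delayedIterate {F : ℝ × ℝ → ℝ} (hF : Continuous F) (x₀ a δ : ℝ) (k : ℕ) :
    Continuous fun p : ℝ × ℝ => delayedIterate F x₀ a δ k p.1 p.2 := by
  induction k with
  | zero => exact continuous_const
  | succ k ih =>
    simp only [delayedIterate, doublePrimitive]
    refine Continuous.add (by fun_prop) ?_
    refine intervalIntegral.continuous_parametric_intervalIntegral_of_continuous
      (f := fun (p : ℝ × ℝ) t =>
        (p.2 - t) * F (t, delayedIterate F x₀ a δ k p.1 (max x₀ (t - δ)))) ?_ continuous_snd
    have h : Continuous fun q : (ℝ × ℝ) × ℝ =>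
        delayedIterate F x₀ a δ k q.1.1 (max x₀ (q.2 - δ)) :=
      ih.comp (f := fun q : (ℝ × ℝ) × ℝ => (q.1.1, max x₀ (q.2 - δ))) (by fun_prop)
    simp only [Function.uncurry_def]
    fun_prop

theorem delayedIterate_succ_eq (F : ℝ × ℝ → ℝ) (x₀ a : ℝ) {δ : ℝ} (hδ : 0 ≤ δ) (s : ℝ) (k : ℕ) :
    ∀ x, x₀ ≤ x → x ≤ x₀ + k * δ →
      delayedIterate F x₀ a δ (k + 1) s x = delayedIterate F x₀ a δ k s x := by
  induction k with
  | zero =>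
    intro x h₁ h₂
    obtain rfl : x = x₀ := by simp at h₂; linarith
    simp [delayedIterate, doublePrimitive]
  | succ k ih =>
    intro x h₁ h₂
    have hk : x ≤ x₀ + k * δ + δ := by push_cast at h₂; linarith
    refine doublePrimitive_congr h₁ a s fun t ht => ?_
    rw [ih (max x₀ (t - δ)) (le_max_left _ _) (max_le (by linarith [mul_nonneg k.cast_nonneg hδ])
      (by linarith [ht.2]))]

/-- The Dirichlet problem for `φ'' = F (x, φ)` with `F` bounded is solvable. -/
theorem exists_doublePrimitive_eq_of_bounded {F : ℝ × ℝ → ℝ} (hF : Continuous F) {M : ℝ}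
    (hM : ∀ p, |F p| ≤ M) {x₀ T : ℝ} (hT : x₀ < T) (a b : ℝ) :
    ∃ (u : ℝ → ℝ) (σ : ℝ), Continuous u ∧ u T = b ∧
      ∀ x, x₀ ≤ x → u x = doublePrimitive x₀ a σ (fun t => F (t, u t)) x := by
  have hL : 0 < T - x₀ := sub_pos.2 hT
  set S : ℝ := (|b - a| + (T - x₀) * M * (T - x₀)) / (T - x₀)
  have hSL : S * (T - x₀) = |b - a| + (T - x₀) * M * (T - x₀) := div_mul_cancel₀ _ hL.ne'
  have hM₀ : 0 ≤ M := (abs_nonneg _).trans (hM 0)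
  have hS₀ : 0 ≤ S := by positivity
  have hshoot : ∀ (δ : ℝ) (k : ℕ), ∃ s, |s| ≤ S ∧ delayedIterate F x₀ a δ (k + 1) s T = b := by
    intro δ k
    have hc : Continuous fun s => delayedIterate F x₀ a δ (k + 1) s T :=
      (continuous_delayedIterate hF x₀ a δ (k + 1)).comp (continuous_id.prodMk continuous_const)
    have hb : ∀ s, |∫ t in x₀..T, (T - t) * F (t, delayedIterate F x₀ a δ k s (max x₀ (t - δ)))|
        ≤ (T - x₀) * M * (T - x₀) := fun s =>
      abs_integral_sub_mul_le hT.le fun t _ => hM _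
    have hba := abs_le.1 (le_refl |b - a|)
    obtain ⟨s, hs, hsb⟩ := intermediate_value_Icc (by linarith : -S ≤ S) hc.continuousOn
      (show b ∈ Icc _ _ from ⟨by
        have := (abs_le.1 (hb (-S))).2
        simp only [delayedIterate, doublePrimitive]
        linarith, by
        have := (abs_le.1 (hb S)).1
        simp only [delayedIterate, doublePrimitive]
        linarith⟩)
    exact ⟨s, abs_le.2 hs, hsb⟩
  let δ : ℕ → ℝ := fun n => 1 / ((n : ℝ) + 1)
  have hδ : ∀ n, 0 < δ n := fun n => Nat.one_div_pos_of_nat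
  choose s hs hsb using fun n : ℕ => hshoot (δ n) ((n + 1) ^ 2)
  have hl : (hyperfilter ℕ : Filter ℕ) ≤ atTop := by
    rw [← Nat.cofinite_eq_atTop]; exact hyperfilter_le_cofinite
  let ψ : ℕ → ℝ → ℝ := fun n t =>
    delayedIterate F x₀ a (δ n) ((n + 1) ^ 2) (s n) (max x₀ (t - δ n))
  have hψ : ∀ n, Continuous (ψ n) := fun n => by
    have h : Continuous fun t => (s n, max x₀ (t - δ n)) := by fun_prop
    exact (continuous_delayedIterate hF x₀ a (δ n) ((n + 1) ^ 2)).comp h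
  obtain ⟨u, σ, hu, hlim, hsol⟩ := exists_limit_doublePrimitive (hyperfilter ℕ) (x₀ := x₀) (a := a)
    hF (φ := fun n => delayedIterate F x₀ a (δ n) ((n + 1) ^ 2 + 1) (s n)) (ψ := ψ) (s := s) hψ
    (fun T => ⟨max S M, Eventually.of_forall fun n =>
      ⟨(hs n).trans (le_max_left _ _), fun x _ => (hM _).trans (le_max_right _ _)⟩⟩)
    (fun T => Eventually.of_forall fun n x _ => rfl) (by
      intro T ε hε
      set C := max S M
      have hCnn : 0 ≤ C := hS₀.trans (le_max_left _ _)
      have e₁ : ∀ᶠ n : ℕ in atTop, T - x₀ ≤ n :=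
        tendsto_natCast_atTop_atTop.eventually_ge_atTop _
      have e₂ : ∀ᶠ n : ℕ in atTop, (C + C * |T - x₀|) * δ n < ε := by
        have := (tendsto_one_div_add_atTop_nhds_zero_nat (𝕜 := ℝ)).const_mul (C + C * |T - x₀|)
        rw [mul_zero] at this
        exact this.eventually_lt_const hε
      filter_upwards [hl e₁, hl e₂] with n h₁ h₂ x hx
      have hmx : max x₀ (x - δ n) ≤ x := max_le hx.1 (by linarith [hδ n])
      have hm : max x₀ (x - δ n) ∈ Icc x₀ T := ⟨le_max_left _ _, hmx.trans hx.2⟩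
      have hkδ : ((((n + 1) ^ 2 : ℕ) : ℝ)) * δ n = n + 1 := by
        simp only [δ]; push_cast; field_simp
      have hψφ : ψ n x =
          delayedIterate F x₀ a (δ n) ((n + 1) ^ 2 + 1) (s n) (max x₀ (x - δ n)) :=
        (delayedIterate_succ_eq F x₀ a (hδ n).le (s n) _ _ hm.1
          (by rw [hkδ]; linarith [hm.2])).symm
      rw [hψφ]
      refine lt_of_le_of_lt (abs_doublePrimitive_sub_le (C := C)
        (hF.comp (continuous_id.prodMk (hψ n))) ((hs n).trans (le_max_left _ _))
        (fun t _ => (hM _).trans (le_max_right _ _)) hx hm) (lt_of_le_of_lt ?_ h₂)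
      refine mul_le_mul ?_ ?_ (abs_nonneg _) (by positivity)
      · gcongr
        exact le_abs_self _
      · rw [abs_sub_comm, abs_of_nonneg (by linarith)]
        linarith [le_max_right x₀ (x - δ n)])
  refine ⟨u, σ, hu, tendsto_nhds_unique (hlim T hT.le) ?_, hsol⟩
  simp only [hsb]
  exact tendsto_const_nhds

theorem IsLocalMin.nonneg_of_hasDerivAt {w w' : ℝ → ℝ} {x c : ℝ} (hmin : IsLocalMin w x)
    (hw : ∀ᶠ y in 𝓝 x, HasDerivAt w (w' y) y) (hw' : HasDerivAt w' c x) : 0 ≤ c := by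
  by_contra! hc
  have hd : deriv w =ᶠ[𝓝 x] w' := hw.mono fun y hy => hy.deriv
  have hdd : deriv (deriv w) x = c := hd.deriv_eq.trans hw'.deriv
  have hmax : IsLocalMax w x := isLocalMax_of_deriv_deriv_neg (by rwa [hdd]) hmin.deriv_eq_zero
    hw.self_of_nhds.continuousAt
  have hconst : w =ᶠ[𝓝 x] fun _ => w x := by
    filter_upwards [hmin, hmax] with y h₁ h₂ using le_antisymm h₂ h₁
  have hzero : deriv w =ᶠ[𝓝 x] fun _ => 0 := by simpa using hconst.deriv
  have : deriv (deriv w) x = 0 := by simpa using hzero.deriv_eq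
  linarith

theorem nonneg_of_no_neg_isLocalMin {w : ℝ → ℝ} {a b : ℝ} (hw : ContinuousOn w (Icc a b))
    (ha : 0 ≤ w a) (hb : 0 ≤ w b) (h : ∀ x ∈ Ioo a b, IsLocalMin w x → 0 ≤ w x) :
    ∀ x ∈ Icc a b, 0 ≤ w x := by
  intro x hx
  obtain ⟨y, hy, hmin⟩ := isCompact_Icc.exists_isMinOn ⟨x, hx⟩ hw
  refine le_trans ?_ (hmin hx)
  rcases hy.1.eq_or_lt with rfl | h₁
  · exact ha
  rcases hy.2.eq_or_lt with rfl | h₂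
  · exact hb
  exact h y ⟨h₁, h₂⟩ (hmin.isLocalMin (Icc_mem_nhds h₁ h₂))

/-- Second-order comparison at an interior point where `u - γ` has a local minimum. -/
theorem le_of_isLocalMin_sub {x₀ a s x T : ℝ} {g u γ γ' γ'' : ℝ → ℝ} (hg : Continuous g)
    (hu : ∀ x ∈ Icc x₀ T, u x = doublePrimitive x₀ a s g x) (hx : x ∈ Ioo x₀ T)
    (hγ : ∀ x ∈ Ici x₀, HasDerivWithinAt γ (γ' x) (Ici x₀) x)
    (hγ' : ∀ x ∈ Ici x₀, HasDerivWithinAt γ' (γ'' x) (Ici x₀) x)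
    (hmin : IsLocalMin (fun x => u x - γ x) x) : γ'' x ≤ g x := by
  refine sub_nonneg.1 (hmin.nonneg_of_hasDerivAt
    (w' := fun y => (s + ∫ t in x₀..y, g t) - γ' y) ?_
    ((hasDerivAt_add_integral hg x₀ s x).sub
      ((hγ' x hx.1.le).hasDerivAt (Ici_mem_nhds hx.1))))
  filter_upwards [Ioo_mem_nhds hx.1 hx.2] with y hy
  refine HasDerivAt.sub ?_ ((hγ y hy.1.le).hasDerivAt (Ici_mem_nhds hy.1))
  refine (hasDerivAt_doublePrimitive hg x₀ a s y).congr_of_eventuallyEq ?_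
  filter_upwards [Icc_mem_nhds hy.1 hy.2] with z hz using hu z hz

theorem doublePrimitive_neg (x₀ a s : ℝ) (g : ℝ → ℝ) (x : ℝ) :
    doublePrimitive x₀ (-a) (-s) (fun t => -g t) x = -doublePrimitive x₀ a s g x := by
  simp only [doublePrimitive, mul_neg, intervalIntegral.integral_neg]
  ring

/-- Second-order comparison at an interior point where `γ - u` has a local minimum. -/
theorem ge_of_isLocalMin_sub {x₀ a s x T : ℝ} {g u γ γ' γ'' : ℝ → ℝ} (hg : Continuous g)
    (hu : ∀ x ∈ Icc x₀ T, u x = doublePrimitive x₀ a s g x) (hx : x ∈ Ioo x₀ T)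
    (hγ : ∀ x ∈ Ici x₀, HasDerivWithinAt γ (γ' x) (Ici x₀) x)
    (hγ' : ∀ x ∈ Ici x₀, HasDerivWithinAt γ' (γ'' x) (Ici x₀) x)
    (hmin : IsLocalMin (fun x => γ x - u x) x) : g x ≤ γ'' x := by
  have := le_of_isLocalMin_sub (u := fun x => -u x) (γ := fun x => -γ x) (γ' := fun x => -γ' x)
    (γ'' := fun x => -γ'' x) (g := fun x => -g x) (a := -a) (s := -s) hg.neg
    (fun y hy => by rw [doublePrimitive_neg, hu y hy]) hx (fun y hy => (hγ y hy).neg)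
    (fun y hy => (hγ' y hy).neg) (by simpa [neg_add_eq_sub] using hmin)
  linarith

/-- Solvability on a compact interval between a lower and an upper solution. -/
theorem exists_solution_between_on_Icc {x₀ T C : ℝ} {f : ℝ × ℝ → ℝ} (hf : Continuous f)
    {α β αd αdd βd βdd : ℝ → ℝ} (hT : x₀ < T)
    (hαC : ∀ x ∈ Ici x₀, |α x| ≤ C) (hβC : ∀ x ∈ Ici x₀, |β x| ≤ C)
    (hαd : ∀ x ∈ Ici x₀, HasDerivWithinAt α (αd x) (Ici x₀) x)
    (hαdd : ∀ x ∈ Ici x₀, HasDerivWithinAt αd (αdd x) (Ici x₀) x)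
    (hβd : ∀ x ∈ Ici x₀, HasDerivWithinAt β (βd x) (Ici x₀) x)
    (hβdd : ∀ x ∈ Ici x₀, HasDerivWithinAt βd (βdd x) (Ici x₀) x)
    (hord : ∀ x ∈ Ici x₀, α x ≤ β x)
    (hlow : ∀ x, x₀ < x → αdd x > f (x, α x))
    (hupp : ∀ x, x₀ < x → βdd x < f (x, β x)) :
    ∃ (u : ℝ → ℝ) (σ : ℝ), Continuous u ∧ ∀ x ∈ Icc x₀ T, (α x ≤ u x ∧ u x ≤ β x) ∧
      u x = doublePrimitive x₀ (α x₀) σ (fun t => f (t, u t)) x := by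
  have hαc : ContinuousOn α (Ici x₀) := fun x hx => (hαd x hx).continuousWithinAt
  have hβc : ContinuousOn β (Ici x₀) := fun x hx => (hβd x hx).continuousWithinAt
  let p : ℝ → ℝ := fun x => max x₀ (min T x)
  have hp : Continuous p := by fun_prop
  have hpm : ∀ x, p x ∈ Icc x₀ T := fun x =>
    ⟨le_max_left _ _, max_le hT.le (min_le_left _ _)⟩
  have hpid : ∀ x ∈ Icc x₀ T, p x = x := fun x hx => by
    simp only [p]; rw [min_eq_right hx.2, max_eq_right hx.1]
  have hαp : Continuous fun x => α (p x) := hαc.comp_continuous hp fun x => (hpm x).1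
  have hβp : Continuous fun x => β (p x) := hβc.comp_continuous hp fun x => (hpm x).1
  let F : ℝ × ℝ → ℝ := fun q => f (p q.1, max (α (p q.1)) (min (β (p q.1)) q.2))
  have hF : Continuous F := by
    have h₁ := hαp.comp (continuous_fst (X := ℝ) (Y := ℝ))
    have h₂ := hβp.comp (continuous_fst (X := ℝ) (Y := ℝ))
    exact hf.comp ((hp.comp continuous_fst).prodMk (h₁.max (h₂.min continuous_snd)))
  obtain ⟨M, hM⟩ := (isCompact_Icc.prod isCompact_Icc :
    IsCompact (Icc x₀ T ×ˢ Icc (-C) C)).exists_bound_of_continuousOn hf.continuousOn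
  have hFM : ∀ q, |F q| ≤ M := fun q => by
    have h₁ := abs_le.1 (hαC _ (hpm q.1).1)
    have h₂ := abs_le.1 (hβC _ (hpm q.1).1)
    exact hM _ ⟨hpm _, le_max_of_le_left h₁.1, max_le h₁.2 ((min_le_left _ _).trans h₂.2)⟩
  obtain ⟨u, σ, hu, huT, hsol⟩ := exists_doublePrimitive_eq_of_bounded hF hFM hT (α x₀) (α T)
  have hux₀ : u x₀ = α x₀ := by rw [hsol x₀ le_rfl]; simp [doublePrimitive]
  have hg : Continuous fun t => F (t, u t) := hF.comp (continuous_id.prodMk hu)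
  have hFeq : ∀ x ∈ Icc x₀ T, ∀ y, F (x, y) = f (x, max (α x) (min (β x) y)) := fun x hx y => by
    simp only [F, hpid x hx]
  have hlo : ∀ x ∈ Icc x₀ T, 0 ≤ u x - α x := by
    refine nonneg_of_no_neg_isLocalMin
      (hu.continuousOn.sub (hαc.mono Icc_subset_Ici_self)) (by linarith) (by linarith) ?_
    intro x hx hmin
    by_contra! hneg
    have h := le_of_isLocalMin_sub hg (fun y hy => hsol y hy.1) hx hαd hαdd hmin
    rw [hFeq x ⟨hx.1.le, hx.2.le⟩,
      max_eq_left ((min_le_right _ _).trans (by linarith))] at h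
    exact (hlow x hx.1).not_ge h
  have hhi : ∀ x ∈ Icc x₀ T, 0 ≤ β x - u x := by
    refine nonneg_of_no_neg_isLocalMin
      ((hβc.mono Icc_subset_Ici_self).sub hu.continuousOn)
      (by linarith [hord x₀ self_mem_Ici]) (by linarith [hord T hT.le]) ?_
    intro x hx hmin
    by_contra! hneg
    have h := ge_of_isLocalMin_sub hg (fun y hy => hsol y hy.1) hx hβd hβdd hmin
    rw [hFeq x ⟨hx.1.le, hx.2.le⟩, min_eq_left (by linarith),
      max_eq_right (hord x hx.1.le)] at h
    exact (hupp x hx.1).not_ge h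
  refine ⟨u, σ, hu, fun x hx => ⟨⟨sub_nonneg.1 (hlo x hx), sub_nonneg.1 (hhi x hx)⟩, ?_⟩⟩
  rw [hsol x hx.1]
  refine doublePrimitive_congr hx.1 _ _ fun t ht => ?_
  have ht' : t ∈ Icc x₀ T := ⟨ht.1, ht.2.trans hx.2⟩
  rw [hFeq t ht', min_eq_right (sub_nonneg.1 (hhi t ht')), max_eq_right (sub_nonneg.1 (hlo t ht'))]

/-- Opial's half-line existence theorem between well-ordered lower and upper
solutions: if α < β are bounded C² functions on [x₀,∞) with α'' > f(x,α) and
β'' < f(x,β) for x > x₀, then there is a solution φ of φ'' = f(x,φ) with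
α < φ < β on (x₀,∞). -/
theorem stmt_3 (x₀ : ℝ) (f : ℝ × ℝ → ℝ) (hf : Continuous f)
    (α β αd αdd βd βdd : ℝ → ℝ)
    (hαbdd : ∃ C, ∀ x ∈ Ici x₀, |α x| ≤ C)
    (hβbdd : ∃ C, ∀ x ∈ Ici x₀, |β x| ≤ C)
    (hαd : ∀ x ∈ Ici x₀, HasDerivWithinAt α (αd x) (Ici x₀) x)
    (hαdd : ∀ x ∈ Ici x₀, HasDerivWithinAt αd (αdd x) (Ici x₀) x)
    (hαc : ContinuousOn αdd (Ici x₀))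
    (hβd : ∀ x ∈ Ici x₀, HasDerivWithinAt β (βd x) (Ici x₀) x)
    (hβdd : ∀ x ∈ Ici x₀, HasDerivWithinAt βd (βdd x) (Ici x₀) x)
    (hβc : ContinuousOn βdd (Ici x₀))
    (hord : ∀ x, x₀ < x → α x < β x)
    (hlow : ∀ x, x₀ < x → αdd x > f (x, α x))
    (hupp : ∀ x, x₀ < x → βdd x < f (x, β x)) :
    ∃ φ φd : ℝ → ℝ,
      (∀ x ∈ Ici x₀, HasDerivWithinAt φ (φd x) (Ici x₀) x) ∧
      (∀ x ∈ Ici x₀, HasDerivWithinAt φd (f (x, φ x)) (Ici x₀) x) ∧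
      (∀ x, x₀ < x → α x < φ x ∧ φ x < β x) := by
  obtain ⟨A, hA⟩ := hαbdd
  obtain ⟨B, hB⟩ := hβbdd
  obtain ⟨C, hαC, hβC⟩ : ∃ C, (∀ x ∈ Ici x₀, |α x| ≤ C) ∧ ∀ x ∈ Ici x₀, |β x| ≤ C :=
    ⟨max A B, fun x hx => (hA x hx).trans (le_max_left _ _),
      fun x hx => (hB x hx).trans (le_max_right _ _)⟩
  have hle : ∀ x ∈ Ici x₀, α x ≤ β x := by
    intro x hx
    rcases (mem_Ici.1 hx).eq_or_lt with rfl | h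
    · exact le_of_tendsto_of_tendsto
        ((hαd _ hx).continuousWithinAt.mono Ioi_subset_Ici_self)
        ((hβd _ hx).continuousWithinAt.mono Ioi_subset_Ici_self)
        (eventually_mem_nhdsWithin.mono fun y hy => (hord y hy).le)
    · exact (hord x h).le
  have hT : ∀ n : ℕ, x₀ < x₀ + n + 1 := fun n => by linarith [n.cast_nonneg (α := ℝ)]
  choose u σ hu hsol using fun n : ℕ =>
    exists_solution_between_on_Icc hf (hT n) hαC hβC hαd hαdd hβd hβdd hle hlow hupp
  have huC : ∀ n : ℕ, ∀ x ∈ Icc x₀ (x₀ + n + 1), |u n x| ≤ C := fun n x hx => by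
    have h₁ := (hsol n x hx).1
    exact abs_le.2 ⟨(abs_le.1 (hαC x hx.1)).1.trans h₁.1, h₁.2.trans (abs_le.1 (hβC x hx.1)).2⟩
  have hfbound : ∀ T, ∃ M, ∀ x ∈ Icc x₀ T, ∀ y ∈ Icc (-C) C, |f (x, y)| ≤ M := fun T => by
    obtain ⟨M, hM⟩ := (isCompact_Icc.prod isCompact_Icc :
      IsCompact (Icc x₀ T ×ˢ Icc (-C) C)).exists_bound_of_continuousOn hf.continuousOn
    exact ⟨M, fun x hx y hy => hM (x, y) ⟨hx, hy⟩⟩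
  obtain ⟨S, hS⟩ : ∃ S, ∀ n, |σ n| ≤ S := by
    obtain ⟨M, hM⟩ := hfbound (x₀ + 1)
    refine ⟨2 * C + M, fun n => ?_⟩
    have hsub : Icc x₀ (x₀ + 1) ⊆ Icc x₀ (x₀ + n + 1) :=
      Icc_subset_Icc_right (by linarith [n.cast_nonneg (α := ℝ)])
    have h₁ : x₀ + 1 ∈ Icc x₀ (x₀ + n + 1) := hsub ⟨by linarith, le_rfl⟩
    have h₂ := (hsol n _ h₁).2
    have h₃ := abs_le.1 (huC n _ h₁)
    have h₄ := abs_le.1 (hαC x₀ self_mem_Ici)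
    have h₅ := abs_le.1 (abs_integral_sub_mul_le (by linarith : x₀ ≤ x₀ + 1)
      fun t ht => hM t ht (u n t) (abs_le.1 (huC n t (hsub ht))))
    simp only [doublePrimitive, add_sub_cancel_left, mul_one, one_mul] at h₂ h₅
    exact abs_le.2 ⟨by linarith, by linarith⟩
  have hl : (hyperfilter ℕ : Filter ℕ) ≤ atTop := by
    rw [← Nat.cofinite_eq_atTop]; exact hyperfilter_le_cofinite
  have hev : ∀ T, ∀ᶠ n : ℕ in hyperfilter ℕ, Icc x₀ T ⊆ Icc x₀ (x₀ + n + 1) := fun T => by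
    have h : ∀ᶠ n : ℕ in atTop, T - x₀ ≤ n := tendsto_natCast_atTop_atTop.eventually_ge_atTop _
    exact hl (h.mono fun n hn => Icc_subset_Icc_right (by linarith))
  obtain ⟨φ, s, hφ, hlim, hφsol⟩ := exists_limit_doublePrimitive (hyperfilter ℕ) (x₀ := x₀)
    (a := α x₀) hf (φ := u) (ψ := u) (s := σ) hu
    (fun T => by
      obtain ⟨M, hM⟩ := hfbound T
      refine ⟨max S M, (hev T).mono fun n hn => ⟨(hS n).trans (le_max_left _ _), fun x hx => ?_⟩⟩
      exact (hM x hx _ (abs_le.1 (huC n x (hn hx)))).trans (le_max_right _ _))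
    (fun T => (hev T).mono fun n hn x hx => (hsol n x (hn hx)).2)
    (fun T ε hε => Eventually.of_forall fun n x _ => by simpa using hε)
  have hg : Continuous fun t => f (t, φ t) := hf.comp (continuous_id.prodMk hφ)
  have hlo : ∀ x, x₀ ≤ x → α x ≤ φ x := fun x hx => ge_of_tendsto (hlim x hx)
    ((hev x).mono fun n hn => (hsol n x (hn ⟨hx, le_rfl⟩)).1.1)
  have hhi : ∀ x, x₀ ≤ x → φ x ≤ β x := fun x hx => le_of_tendsto (hlim x hx)
    ((hev x).mono fun n hn => (hsol n x (hn ⟨hx, le_rfl⟩)).1.2)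
  refine ⟨φ, fun x => s + ∫ t in x₀..x, f (t, φ t), fun x hx => ?_, fun x _ =>
    (hasDerivAt_add_integral hg x₀ s x).hasDerivWithinAt, fun x hx => ⟨?_, ?_⟩⟩
  · exact (hasDerivAt_doublePrimitive hg x₀ (α x₀) s x).hasDerivWithinAt.congr
      (fun y hy => hφsol y hy) (hφsol x hx)
  · refine (hlo x hx.le).lt_of_ne fun heq => ?_
    have hmin : IsLocalMin (fun y => φ y - α y) x := by
      filter_upwards [Ioi_mem_nhds hx] with y hy
      linarith [hlo y (mem_Ioi.1 hy).le]
    have h := le_of_isLocalMin_sub (T := x + 1) hg (fun y hy => hφsol y hy.1)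
      ⟨hx, by linarith⟩ hαd hαdd hmin
    rw [← heq] at h
    exact (hlow x hx).not_ge h
  · refine (hhi x hx.le).lt_of_ne fun heq => ?_
    have hmin : IsLocalMin (fun y => β y - φ y) x := by
      filter_upwards [Ioi_mem_nhds hx] with y hy
      linarith [hhi y (mem_Ioi.1 hy).le]
    have h := ge_of_isLocalMin_sub (T := x + 1) hg (fun y hy => hφsol y hy.1)
      ⟨hx, by linarith⟩ hβd hβdd hmin
    rw [heq] at h
    exact (hupp x hx).not_ge h
end

section
/- Let L > 0 and let f : ℝ × ℝ → ℝ be continuous, L-periodic in its first argument, with continuous partial derivative ∂f/∂y. Let α, β : [x₀, +∞) → ℝ be bounded C² functions with α(x) < β(x), α''(x) > f(x, α(x)) and β''(x) < f(x, β(x)) for all x > x₀, and suppose min{∂f/∂y (x, y) : x ∈ [0,L], y ∈ [inf_{x ≥ x₀} α(x), sup_{x ≥ x₀} β(x)]} > 0. Then there is a C² solution φ of φ'' = f(x, φ) on [x₀, +∞) with α < φ < β on (x₀, +∞), and an L-periodic C² solution ϕ : ℝ → ℝ such that |φ(x) − ϕ(x)| + |φ'(x) − ϕ'(x)| → 0 as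 x → +∞; moreover ϕ is the unique L-periodic solution taking values in the interval [inf_{x ≥ x₀} α(x), sup_{x ≥ x₀} β(x)]. -/
open Set Filter

/-- A function with positive second derivative at a point has no local maximum there. -/
theorem second_deriv_nonpos_of_isLocalMax {w w' : ℝ → ℝ} {w'' x : ℝ} (hmax : IsLocalMax w x)
    (hw : ∀ᶠ y in nhds x, HasDerivAt w (w' y) y) (hw' : HasDerivAt w' w'' x) : w'' ≤ 0 := by
  by_contra! hpos
  have hd : deriv w =ᶠ[nhds x] w' := hw.mono fun y hy => hy.deriv
  have hdd : deriv (deriv w) x = w'' := by rw [hd.deriv_eq, hw'.deriv]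
  have hmin : IsLocalMin w x := isLocalMin_of_deriv_deriv_pos (by rwa [hdd])
    hmax.deriv_eq_zero hw.self_of_nhds.continuousAt
  have hconst : w =ᶠ[nhds x] fun _ => w x := by
    filter_upwards [hmax, hmin] with y h₁ h₂ using le_antisymm h₁ h₂
  have h0 : deriv w =ᶠ[nhds x] fun _ => (0 : ℝ) := by
    simpa using hconst.deriv
  have : deriv (deriv w) x = 0 := by rw [h0.deriv_eq]; simp
  linarith

/-- Maximum principle on a half-line for functions bounded above. -/
theorem nonpos_of_second_deriv_pos {x₀ C : ℝ} {w w' w'' : ℝ → ℝ}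
    (hc : ContinuousOn w (Ici x₀)) (hw : ∀ x, x₀ < x → HasDerivAt w (w' x) x)
    (hw' : ∀ x, x₀ < x → HasDerivAt w' (w'' x) x) (hC : ∀ x ∈ Ici x₀, w x ≤ C)
    (h0 : w x₀ ≤ 0) (hpos : ∀ x, x₀ < x → 0 < w x → 0 < w'' x) :
    ∀ x ∈ Ici x₀, w x ≤ 0 := by
  intro y hy
  by_contra! hwy
  have hxy : x₀ < y := lt_of_le_of_ne hy (by rintro rfl; linarith)
  obtain ⟨ε, hε, hεy⟩ : ∃ ε, 0 < ε ∧ ε * (y - x₀) < w y := by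
    have hd : 0 < y - x₀ := sub_pos.2 hxy
    refine ⟨w y / (2 * (y - x₀)), by positivity, ?_⟩
    field_simp
    linarith
  have hCy : 0 < C := hwy.trans_le (hC y hy)
  set R := max y (x₀ + C / ε) with hR
  have hyR : y ≤ R := le_max_left _ _
  have hRC : C ≤ ε * (R - x₀) := by
    have h : C / ε ≤ R - x₀ := by linarith [le_max_right y (x₀ + C / ε)]
    rw [div_le_iff₀ hε] at h
    linarith
  have hzc : ContinuousOn (fun x => w x - ε * (x - x₀)) (Icc x₀ R) :=
    (hc.mono Icc_subset_Ici_self).sub (by fun_prop)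
  obtain ⟨p, hp, hpmax⟩ := isCompact_Icc.exists_isMaxOn ⟨y, hy, hyR⟩ hzc
  have hzp : 0 < w p - ε * (p - x₀) := by
    have := hpmax (show y ∈ Icc x₀ R from ⟨hy, hyR⟩)
    have : w y - ε * (y - x₀) ≤ w p - ε * (p - x₀) := this
    linarith
  have hp₀ : x₀ < p := lt_of_le_of_ne hp.1 (by rintro rfl; simp at hzp; linarith)
  have hpR : p < R := lt_of_le_of_ne hp.2 (by
    intro h
    have := hC p hp.1
    rw [h] at this hzp
    linarith)
  have hloc : IsLocalMax (fun x => w x - ε * (x - x₀)) p :=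
    hpmax.isLocalMax (Icc_mem_nhds hp₀ hpR)
  have h2 := second_deriv_nonpos_of_isLocalMax (w' := fun x => w' x - ε) (w'' := w'' p) hloc
    (by
      filter_upwards [lt_mem_nhds hp₀] with x hx
      exact ((hw x hx).sub (((hasDerivAt_id x).sub_const x₀).const_mul ε)).congr_deriv (by simp))
    ((hw' p hp₀).sub_const ε)
  have : 0 < ε * (p - x₀) := mul_pos hε (sub_pos.2 hp₀)
  linarith [hpos p hp₀ (by linarith)]

/-- Strong form of the maximum principle on a half-line. -/
theorem neg_of_second_deriv_pos {x₀ C : ℝ} {w w' w'' : ℝ → ℝ}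
    (hc : ContinuousOn w (Ici x₀)) (hw : ∀ x, x₀ < x → HasDerivAt w (w' x) x)
    (hw' : ∀ x, x₀ < x → HasDerivAt w' (w'' x) x) (hC : ∀ x ∈ Ici x₀, w x ≤ C)
    (h0 : w x₀ ≤ 0) (hpos : ∀ x, x₀ < x → 0 ≤ w x → 0 < w'' x) :
    ∀ x, x₀ < x → w x < 0 := by
  have hle := nonpos_of_second_deriv_pos hc hw hw' hC h0 fun x hx h => hpos x hx h.le
  intro x hx
  refine lt_of_le_of_ne (hle x hx.le) fun h => ?_
  have hloc : IsLocalMax w x := by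
    filter_upwards [lt_mem_nhds hx] with y hy
    rw [h]; exact hle y hy.le
  have := second_deriv_nonpos_of_isLocalMax hloc
    (by filter_upwards [lt_mem_nhds hx] with y hy using hw y hy) (hw' x hx)
  linarith [hpos x hx h.ge]

theorem hasDerivAt_const_mul_exp (S k c x : ℝ) :
    HasDerivAt (fun y => S * Real.exp (k * (y - c))) (S * k * Real.exp (k * (x - c))) x := by
  exact (((((hasDerivAt_id x).sub_const c).const_mul k).exp).const_mul S).congr_deriv (by
    simp only [id]
    ring)

/-- A bounded function with `w'' ≥ k² w` wherever it is positive decays exponentially. -/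
theorem le_exp_of_second_deriv_ge {x₀ S k : ℝ} (hk : 0 < k) {w w' w'' : ℝ → ℝ}
    (hc : ContinuousOn w (Ici x₀)) (hw : ∀ x, x₀ < x → HasDerivAt w (w' x) x)
    (hw' : ∀ x, x₀ < x → HasDerivAt w' (w'' x) x) (hS : ∀ x ∈ Ici x₀, w x ≤ S)
    (hS0 : 0 ≤ S) (hge : ∀ x, x₀ < x → 0 < w x → k ^ 2 * w x ≤ w'' x) :
    ∀ x ∈ Ici x₀, w x ≤ S * Real.exp (-k * (x - x₀)) := by
  intro x hx
  have key := nonpos_of_second_deriv_pos (x₀ := x₀) (C := S)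
    (w := fun x => w x - S * Real.exp (-k * (x - x₀)))
    (w' := fun x => w' x - S * (-k) * Real.exp (-k * (x - x₀)))
    (w'' := fun x => w'' x - S * (-k) * (-k) * Real.exp (-k * (x - x₀)))
    (hc.sub (by fun_prop)) (fun x hx => (hw x hx).sub (hasDerivAt_const_mul_exp _ _ _ _))
    (fun x hx => (hw' x hx).sub (hasDerivAt_const_mul_exp _ _ _ _))
    (fun x hx => by
      have := hS x hx
      have : 0 ≤ S * Real.exp (-k * (x - x₀)) := by positivity
      linarith)
    (by simpa using hS x₀ self_mem_Ici)
    (fun x hx h => by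
      have h1 : 0 ≤ S * Real.exp (-k * (x - x₀)) := by positivity
      have h2 := hge x hx (by linarith)
      have h3 := mul_pos (pow_pos hk 2) h
      nlinarith)
  exact sub_nonpos.1 (key x hx)

/-- Maximum principle on the whole line. -/
theorem nonpos_of_second_deriv_ge {C m : ℝ} (hm : 0 < m) {w w' w'' : ℝ → ℝ}
    (hw : ∀ x, HasDerivAt w (w' x) x) (hw' : ∀ x, HasDerivAt w' (w'' x) x)
    (hC : ∀ x, w x ≤ C) (hge : ∀ x, 0 < w x → m * w x ≤ w'' x) (x : ℝ) : w x ≤ 0 := by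
  have hk : 0 < √m := Real.sqrt_pos.2 hm
  have hcont : Continuous w := continuous_iff_continuousAt.2 fun x => (hw x).continuousAt
  have hb : ∀ n : ℕ, w x ≤ max C 0 * Real.exp (-√m * n) := by
    intro n
    have := le_exp_of_second_deriv_ge (x₀ := x - n) (S := max C 0) hk hcont.continuousOn
      (fun y _ => hw y) (fun y _ => hw' y) (fun y _ => (hC y).trans (le_max_left _ _))
      (le_max_right _ _) (fun y _ h => by rw [Real.sq_sqrt hm.le]; exact hge y h) x
      (by simp)
    simpa using this
  have hlim : Tendsto (fun n : ℕ => max C 0 * Real.exp (-√m * n)) atTop (nhds 0) := by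
    have h1 : Tendsto (fun n : ℕ => -√m * (n : ℝ)) atTop atBot :=
      (tendsto_natCast_atTop_atTop).const_mul_atTop_of_neg (by linarith)
    simpa using (Real.tendsto_exp_atBot.comp h1).const_mul (max C 0)
  exact ge_of_tendsto' hlim hb

/-- Derivative of the upper tail integral. -/
theorem hasDerivAt_integral_Ioi {F : ℝ → ℝ} (hF : Continuous F)
    (hi : ∀ x, MeasureTheory.IntegrableOn F (Ioi x)) (x : ℝ) :
    HasDerivAt (fun y => ∫ s in Ioi y, F s) (-F x) x := by
  have h : (fun y => ∫ s in Ioi y, F s) = fun y => (∫ s in Ioi 0, F s) - ∫ s in (0 : ℝ)..y, F s := by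
    funext y
    have := intervalIntegral.integral_interval_add_Ioi (hi 0) (hi y)
    linarith
  rw [h]
  exact (intervalIntegral.integral_hasDerivAt_right (hF.intervalIntegrable _ _)
    hF.stronglyMeasurable.stronglyMeasurableAtFilter hF.continuousAt).const_sub _

/-- A bounded solution of the first-order linear equation `v' = k v - h`. -/
theorem exists_bounded_solution_first_order {k M : ℝ} (hk : 0 < k) {h : ℝ → ℝ} (hh : Continuous h)
    (hM : ∀ x, |h x| ≤ M) :
    ∃ v : ℝ → ℝ, (∀ x, HasDerivAt v (k * v x - h x) x) ∧ ∀ x, |v x| ≤ M / k := by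
  have hint : ∀ x, MeasureTheory.IntegrableOn (fun s => M * Real.exp (-k * s)) (Ioi x) := fun x =>
    (integrableOn_exp_mul_Ioi (neg_lt_zero.2 hk) x).const_mul M
  have hcF : Continuous fun s => Real.exp (-k * s) * h s := by fun_prop
  have hle : ∀ s, ‖Real.exp (-k * s) * h s‖ ≤ M * Real.exp (-k * s) := by
    intro s
    rw [norm_mul, Real.norm_eq_abs, Real.norm_eq_abs, abs_of_pos (Real.exp_pos _), mul_comm]
    gcongr
    exact hM s
  have hi : ∀ x, MeasureTheory.IntegrableOn (fun s => Real.exp (-k * s) * h s) (Ioi x) := fun x =>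
    (hint x).mono' hcF.aestronglyMeasurable (Eventually.of_forall hle)
  refine ⟨fun x => Real.exp (k * x) * ∫ s in Ioi x, Real.exp (-k * s) * h s, fun x => ?_,
    fun x => ?_⟩
  · have h1 : HasDerivAt (fun y => Real.exp (k * y)) (Real.exp (k * x) * k) x := by
      simpa using ((hasDerivAt_id x).const_mul k).exp
    refine (h1.mul (hasDerivAt_integral_Ioi hcF hi x)).congr_deriv ?_
    have : Real.exp (k * x) * Real.exp (-k * x) = 1 := by rw [← Real.exp_add]; simp
    linear_combination -h x * this
  · rw [abs_mul, abs_of_pos (Real.exp_pos _)]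
    have h1 := MeasureTheory.norm_integral_le_of_norm_le (hint x) (Eventually.of_forall hle)
    rw [MeasureTheory.integral_const_mul, integral_exp_mul_Ioi (neg_lt_zero.2 hk)] at h1
    rw [Real.norm_eq_abs] at h1
    have : Real.exp (k * x) * Real.exp (-k * x) = 1 := by rw [← Real.exp_add]; simp
    calc _ ≤ Real.exp (k * x) * (M * (-Real.exp (-k * x) / -k)) := by gcongr
      _ = (Real.exp (k * x) * Real.exp (-k * x)) * (M / k) := by ring
      _ = M / k := by rw [this, one_mul]

/-- A bounded solution of `v'' = k² v - h` on the line. -/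
theorem exists_bounded_solution_second_order {k M : ℝ} (hk : 0 < k) {h : ℝ → ℝ}
    (hh : Continuous h) (hM : ∀ x, |h x| ≤ M) :
    ∃ v v' : ℝ → ℝ, (∀ x, HasDerivAt v (v' x) x) ∧
      (∀ x, HasDerivAt v' (k ^ 2 * v x - h x) x) ∧ ∃ C, ∀ x, |v x| ≤ C := by
  obtain ⟨p, hp, hpb⟩ := exists_bounded_solution_first_order hk hh hM
  obtain ⟨q, hq, hqb⟩ := exists_bounded_solution_first_order hk
    (h := fun x => h (-x)) (by fun_prop) (fun x => hM (-x))
  have hq' : ∀ x, HasDerivAt (fun y => q (-y)) (-(k * q (-x) - h x)) x := by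
    intro x
    have := (hq (-x)).comp x (hasDerivAt_neg x)
    simpa [Function.comp_def] using this
  refine ⟨fun x => (p x + q (-x)) / (2 * k), fun x => (p x - q (-x)) / 2, fun x => ?_, fun x => ?_,
    (M / k + M / k) / (2 * k), fun x => ?_⟩
  · refine (((hp x).add (hq' x)).div_const (2 * k)).congr_deriv ?_
    field_simp
    ring
  · refine (((hp x).sub (hq' x)).div_const 2).congr_deriv ?_
    field_simp
    ring
  · rw [abs_div, abs_of_pos (show 0 < 2 * k by positivity)]
    gcongr
    exact (abs_add_le _ _).trans (add_le_add (hpb x) (hqb _))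

open BoundedContinuousFunction in
/-- Contraction argument for a strongly monotone Lipschitz nonlinearity. -/
theorem exists_fixedPoint_of_solver {m K B : ℝ} (hm : 0 < m) (hmK : m ≤ K) {g : ℝ × ℝ → ℝ}
    (hg : Continuous g)
    (hlow : ∀ x y z, y ≤ z → m * (z - y) ≤ g (x, z) - g (x, y))
    (hupp : ∀ x y z, y ≤ z → g (x, z) - g (x, y) ≤ K * (z - y))
    (hB : ∀ x, |g (x, 0)| ≤ B) (S : (ℝ →ᵇ ℝ) → (ℝ →ᵇ ℝ))
    (hS : ∀ h₁ h₂ δ, 0 ≤ δ → (∀ x, |h₁ x - h₂ x| ≤ δ) → ∀ x, S h₁ x - S h₂ x ≤ δ / K) :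
    ∃ u h : ℝ →ᵇ ℝ, (∀ x, h x = K * u x - g (x, u x)) ∧ S h = u := by
  have hK : 0 < K := hm.trans_le hmK
  have hlip : ∀ x y z, |(K * z - g (x, z)) - (K * y - g (x, y))| ≤ (K - m) * |z - y| := by
    intro x y z
    rcases le_total y z with h | h
    · have h1 := hlow x y z h
      have h2 := hupp x y z h
      rw [abs_of_nonneg (sub_nonneg.2 h), abs_of_nonneg (by linarith)]
      linarith
    · have h1 := hlow x z y h
      have h2 := hupp x z y h
      rw [abs_of_nonpos (sub_nonpos.2 h), abs_of_nonpos (by linarith)]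
      linarith
  have hbd : ∀ (u : ℝ →ᵇ ℝ) (x : ℝ), ‖K * u x - g (x, u x)‖ ≤ B + (K - m) * ‖u‖ := by
    intro u x
    have h1 := hlip x 0 (u x)
    have h2 := u.norm_coe_le_norm x
    rw [Real.norm_eq_abs] at h2 ⊢
    have h3 : (K - m) * |u x| ≤ (K - m) * ‖u‖ :=
      mul_le_mul_of_nonneg_left h2 (sub_nonneg.2 hmK)
    have h4 := hB x
    simp only [mul_zero, zero_sub, sub_zero, sub_neg_eq_add] at h1
    rw [abs_le] at h1 h4 ⊢
    constructor <;> linarith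
  let N : (ℝ →ᵇ ℝ) → (ℝ →ᵇ ℝ) := fun u =>
    BoundedContinuousFunction.ofNormedAddCommGroup (fun x => K * u x - g (x, u x))
      (by fun_prop) _ (hbd u)
  have hN : ∀ u x, N u x = K * u x - g (x, u x) := fun _ _ => rfl
  have hcontr : ContractingWith (Real.toNNReal ((K - m) / K)) (fun u => S (N u)) := by
    have hq : 0 ≤ (K - m) / K := div_nonneg (sub_nonneg.2 hmK) hK.le
    refine ⟨?_, LipschitzWith.of_dist_le_mul fun u v => ?_⟩
    · rw [Real.toNNReal_lt_one, div_lt_one hK]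
      linarith
    · rw [Real.coe_toNNReal _ hq, BoundedContinuousFunction.dist_le (by positivity)]
      have key : ∀ u v : ℝ →ᵇ ℝ, ∀ x, S (N u) x - S (N v) x ≤ (K - m) / K * dist u v := by
        intro u v x
        have := hS (N u) (N v) ((K - m) * dist u v)
          (mul_nonneg (sub_nonneg.2 hmK) dist_nonneg) (fun x => by
            rw [hN, hN]
            refine (hlip x (v x) (u x)).trans (mul_le_mul_of_nonneg_left ?_ (sub_nonneg.2 hmK))
            rw [← Real.dist_eq]
            exact BoundedContinuousFunction.dist_coe_le_dist x) x
        rwa [mul_div_right_comm] at this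
      intro x
      rw [Real.dist_eq, abs_le]
      have h1 := key u v x
      have h2 := key v u x
      rw [dist_comm v u] at h2
      constructor <;> linarith
  exact ⟨hcontr.fixedPoint, N hcontr.fixedPoint, fun x => rfl, hcontr.fixedPoint_isFixedPt⟩

open BoundedContinuousFunction in
/-- A bounded solution on the line of an equation with strongly monotone Lipschitz right side. -/
theorem exists_bounded_solution_line {m K B : ℝ} (hm : 0 < m) (hmK : m ≤ K) {g : ℝ × ℝ → ℝ}
    (hg : Continuous g)
    (hlow : ∀ x y z, y ≤ z → m * (z - y) ≤ g (x, z) - g (x, y))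
    (hupp : ∀ x y z, y ≤ z → g (x, z) - g (x, y) ≤ K * (z - y))
    (hB : ∀ x, |g (x, 0)| ≤ B) :
    ∃ u u' : ℝ → ℝ, (∀ x, HasDerivAt u (u' x) x) ∧ (∀ x, HasDerivAt u' (g (x, u x)) x) ∧
      ∃ C, ∀ x, |u x| ≤ C := by
  have hK : 0 < K := hm.trans_le hmK
  have hex : ∀ h : ℝ →ᵇ ℝ, ∃ (v : ℝ →ᵇ ℝ) (v' : ℝ → ℝ), (∀ x, HasDerivAt v (v' x) x) ∧
      ∀ x, HasDerivAt v' (K * v x - h x) x := by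
    intro h
    obtain ⟨v, v', hv, hv', C, hC⟩ := exists_bounded_solution_second_order
      (Real.sqrt_pos.2 hK) h.continuous h.norm_coe_le_norm
    rw [Real.sq_sqrt hK.le] at hv'
    exact ⟨BoundedContinuousFunction.ofNormedAddCommGroup v
      (continuous_iff_continuousAt.2 fun x => (hv x).continuousAt) C hC, v', hv, hv'⟩
  choose S S' hS hS' using hex
  obtain ⟨u, h, hu, hSu⟩ := exists_fixedPoint_of_solver hm hmK hg hlow hupp hB S (by
    intro h₁ h₂ δ hδ hle x
    have := nonpos_of_second_deriv_ge (C := ‖S h₁‖ + ‖S h₂‖ - δ / K) hK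
      (w := fun x => S h₁ x - S h₂ x - δ / K)
      (fun x => ((hS h₁ x).sub (hS h₂ x)).sub_const (δ / K))
      (fun x => (hS' h₁ x).sub (hS' h₂ x))
      (fun x => by
        have h1 := (abs_le.1 ((S h₁).norm_coe_le_norm x)).2
        have h2 := (abs_le.1 ((S h₂).norm_coe_le_norm x)).1
        linarith)
      (fun x _ => by
        have h1 := (abs_le.1 (hle x)).2
        rw [mul_sub, mul_div_cancel₀ _ hK.ne']
        linarith) x
    linarith)
  refine ⟨u, S' h, fun x => ?_, fun x => ?_, ‖u‖, u.norm_coe_le_norm⟩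
  · rw [← hSu]; exact hS h x
  · refine (hS' h x).congr_deriv ?_
    rw [hu, hSu]; ring

open BoundedContinuousFunction in
/-- A bounded solution on a half-line with prescribed initial value. -/
theorem exists_bounded_solution_half_line {m K B : ℝ} (hm : 0 < m) (hmK : m ≤ K) {g : ℝ × ℝ → ℝ}
    (hg : Continuous g)
    (hlow : ∀ x y z, y ≤ z → m * (z - y) ≤ g (x, z) - g (x, y))
    (hupp : ∀ x y z, y ≤ z → g (x, z) - g (x, y) ≤ K * (z - y))
    (hB : ∀ x, |g (x, 0)| ≤ B) (x₀ c : ℝ) :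
    ∃ u u' : ℝ → ℝ, (∀ x, HasDerivAt u (u' x) x) ∧
      (∀ x ∈ Ici x₀, HasDerivAt u' (g (x, u x)) x) ∧ u x₀ = c ∧
      ∃ C, ∀ x ∈ Ici x₀, |u x| ≤ C := by
  have hK : 0 < K := hm.trans_le hmK
  have hex : ∀ h : ℝ →ᵇ ℝ, ∃ v v' : ℝ → ℝ, ∃ V : ℝ →ᵇ ℝ, (∀ x, HasDerivAt v (v' x) x) ∧
      (∀ x, HasDerivAt v' (K * v x - h x) x) ∧ v x₀ = c ∧ ∀ x, V x = v (max x x₀) := by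
    intro h
    obtain ⟨v, v', hv, hv', C, hC⟩ := exists_bounded_solution_second_order
      (Real.sqrt_pos.2 hK) h.continuous h.norm_coe_le_norm
    rw [Real.sq_sqrt hK.le] at hv'
    set d := c - v x₀ with hd
    have hvc : Continuous v := continuous_iff_continuousAt.2 fun x => (hv x).continuousAt
    refine ⟨fun x => v x + d * Real.exp (-√K * (x - x₀)),
      fun x => v' x + d * (-√K) * Real.exp (-√K * (x - x₀)),
      BoundedContinuousFunction.ofNormedAddCommGroup
        (fun x => v (max x x₀) + d * Real.exp (-√K * (max x x₀ - x₀))) (by fun_prop) (C + |d|) ?_,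
      fun x => (hv x).add (hasDerivAt_const_mul_exp _ _ _ _), fun x => ?_, by simp [hd],
      fun x => rfl⟩
    · intro x
      refine (norm_add_le _ _).trans (add_le_add (hC _) ?_)
      rw [norm_mul, Real.norm_eq_abs, Real.norm_eq_abs, Real.abs_exp]
      refine mul_le_of_le_one_right (abs_nonneg d) (Real.exp_le_one_iff.2 ?_)
      have : 0 ≤ √K * (max x x₀ - x₀) :=
        mul_nonneg (Real.sqrt_nonneg K) (sub_nonneg.2 (le_max_right _ _))
      linarith
    · refine ((hv' x).add (hasDerivAt_const_mul_exp (d * (-√K)) (-√K) x₀ x)).congr_deriv ?_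
      linear_combination d * Real.exp (-√K * (x - x₀)) * Real.sq_sqrt hK.le
  choose v v' S hv hv' hvc hS using hex
  obtain ⟨u, h, hu, hSu⟩ := exists_fixedPoint_of_solver hm hmK hg hlow hupp hB S (by
    intro h₁ h₂ δ hδ hle x
    have hδK : 0 ≤ δ / K := div_nonneg hδ hK.le
    have := nonpos_of_second_deriv_pos (x₀ := x₀) (C := ‖S h₁‖ + ‖S h₂‖ - δ / K)
      (w := fun x => v h₁ x - v h₂ x - δ / K)
      (w' := fun x => v' h₁ x - v' h₂ x)
      (w'' := fun x => (K * v h₁ x - h₁ x) - (K * v h₂ x - h₂ x))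
      (fun x _ => (((hv h₁ x).sub (hv h₂ x)).sub_const
        (δ / K)).continuousAt.continuousWithinAt)
      (fun x _ => ((hv h₁ x).sub (hv h₂ x)).sub_const (δ / K))
      (fun x _ => (hv' h₁ x).sub (hv' h₂ x))
      (fun x hx => by
        have h1 := (abs_le.1 ((S h₁).norm_coe_le_norm x)).2
        have h2 := (abs_le.1 ((S h₂).norm_coe_le_norm x)).1
        rw [hS, max_eq_left hx] at h1 h2
        linarith)
      (by simp only [hvc]; linarith)
      (fun x _ hpos => by
        have h1 := (abs_le.1 (hle x)).2
        have h2 := mul_pos hK hpos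
        rw [mul_sub, mul_div_cancel₀ _ hK.ne'] at h2
        linarith) (max x x₀) (mem_Ici.2 (le_max_right _ _))
    rw [hS, hS]
    linarith)
  have hvu : ∀ x ∈ Ici x₀, v h x = u x := fun x hx => by
    rw [← hSu, hS, max_eq_left hx]
  refine ⟨v h, v' h, hv h, fun x hx => ?_, hvc h, ‖u‖, fun x hx => ?_⟩
  · refine (hv' h x).congr_deriv ?_
    rw [hu, hvu x hx]; ring
  · rw [hvu x hx]; exact u.norm_coe_le_norm x

/-- If `w → 0` and `w''` is dominated by `w`, then `w' → 0`. -/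
theorem tendsto_deriv_zero_of_second_deriv_le {x₀ K : ℝ} {w w' w'' : ℝ → ℝ}
    (hw : ∀ x, x₀ < x → HasDerivAt w (w' x) x) (hw' : ∀ x, x₀ < x → HasDerivAt w' (w'' x) x)
    (hle : ∀ x, x₀ < x → |w'' x| ≤ K * |w x|) (h0 : Tendsto w atTop (nhds 0)) :
    Tendsto w' atTop (nhds 0) := by
  have hKw : Tendsto (fun x => K * |w x|) atTop (nhds 0) := by
    simpa using h0.abs.const_mul K
  rw [Metric.tendsto_atTop]
  intro ε hε
  obtain ⟨N₁, hN₁⟩ := Metric.tendsto_atTop.1 h0 (ε / 4) (by positivity)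
  obtain ⟨N₂, hN₂⟩ := Metric.tendsto_atTop.1 hKw (ε / 4) (by positivity)
  refine ⟨max (max N₁ N₂) (x₀ + 1), fun x hx => ?_⟩
  simp only [max_le_iff] at hx
  obtain ⟨⟨hx₁, hx₂⟩, hx₃⟩ := hx
  obtain ⟨ξ, hξ, hξe⟩ := exists_hasDerivAt_eq_slope w w' (lt_add_one x)
    (fun y hy => (hw y (by linarith [hy.1])).continuousAt.continuousWithinAt)
    (fun y hy => hw y (by linarith [hy.1]))
  obtain ⟨η, hη, hηe⟩ := exists_hasDerivAt_eq_slope w' w'' hξ.1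
    (fun y hy => (hw' y (by linarith [hy.1])).continuousAt.continuousWithinAt)
    (fun y hy => hw' y (by linarith [hy.1]))
  have h1 := hN₁ x hx₁
  have h2 := hN₁ (x + 1) (by linarith)
  have h3 := hN₂ η (by linarith [hη.1])
  have h4 := hle η (by linarith [hη.1])
  rw [Real.dist_eq, sub_zero] at h1 h2 h3 ⊢
  have h5 : |w'' η| < ε / 4 := h4.trans_lt ((le_abs_self _).trans_lt h3)
  rw [eq_div_iff (sub_pos.2 hξ.1).ne'] at hηe
  have h6 : |w' ξ - w' x| ≤ ε / 4 := by
    rw [← hηe, abs_mul, abs_of_pos (sub_pos.2 hξ.1)]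
    have := hξ.2
    have := hξ.1
    nlinarith [abs_nonneg (w'' η)]
  rw [add_sub_cancel_left, div_one] at hξe
  rw [hξe] at h6
  rw [abs_lt] at h1 h2 ⊢
  rw [abs_le] at h6
  constructor <;> linarith [h6.1, h6.2]

/-- The extension of a right side `f` from the strip `ℝ × [a, b]` by slope `m` lines. -/
noncomputable def clampedExtension (f : ℝ × ℝ → ℝ) (a b m : ℝ) (p : ℝ × ℝ) : ℝ :=
  f (p.1, max a (min b p.2)) + m * (p.2 - max a (min b p.2))

theorem clampedExtension_of_mem {f : ℝ × ℝ → ℝ} {a b m x y : ℝ} (hy : y ∈ Icc a b) :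
    clampedExtension f a b m (x, y) = f (x, y) := by
  simp [clampedExtension, min_eq_right hy.2, max_eq_right hy.1]

theorem clampedExtension_sub_bounds {f : ℝ × ℝ → ℝ} {a b m K : ℝ} (hab : a ≤ b) (hmK : m ≤ K)
    (hlow : ∀ x, ∀ y ∈ Icc a b, ∀ z ∈ Icc a b, y ≤ z → m * (z - y) ≤ f (x, z) - f (x, y))
    (hupp : ∀ x, ∀ y ∈ Icc a b, ∀ z ∈ Icc a b, y ≤ z → f (x, z) - f (x, y) ≤ K * (z - y))
    (x y z : ℝ) (hyz : y ≤ z) :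
    m * (z - y) ≤ clampedExtension f a b m (x, z) - clampedExtension f a b m (x, y) ∧
      clampedExtension f a b m (x, z) - clampedExtension f a b m (x, y) ≤ K * (z - y) := by
  have hmem : ∀ t, max a (min b t) ∈ Icc a b := fun t =>
    ⟨le_max_left _ _, max_le hab (min_le_left _ _)⟩
  have hP : max a (min b y) ≤ max a (min b z) := by gcongr
  have hP' : max a (min b z) - max a (min b y) ≤ z - y := by
    have h1 := abs_max_sub_max_le_max a (min b z) a (min b y)
    have h2 := abs_min_sub_min_le_max b z b y
    rw [sub_self, abs_zero] at h1 h2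
    replace h1 := h1.trans_eq (max_eq_right (abs_nonneg _))
    replace h2 := h2.trans_eq (max_eq_right (abs_nonneg _))
    rw [abs_of_nonneg (sub_nonneg.2 hyz)] at h2
    exact (le_abs_self _).trans (h1.trans h2)
  have h1 := hlow x _ (hmem y) _ (hmem z) hP
  have h2 := hupp x _ (hmem y) _ (hmem z) hP
  have h3 := mul_nonneg (sub_nonneg.2 hmK) (sub_nonneg.2 hP')
  simp only [clampedExtension]
  constructor <;> linarith

/-- A continuous function that is periodic in the first variable is bounded on vertical strips. -/
theorem exists_abs_le_of_periodic {L : ℝ} (hL : 0 < L) {f : ℝ × ℝ → ℝ} (hf : Continuous f)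
    (hper : ∀ x y, f (x + L, y) = f (x, y)) (a b : ℝ) :
    ∃ B, ∀ x, ∀ y ∈ Icc a b, |f (x, y)| ≤ B := by
  have hcpt : IsCompact (Icc 0 L ×ˢ Icc a b) := isCompact_Icc.prod isCompact_Icc
  obtain ⟨B, hB⟩ := hcpt.exists_bound_of_continuousOn hf.continuousOn
  refine ⟨B, fun x y hy => ?_⟩
  have hp : Function.Periodic (fun x => f (x, y)) L := fun x => hper x y
  obtain ⟨t, ht, hxt⟩ := hp.exists_mem_Ico₀ hL x
  exact (congrArg abs hxt).trans_le (hB (t, y) ⟨Ico_subset_Icc_self ht, hy⟩)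

/-- Two-sided increment bounds from the positive minimum of the periodic partial derivative. -/
theorem exists_increment_bounds {L : ℝ} (hL : 0 < L) {f fy : ℝ × ℝ → ℝ} (hfy : Continuous fy)
    (hper : ∀ x y, f (x + L, y) = f (x, y))
    (hderiv : ∀ x y : ℝ, HasDerivAt (fun z => f (x, z)) (fy (x, y)) y) {a b : ℝ}
    (hpos : 0 < sInf (fy '' (Icc 0 L ×ˢ Icc a b))) :
    ∃ m K, 0 < m ∧ m ≤ K ∧
      (∀ x, ∀ y ∈ Icc a b, ∀ z ∈ Icc a b, y ≤ z → m * (z - y) ≤ f (x, z) - f (x, y)) ∧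
      ∀ x, ∀ y ∈ Icc a b, ∀ z ∈ Icc a b, y ≤ z → f (x, z) - f (x, y) ≤ K * (z - y) := by
  have hfyper : ∀ x y, fy (x + L, y) = fy (x, y) := fun x y => by
    have h := hderiv (x + L) y
    simp only [hper] at h
    exact h.unique (hderiv x y)
  obtain ⟨B, hB⟩ := exists_abs_le_of_periodic hL hfy hfyper a b
  have hbdd : BddBelow (fy '' (Icc 0 L ×ˢ Icc a b)) :=
    ((isCompact_Icc.prod isCompact_Icc).image hfy).bddBelow
  set m := sInf (fy '' (Icc 0 L ×ˢ Icc a b))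
  have hle : ∀ x, ∀ y ∈ Icc a b, m ≤ fy (x, y) := by
    intro x y hy
    have hp : Function.Periodic (fun x => fy (x, y)) L := fun x => hfyper x y
    obtain ⟨t, ht, hxt⟩ := hp.exists_mem_Ico₀ hL x
    exact (csInf_le hbdd ⟨(t, y), ⟨Ico_subset_Icc_self ht, hy⟩, rfl⟩).trans_eq hxt.symm
  have hslope : ∀ x, ∀ y ∈ Icc a b, ∀ z ∈ Icc a b, y ≤ z →
      ∃ ξ ∈ Icc a b, f (x, z) - f (x, y) = fy (x, ξ) * (z - y) := by
    intro x y hy z hz hyz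
    rcases hyz.eq_or_lt with rfl | hlt
    · exact ⟨y, hy, by simp⟩
    · obtain ⟨ξ, hξ, h⟩ := exists_hasDerivAt_eq_slope (fun z => f (x, z)) (fun z => fy (x, z)) hlt
        (fun t _ => (hderiv x t).continuousAt.continuousWithinAt) (fun t _ => hderiv x t)
      refine ⟨ξ, ⟨hy.1.trans hξ.1.le, hξ.2.le.trans hz.2⟩, ?_⟩
      rw [h, div_mul_cancel₀ _ (sub_pos.2 hlt).ne']
  refine ⟨m, max m B, hpos, le_max_left _ _, fun x y hy z hz hyz => ?_, fun x y hy z hz hyz => ?_⟩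
  all_goals
    obtain ⟨ξ, hξ, h⟩ := hslope x y hy z hz hyz
    rw [h]
    refine mul_le_mul_of_nonneg_right ?_ (sub_nonneg.2 hyz)
  · exact hle x ξ hξ
  · exact ((le_abs_self _).trans (hB x ξ hξ)).trans (le_max_right _ _)

/-- Bounded solutions on the line of a strongly monotone equation coincide. -/
theorem eq_of_bounded_solutions {m : ℝ} (hm : 0 < m) {g : ℝ × ℝ → ℝ}
    (hlow : ∀ x y z, y ≤ z → m * (z - y) ≤ g (x, z) - g (x, y)) {u u' v v' : ℝ → ℝ}
    (hu : ∀ x, HasDerivAt u (u' x) x) (hu' : ∀ x, HasDerivAt u' (g (x, u x)) x)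
    (hv : ∀ x, HasDerivAt v (v' x) x) (hv' : ∀ x, HasDerivAt v' (g (x, v x)) x)
    (hub : ∃ C, ∀ x, |u x| ≤ C) (hvb : ∃ C, ∀ x, |v x| ≤ C) : u = v := by
  have key : ∀ {u u' v v' : ℝ → ℝ}, (∀ x, HasDerivAt u (u' x) x) →
      (∀ x, HasDerivAt u' (g (x, u x)) x) → (∀ x, HasDerivAt v (v' x) x) →
      (∀ x, HasDerivAt v' (g (x, v x)) x) → (∃ C, ∀ x, |u x| ≤ C) → (∃ C, ∀ x, |v x| ≤ C) →
      ∀ x, u x - v x ≤ 0 := by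
    intro u u' v v' hu hu' hv hv' ⟨C, hC⟩ ⟨D, hD⟩
    exact nonpos_of_second_deriv_ge (C := C + D) hm (fun x => (hu x).sub (hv x))
      (fun x => (hu' x).sub (hv' x))
      (fun x => by linarith [(abs_le.1 (hC x)).2, (abs_le.1 (hD x)).1])
      (fun x h => hlow x _ _ (sub_pos.1 h).le)
  funext x
  have h1 := key hu hu' hv hv' hub hvb x
  have h2 := key hv hv' hu hu' hvb hub x
  linarith

/-- Bounded solutions on a half-line of a strongly monotone equation are asymptotic. -/
theorem tendsto_sub_of_bounded_solutions {m x₀ : ℝ} (hm : 0 < m) {g : ℝ × ℝ → ℝ}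
    (hlow : ∀ x y z, y ≤ z → m * (z - y) ≤ g (x, z) - g (x, y)) {u u' v v' : ℝ → ℝ}
    (hu : ∀ x ∈ Ici x₀, HasDerivAt u (u' x) x) (hu' : ∀ x ∈ Ici x₀, HasDerivAt u' (g (x, u x)) x)
    (hv : ∀ x ∈ Ici x₀, HasDerivAt v (v' x) x) (hv' : ∀ x ∈ Ici x₀, HasDerivAt v' (g (x, v x)) x)
    (hub : ∃ C, ∀ x ∈ Ici x₀, |u x| ≤ C) (hvb : ∃ C, ∀ x ∈ Ici x₀, |v x| ≤ C) :
    Tendsto (fun x => u x - v x) atTop (nhds 0) := by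
  obtain ⟨C, hC⟩ := hub
  obtain ⟨D, hD⟩ := hvb
  have hC0 : 0 ≤ C := (abs_nonneg _).trans (hC x₀ self_mem_Ici)
  have hD0 : 0 ≤ D := (abs_nonneg _).trans (hD x₀ self_mem_Ici)
  have hk : 0 < √m := Real.sqrt_pos.2 hm
  have hlim : Tendsto (fun x => (C + D) * Real.exp (-√m * (x - x₀))) atTop (nhds 0) := by
    have h1 : Tendsto (fun x => -√m * (x - x₀)) atTop atBot :=
      (tendsto_atTop_add_const_right _ (-x₀) tendsto_id).const_mul_atTop_of_neg (by linarith)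
    simpa using (Real.tendsto_exp_atBot.comp h1).const_mul (C + D)
  refine squeeze_zero_norm' ?_ hlim
  filter_upwards [eventually_ge_atTop x₀] with x hx
  have h1 := le_exp_of_second_deriv_ge (x₀ := x₀) (S := C + D) hk (w := fun x => u x - v x)
    (fun x hx => ((hu x hx).sub (hv x hx)).continuousAt.continuousWithinAt)
    (fun x hx => (hu x hx.le).sub (hv x hx.le)) (fun x hx => (hu' x hx.le).sub (hv' x hx.le))
    (fun x hx => by linarith [(abs_le.1 (hC x hx)).2, (abs_le.1 (hD x hx)).1])
    (by positivity)
    (fun x _ h => by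
      rw [Real.sq_sqrt hm.le]
      exact hlow x _ _ (sub_pos.1 h).le) x hx
  have h2 := le_exp_of_second_deriv_ge (x₀ := x₀) (S := C + D) hk (w := fun x => v x - u x)
    (fun x hx => ((hv x hx).sub (hu x hx)).continuousAt.continuousWithinAt)
    (fun x hx => (hv x hx.le).sub (hu x hx.le)) (fun x hx => (hv' x hx.le).sub (hu' x hx.le))
    (fun x hx => by linarith [(abs_le.1 (hC x hx)).1, (abs_le.1 (hD x hx)).2])
    (by positivity)
    (fun x _ h => by
      rw [Real.sq_sqrt hm.le]
      exact hlow x _ _ (sub_pos.1 h).le) x hx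
  rw [Real.norm_eq_abs, abs_le]
  constructor <;> linarith

/-- A periodic function asymptotic to a function with values in `[a, b]` has values in `[a, b]`. -/
theorem mem_Icc_of_periodic_of_tendsto_sub {L x₀ a b : ℝ} (hL : 0 < L) {u v : ℝ → ℝ}
    (hu : ∀ x ∈ Ici x₀, u x ∈ Icc a b) (hv : Function.Periodic v L)
    (h : Tendsto (fun x => u x - v x) atTop (nhds 0)) (x : ℝ) : v x ∈ Icc a b := by
  have hseq : Tendsto (fun n : ℕ => x + n * L) atTop atTop :=
    tendsto_atTop_add_const_left _ _ (tendsto_natCast_atTop_atTop.atTop_mul_const hL)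
  have hlim : Tendsto (fun n : ℕ => u (x + n * L)) atTop (nhds (v x)) := by
    have := (h.comp hseq).add_const (v x)
    simp only [zero_add] at this
    refine this.congr fun n => ?_
    have := hv.nat_mul n x
    simp only [Function.comp_apply, this]
    ring
  refine isClosed_Icc.mem_of_tendsto hlim ?_
  filter_upwards [hseq.eventually_ge_atTop x₀] with n hn using hu _ hn

/-- A bounded strict lower solution lies below every bounded solution that starts above it. -/
theorem lt_of_lower_solution {x₀ : ℝ} {g : ℝ × ℝ → ℝ}
    (hmono : ∀ x y z, y ≤ z → g (x, y) ≤ g (x, z)) {α αd αdd u u' : ℝ → ℝ}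
    (hα : ∀ x ∈ Ici x₀, HasDerivWithinAt α (αd x) (Ici x₀) x)
    (hα' : ∀ x ∈ Ici x₀, HasDerivWithinAt αd (αdd x) (Ici x₀) x)
    (hlow : ∀ x, x₀ < x → g (x, α x) < αdd x)
    (hu : ∀ x ∈ Ici x₀, HasDerivAt u (u' x) x) (hu' : ∀ x ∈ Ici x₀, HasDerivAt u' (g (x, u x)) x)
    (hαb : ∃ C, ∀ x ∈ Ici x₀, |α x| ≤ C) (hub : ∃ C, ∀ x ∈ Ici x₀, |u x| ≤ C)
    (h0 : α x₀ ≤ u x₀) : ∀ x, x₀ < x → α x < u x := by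
  obtain ⟨C, hC⟩ := hαb
  obtain ⟨D, hD⟩ := hub
  intro x hx
  refine sub_neg.1 (neg_of_second_deriv_pos (x₀ := x₀) (C := C + D) (w := fun x => α x - u x)
    (fun x hx => (hα x hx).continuousWithinAt.sub (hu x hx).continuousAt.continuousWithinAt)
    (fun x hx => ((hα x hx.le).hasDerivAt (Ici_mem_nhds hx)).sub (hu x hx.le))
    (fun x hx => ((hα' x hx.le).hasDerivAt (Ici_mem_nhds hx)).sub (hu' x hx.le))
    (fun x hx => by linarith [(abs_le.1 (hC x hx)).2, (abs_le.1 (hD x hx)).1])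
    (sub_nonpos.2 h0) (fun x hx h => ?_) x hx)
  linarith [hlow x hx, hmono x _ _ (sub_nonneg.1 h)]

/-- A bounded strict upper solution lies above every bounded solution that starts below it. -/
theorem lt_of_upper_solution {x₀ : ℝ} {g : ℝ × ℝ → ℝ}
    (hmono : ∀ x y z, y ≤ z → g (x, y) ≤ g (x, z)) {β βd βdd u u' : ℝ → ℝ}
    (hβ : ∀ x ∈ Ici x₀, HasDerivWithinAt β (βd x) (Ici x₀) x)
    (hβ' : ∀ x ∈ Ici x₀, HasDerivWithinAt βd (βdd x) (Ici x₀) x)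
    (hupp : ∀ x, x₀ < x → βdd x < g (x, β x))
    (hu : ∀ x ∈ Ici x₀, HasDerivAt u (u' x) x) (hu' : ∀ x ∈ Ici x₀, HasDerivAt u' (g (x, u x)) x)
    (hβb : ∃ C, ∀ x ∈ Ici x₀, |β x| ≤ C) (hub : ∃ C, ∀ x ∈ Ici x₀, |u x| ≤ C)
    (h0 : u x₀ ≤ β x₀) : ∀ x, x₀ < x → u x < β x := by
  intro x hx
  refine neg_lt_neg_iff.1 (lt_of_lower_solution (x₀ := x₀) (g := fun p => -g (p.1, -p.2))
    (fun x y z h => neg_le_neg (hmono x _ _ (neg_le_neg h)))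
    (α := fun x => -β x) (u := fun x => -u x)
    (fun x hx => (hβ x hx).neg) (fun x hx => (hβ' x hx).neg)
    (fun x hx => by simpa using hupp x hx)
    (fun x hx => (hu x hx).neg) (fun x hx => by simpa using! (hu' x hx).neg)
    (by simpa using hβb) (by simpa using hub) (neg_le_neg h0) x hx)

/-- Between bounded well-ordered lower and upper solutions α < β on [x₀,∞)
there is a solution φ of φ'' = f(x,φ); if moreover min ∂f/∂y > 0 on
[0,L] × [inf α, sup β], then φ converges (with its derivative) to an
L-periodic solution ϕ, which is the unique L-periodic solution with values
in [inf α, sup β]. -/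
theorem stmt_4 (L x₀ : ℝ) (hL : 0 < L) (f fy : ℝ × ℝ → ℝ)
    (hf : Continuous f) (hfy : Continuous fy)
    (hper : ∀ x y, f (x + L, y) = f (x, y))
    (hderiv : ∀ x y : ℝ, HasDerivAt (fun z => f (x, z)) (fy (x, y)) y)
    (α β αd αdd βd βdd : ℝ → ℝ)
    (hαbdd : ∃ C, ∀ x ∈ Ici x₀, |α x| ≤ C)
    (hβbdd : ∃ C, ∀ x ∈ Ici x₀, |β x| ≤ C)
    (hαd : ∀ x ∈ Ici x₀, HasDerivWithinAt α (αd x) (Ici x₀) x)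
    (hαdd : ∀ x ∈ Ici x₀, HasDerivWithinAt αd (αdd x) (Ici x₀) x)
    (hαc : ContinuousOn αdd (Ici x₀))
    (hβd : ∀ x ∈ Ici x₀, HasDerivWithinAt β (βd x) (Ici x₀) x)
    (hβdd : ∀ x ∈ Ici x₀, HasDerivWithinAt βd (βdd x) (Ici x₀) x)
    (hβc : ContinuousOn βdd (Ici x₀))
    (hord : ∀ x, x₀ < x → α x < β x)
    (hlow : ∀ x, x₀ < x → αdd x > f (x, α x))
    (hupp : ∀ x, x₀ < x → βdd x < f (x, β x))
    (hpos : 0 < sInf (fy ''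
      (Icc 0 L ×ˢ Icc (sInf (α '' Ici x₀)) (sSup (β '' Ici x₀))))) :
    ∃ φ φd : ℝ → ℝ,
      (∀ x ∈ Ici x₀, HasDerivWithinAt φ (φd x) (Ici x₀) x) ∧
      (∀ x ∈ Ici x₀, HasDerivWithinAt φd (f (x, φ x)) (Ici x₀) x) ∧
      (∀ x, x₀ < x → α x < φ x ∧ φ x < β x) ∧
      ∃ ϕ : ℝ → ℝ, ContDiff ℝ 2 ϕ ∧ (∀ x, deriv (deriv ϕ) x = f (x, ϕ x)) ∧
        (∀ x, ϕ (x + L) = ϕ x) ∧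
        Tendsto (fun x => |φ x - ϕ x| + |φd x - deriv ϕ x|) atTop (nhds 0) ∧
        (∀ ψ : ℝ → ℝ, ContDiff ℝ 2 ψ → (∀ x, deriv (deriv ψ) x = f (x, ψ x)) →
          (∀ x, ψ (x + L) = ψ x) →
          (∀ x, ψ x ∈ Icc (sInf (α '' Ici x₀)) (sSup (β '' Ici x₀))) → ψ = ϕ) := by
  have hbelow : BddBelow (α '' Ici x₀) := by
    obtain ⟨C, hC⟩ := hαbdd
    exact ⟨-C, forall_mem_image.2 fun x hx => (abs_le.1 (hC x hx)).1⟩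
  have habove : BddAbove (β '' Ici x₀) := by
    obtain ⟨C, hC⟩ := hβbdd
    exact ⟨C, forall_mem_image.2 fun x hx => (abs_le.1 (hC x hx)).2⟩
  set a := sInf (α '' Ici x₀)
  set b := sSup (β '' Ici x₀)
  have hord' : ∀ x ∈ Ici x₀, α x ≤ β x := by
    intro x hx
    rw [← closure_Ioi] at hx
    have hcl : closure (Ioi x₀) ⊆ Ici x₀ := (closure_Ioi x₀).subset
    exact le_on_closure (fun y hy => (hord y hy).le)
      (fun y hy => (hαd y (hcl hy)).continuousWithinAt.mono hcl)
      (fun y hy => (hβd y (hcl hy)).continuousWithinAt.mono hcl) hx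
  have haα : ∀ x ∈ Ici x₀, a ≤ α x := fun x hx => csInf_le hbelow (mem_image_of_mem α hx)
  have hβb : ∀ x ∈ Ici x₀, β x ≤ b := fun x hx => le_csSup habove (mem_image_of_mem β hx)
  have hαmem : ∀ x ∈ Ici x₀, α x ∈ Icc a b := fun x hx =>
    ⟨haα x hx, (hord' x hx).trans (hβb x hx)⟩
  have hβmem : ∀ x ∈ Ici x₀, β x ∈ Icc a b := fun x hx =>
    ⟨(haα x hx).trans (hord' x hx), hβb x hx⟩
  have hab : a ≤ b := (hαmem x₀ self_mem_Ici).1.trans (hαmem x₀ self_mem_Ici).2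
  obtain ⟨m, K, hm, hmK, hlo, hup⟩ := exists_increment_bounds hL hfy hper hderiv hpos
  set g := clampedExtension f a b m with hg
  have hgc : Continuous g := by
    have : g = fun p => f (p.1, max a (min b p.2)) + m * (p.2 - max a (min b p.2)) := rfl
    rw [this]
    fun_prop
  have hgf : ∀ x, ∀ y ∈ Icc a b, g (x, y) = f (x, y) := fun x y hy => clampedExtension_of_mem hy
  have hgper : ∀ x y, g (x + L, y) = g (x, y) := fun x y => by
    simp only [hg, clampedExtension, hper]
  have hglo : ∀ x y z, y ≤ z → m * (z - y) ≤ g (x, z) - g (x, y) := fun x y z h =>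
    (clampedExtension_sub_bounds hab hmK hlo hup x y z h).1
  have hgup : ∀ x y z, y ≤ z → g (x, z) - g (x, y) ≤ K * (z - y) := fun x y z h =>
    (clampedExtension_sub_bounds hab hmK hlo hup x y z h).2
  have hgmono : ∀ x y z, y ≤ z → g (x, y) ≤ g (x, z) := fun x y z h =>
    sub_nonneg.1 ((mul_nonneg hm.le (sub_nonneg.2 h)).trans (hglo x y z h))
  obtain ⟨B, hB⟩ : ∃ B, ∀ x, |g (x, 0)| ≤ B := by
    obtain ⟨B, hB⟩ := exists_abs_le_of_periodic hL hgc hgper 0 0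
    exact ⟨B, fun x => hB x 0 (by simp)⟩
  obtain ⟨φ, φd, hφ, hφd, hφ0, hφb⟩ :=
    exists_bounded_solution_half_line hm hmK hgc hglo hgup hB x₀ (α x₀)
  obtain ⟨ϕ, ϕd, hϕ, hϕd, hϕb⟩ := exists_bounded_solution_line hm hmK hgc hglo hgup hB
  have hαφ := lt_of_lower_solution hgmono hαd hαdd
    (fun x hx => by rw [hgf x _ (hαmem x hx.le)]; exact hlow x hx)
    (fun x _ => hφ x) hφd hαbdd hφb hφ0.ge
  have hφβ := lt_of_upper_solution hgmono hβd hβdd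
    (fun x hx => by rw [hgf x _ (hβmem x hx.le)]; exact hupp x hx)
    (fun x _ => hφ x) hφd hβbdd hφb (hφ0.trans_le (hord' x₀ self_mem_Ici))
  have hφmem : ∀ x ∈ Ici x₀, φ x ∈ Icc a b := by
    intro x hx
    rcases (mem_Ici.1 hx).eq_or_lt with rfl | hlt
    · rw [hφ0]; exact hαmem _ hx
    · exact ⟨(haα x hx).trans (hαφ x hlt).le, (hφβ x hlt).le.trans (hβb x hx)⟩
  have hϕper : Function.Periodic ϕ L := by
    refine congr_fun (eq_of_bounded_solutions hm hglo (u := fun x => ϕ (x + L))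
      (fun x => (hϕ (x + L)).comp_add_const x L) (fun x => ?_) hϕ hϕd ?_ hϕb)
    · rw [← hgper]
      exact (hϕd (x + L)).comp_add_const x L
    · exact hϕb.imp fun C hC x => hC _
  have hlim : Tendsto (fun x => φ x - ϕ x) atTop (nhds 0) :=
    tendsto_sub_of_bounded_solutions (x₀ := x₀) hm hglo (fun x _ => hφ x) hφd (fun x _ => hϕ x)
      (fun x _ => hϕd x) hφb (hϕb.imp fun C hC x _ => hC x)
  have hlim' : Tendsto (fun x => φd x - ϕd x) atTop (nhds 0) := by
    refine tendsto_deriv_zero_of_second_deriv_le (x₀ := x₀) (K := K)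
      (fun x _ => (hφ x).sub (hϕ x)) (fun x hx => (hφd x hx.le).sub (hϕd x)) (fun x _ => ?_) hlim
    change _ ≤ K * |φ x - ϕ x|
    rcases le_total (ϕ x) (φ x) with h | h
    · have := hgmono x _ _ h
      rw [abs_of_nonneg (sub_nonneg.2 h), abs_of_nonneg (sub_nonneg.2 this)]
      exact hgup x _ _ h
    · have := hgmono x _ _ h
      rw [abs_sub_comm, abs_sub_comm (φ x), abs_of_nonneg (sub_nonneg.2 h),
        abs_of_nonneg (sub_nonneg.2 this)]
      exact hgup x _ _ h
  have hϕmem := mem_Icc_of_periodic_of_tendsto_sub hL hφmem hϕper hlim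
  have hdϕ : deriv ϕ = ϕd := funext fun x => (hϕ x).deriv
  have hddϕ : deriv ϕd = fun x => g (x, ϕ x) := funext fun x => (hϕd x).deriv
  have hϕc : Continuous ϕ := continuous_iff_continuousAt.2 fun x => (hϕ x).continuousAt
  refine ⟨φ, φd, fun x _ => (hφ x).hasDerivWithinAt, fun x hx => ?_,
    fun x hx => ⟨hαφ x hx, hφβ x hx⟩, ϕ, ?_, fun x => ?_, hϕper, ?_, fun ψ hψ hψf hψper hψmem => ?_⟩
  · rw [← hgf x _ (hφmem x hx)]
    exact (hφd x hx).hasDerivWithinAt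
  · rw [show (2 : WithTop ℕ∞) = 1 + 1 from (one_add_one_eq_two).symm, contDiff_succ_iff_deriv]
    refine ⟨fun x => (hϕ x).differentiableAt, by simp, ?_⟩
    rw [hdϕ, contDiff_one_iff_deriv, hddϕ]
    exact ⟨fun x => (hϕd x).differentiableAt, by fun_prop⟩
  · rw [hdϕ, hddϕ]
    exact hgf x _ (hϕmem x)
  · rw [hdϕ]
    simpa using hlim.abs.add hlim'.abs
  · have hψ1 : ContDiff ℝ 1 (deriv ψ) := by
      rw [show (2 : WithTop ℕ∞) = 1 + 1 from (one_add_one_eq_two).symm,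
        contDiff_succ_iff_deriv] at hψ
      exact hψ.2.2
    refine eq_of_bounded_solutions hm hglo
      (fun x => (hψ.differentiable (by norm_num) x).hasDerivAt) (fun x => ?_) hϕ hϕd
      ⟨max |a| |b|, fun x => abs_le_max_abs_abs (hψmem x).1 (hψmem x).2⟩ hϕb
    rw [hgf x _ (hψmem x), ← hψf]
    exact (hψ1.differentiable (by norm_num) x).hasDerivAt
end

section
/- Fix g₁ ∈ ℝ and λ > 0, and set ρ = √((√(g₁² + 4λ²) − g₁)/2), α = √(2ρ² + (3/2)g₁), k = ρ√(ρ² + g₁/2). (Note ρ² + g₁/2 = √(g₁² + 4λ²)/2 > 0 and 2ρ² + (3/2)g₁ = √(g₁² + 4λ²) + g₁/2 > 0, and ρ² + α² − ρ² tanh²(kx) ≥ α² > 0 for all x.) Then the function φ(x) = ρ α tanh(kx) / √(ρ² + α² − ρ² tanh²(kx)) is C² on ℝ and satisfies φ''(x) + λ²φ(x) − g₁φ(x)³ − φ(x)⁵ = 0 for all x ∈ ℝ. -/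
lemma hasDerivAt_tanh_mul (k x : ℝ) :
    HasDerivAt (fun y => Real.tanh (k * y)) (k * (1 - Real.tanh (k * x) ^ 2)) x := by
  have hlin : HasDerivAt (fun y : ℝ => k * y) k x := by
    simpa using (hasDerivAt_id x).const_mul k
  have hc : Real.cosh (k * x) ≠ 0 := (Real.cosh_pos _).ne'
  have h := (hlin.sinh).div hlin.cosh hc
  have he : (fun y => Real.tanh (k * y)) =
      (fun y => Real.sinh (k * y)) / fun y => Real.cosh (k * y) := by
    funext y
    simp [Real.tanh_eq_sinh_div_cosh]
  rw [he]
  refine h.congr_deriv ?_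
  rw [Real.tanh_eq_sinh_div_cosh]
  field_simp

lemma contDiff_tanh_mul (k : ℝ) {n : WithTop ℕ∞} :
    ContDiff ℝ n (fun y => Real.tanh (k * y)) := by
  simp only [Real.tanh_eq_sinh_div_cosh]
  exact (Real.contDiff_sinh.comp (contDiff_const.mul contDiff_id)).div
    (Real.contDiff_cosh.comp (contDiff_const.mul contDiff_id)) fun y => (Real.cosh_pos _).ne'

/-- The explicit dark soliton φ(x) = ρα tanh(kx)/√(ρ² + α² − ρ² tanh²(kx))
is a C² solution of the autonomous cubic-quintic equation
φ'' + λ²φ − g₁φ³ − φ⁵ = 0. -/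
theorem stmt_6 (g₁ lam ρ a k : ℝ) (hlam : 0 < lam)
    (hρ : ρ = Real.sqrt ((Real.sqrt (g₁ ^ 2 + 4 * lam ^ 2) - g₁) / 2))
    (ha : a = Real.sqrt (2 * ρ ^ 2 + 3 / 2 * g₁))
    (hk : k = ρ * Real.sqrt (ρ ^ 2 + g₁ / 2))
    (φ : ℝ → ℝ)
    (hφ : φ = fun x =>
      ρ * a * Real.tanh (k * x) /
        Real.sqrt (ρ ^ 2 + a ^ 2 - ρ ^ 2 * Real.tanh (k * x) ^ 2)) :
    ContDiff ℝ 2 φ ∧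
      ∀ x : ℝ, deriv (deriv φ) x + lam ^ 2 * φ x - g₁ * φ x ^ 3 - φ x ^ 5 = 0 := by
  set S := Real.sqrt (g₁ ^ 2 + 4 * lam ^ 2) with hS
  have hS2 : S ^ 2 = g₁ ^ 2 + 4 * lam ^ 2 := Real.sq_sqrt (by positivity)
  have hSg : |g₁| < S := by
    rw [hS, ← Real.sqrt_sq_eq_abs]
    exact Real.sqrt_lt_sqrt (sq_nonneg _) (by nlinarith [pow_pos hlam 2])
  obtain ⟨hg1, hg2⟩ := abs_lt.mp hSg
  have hρ2 : ρ ^ 2 = (S - g₁) / 2 := by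
    rw [hρ, Real.sq_sqrt (by linarith)]
  have ha0 : 0 < 2 * ρ ^ 2 + 3 / 2 * g₁ := by rw [hρ2]; linarith
  have ha2 : a ^ 2 = 2 * ρ ^ 2 + 3 / 2 * g₁ := by
    rw [ha, Real.sq_sqrt ha0.le]
  have hk2 : k ^ 2 = ρ ^ 2 * (ρ ^ 2 + g₁ / 2) := by
    rw [hk, mul_pow, Real.sq_sqrt (by rw [hρ2]; linarith)]
  have hl2 : lam ^ 2 = ρ ^ 4 + g₁ * ρ ^ 2 := by
    have : ρ ^ 4 = (ρ ^ 2) ^ 2 := by ring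
    rw [this, hρ2]; linarith
  have hD : ∀ x, 0 < ρ ^ 2 + a ^ 2 - ρ ^ 2 * Real.tanh (k * x) ^ 2 := fun x => by
    nlinarith [Real.tanh_sq_lt_one (k * x), sq_nonneg ρ]
  have hs : ∀ x, HasDerivAt
      (fun y => Real.sqrt (ρ ^ 2 + a ^ 2 - ρ ^ 2 * Real.tanh (k * y) ^ 2))
      (-(ρ ^ 2 * Real.tanh (k * x) * (k * (1 - Real.tanh (k * x) ^ 2))) /
        Real.sqrt (ρ ^ 2 + a ^ 2 - ρ ^ 2 * Real.tanh (k * x) ^ 2)) x := fun x => by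
    have h := ((((hasDerivAt_tanh_mul k x).fun_pow 2).const_mul (ρ ^ 2)).const_sub
      (ρ ^ 2 + a ^ 2)).sqrt (hD x).ne'
    refine h.congr_deriv ?_
    have := (Real.sqrt_pos.mpr (hD x)).ne'
    field_simp
    push_cast
    ring
  have hd1 : deriv φ = fun x => ρ * a * (ρ ^ 2 + a ^ 2) * k * (1 - Real.tanh (k * x) ^ 2) /
      Real.sqrt (ρ ^ 2 + a ^ 2 - ρ ^ 2 * Real.tanh (k * x) ^ 2) ^ 3 := by
    funext x
    have hs0 := (Real.sqrt_pos.mpr (hD x)).ne'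
    have h := ((hasDerivAt_tanh_mul k x).const_mul (ρ * a)).fun_div (hs x) hs0
    rw [hφ, h.deriv]
    have hsq := Real.sq_sqrt (hD x).le
    generalize Real.sqrt (ρ ^ 2 + a ^ 2 - ρ ^ 2 * Real.tanh (k * x) ^ 2) = s at *
    generalize Real.tanh (k * x) = t at *
    field_simp
    rw [hsq]
    ring
  refine ⟨?_, fun x => ?_⟩
  · rw [hφ]
    refine (contDiff_const.mul (contDiff_tanh_mul k)).div (ContDiff.sqrt ?_ fun x => (hD x).ne')
      fun x => (Real.sqrt_pos.mpr (hD x)).ne'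
    exact contDiff_const.sub (contDiff_const.mul ((contDiff_tanh_mul k).pow 2))
  · have hs0 := (Real.sqrt_pos.mpr (hD x)).ne'
    have h := ((((hasDerivAt_tanh_mul k x).fun_pow 2).const_sub 1).const_mul
      (ρ * a * (ρ ^ 2 + a ^ 2) * k)).fun_div ((hs x).fun_pow 3) (pow_ne_zero 3 hs0)
    have hsq := Real.sq_sqrt (hD x).le
    rw [hd1, h.deriv, hφ]
    dsimp only
    generalize Real.sqrt (ρ ^ 2 + a ^ 2 - ρ ^ 2 * Real.tanh (k * x) ^ 2) = s at *
    generalize Real.tanh (k * x) = t at *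
    have hg : g₁ = 2 / 3 * (a ^ 2 - 2 * ρ ^ 2) := by linarith
    have hk3 : k ^ 2 = ρ ^ 2 * (ρ ^ 2 + a ^ 2) / 3 := by rw [hk2, hg]; ring
    have hl3 : lam ^ 2 = (2 * a ^ 2 * ρ ^ 2 - ρ ^ 4) / 3 := by rw [hl2, hg]; ring
    have key : ρ * a * t * ((ρ ^ 2 + a ^ 2) * k ^ 2 * (1 - t ^ 2) *
        (-2 * s ^ 2 + 3 * ρ ^ 2 * (1 - t ^ 2)) + lam ^ 2 * (s ^ 2) ^ 2
        - g₁ * (ρ * a * t) ^ 2 * s ^ 2 - (ρ * a * t) ^ 4) = 0 := by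
      rw [hk3, hl3, hg, hsq]; ring
    rw [← zero_div (s ^ 5), ← key]
    push_cast
    field_simp
    ring
end

section
/- Fix g₁ ∈ ℝ and 0 < λ₁ < λ₂. For j = 1, 2 set ρ_j = √((√(g₁² + 4λ_j²) − g₁)/2), α_j = √(2ρ_j² + (3/2)g₁), k_j = ρ_j√(ρ_j² + g₁/2), and φ_j(x) = ρ_j α_j tanh(k_j x) / √(ρ_j² + α_j² − ρ_j² tanh²(k_j x)). Then φ₁(0) = φ₂(0) = 0 and φ₁(x) < φ₂(x) for all x > 0. -/
theorem Real.tanh_lt_tanh {x y : ℝ} (h : x < y) : Real.tanh x < Real.tanh y := by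
  rw [Real.tanh_eq_sinh_div_cosh, Real.tanh_eq_sinh_div_cosh,
    div_lt_div_iff₀ (Real.cosh_pos x) (Real.cosh_pos y)]
  have hs : 0 < Real.sinh (y - x) := Real.sinh_pos_iff.mpr (sub_pos.mpr h)
  rw [Real.sinh_sub] at hs
  linarith

/-- The profile `ρ a t / √(ρ² + a² - ρ² t²)` is strictly increasing in `(ρ, a, t)`. -/
theorem solitonProfile_lt {ρ₁ ρ₂ a₁ a₂ t₁ t₂ : ℝ} (hρ₁ : 0 < ρ₁) (ha₁ : 0 < a₁) (ht₁ : 0 < t₁)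
    (hρ : ρ₁ < ρ₂) (ha : a₁ < a₂) (ht : t₁ < t₂) (ht₂ : t₂ < 1) :
    ρ₁ * a₁ * t₁ / Real.sqrt (ρ₁ ^ 2 + a₁ ^ 2 - ρ₁ ^ 2 * t₁ ^ 2) <
      ρ₂ * a₂ * t₂ / Real.sqrt (ρ₂ ^ 2 + a₂ ^ 2 - ρ₂ ^ 2 * t₂ ^ 2) := by
  have hρ₂ : 0 < ρ₂ := hρ₁.trans hρ
  have ha₂ : 0 < a₂ := ha₁.trans ha
  have ht₂' : 0 < t₂ := ht₁.trans ht
  have hr : ρ₁ ^ 2 < ρ₂ ^ 2 := by gcongr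
  have hA : a₁ ^ 2 < a₂ ^ 2 := by gcongr
  have hS : t₁ ^ 2 < t₂ ^ 2 := by gcongr
  have hS₂ : 0 < 1 - t₂ ^ 2 := by nlinarith
  have hS₁ : 0 < 1 - t₁ ^ 2 := by linarith
  have hD₁ : 0 < ρ₁ ^ 2 + a₁ ^ 2 - ρ₁ ^ 2 * t₁ ^ 2 := by
    have : 0 < ρ₁ ^ 2 * (1 - t₁ ^ 2) + a₁ ^ 2 := by positivity
    linarith
  have hD₂ : 0 < ρ₂ ^ 2 + a₂ ^ 2 - ρ₂ ^ 2 * t₂ ^ 2 := by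
    have : 0 < ρ₂ ^ 2 * (1 - t₂ ^ 2) + a₂ ^ 2 := by positivity
    linarith
  refine lt_of_pow_lt_pow_left₀ 2 (by positivity) ?_
  rw [div_pow, div_pow, Real.sq_sqrt hD₁.le, Real.sq_sqrt hD₂.le, div_lt_div_iff₀ hD₁ hD₂]
  have h₁ : ρ₁ ^ 2 * ρ₂ ^ 2 * (a₁ ^ 2 * t₁ ^ 2 * (1 - t₂ ^ 2)) <
      ρ₁ ^ 2 * ρ₂ ^ 2 * (a₂ ^ 2 * t₂ ^ 2 * (1 - t₁ ^ 2)) := by gcongr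
  have h₂ : a₁ ^ 2 * a₂ ^ 2 * (ρ₁ ^ 2 * t₁ ^ 2) < a₁ ^ 2 * a₂ ^ 2 * (ρ₂ ^ 2 * t₂ ^ 2) := by gcongr
  linear_combination h₁ + h₂


/-- For 0 < λ₁ < λ₂, the corresponding explicit dark solitons φ₁, φ₂ satisfy
φ₁(0) = φ₂(0) = 0 and φ₁(x) < φ₂(x) for all x > 0. -/
theorem stmt_8 (g₁ lam₁ lam₂ ρ₁ ρ₂ a₁ a₂ k₁ k₂ : ℝ)
    (hlam₁ : 0 < lam₁) (hlam : lam₁ < lam₂)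
    (hρ₁ : ρ₁ = Real.sqrt ((Real.sqrt (g₁ ^ 2 + 4 * lam₁ ^ 2) - g₁) / 2))
    (hρ₂ : ρ₂ = Real.sqrt ((Real.sqrt (g₁ ^ 2 + 4 * lam₂ ^ 2) - g₁) / 2))
    (ha₁ : a₁ = Real.sqrt (2 * ρ₁ ^ 2 + 3 / 2 * g₁))
    (ha₂ : a₂ = Real.sqrt (2 * ρ₂ ^ 2 + 3 / 2 * g₁))
    (hk₁ : k₁ = ρ₁ * Real.sqrt (ρ₁ ^ 2 + g₁ / 2))
    (hk₂ : k₂ = ρ₂ * Real.sqrt (ρ₂ ^ 2 + g₁ / 2))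
    (φ₁ φ₂ : ℝ → ℝ)
    (hφ₁ : φ₁ = fun x =>
      ρ₁ * a₁ * Real.tanh (k₁ * x) /
        Real.sqrt (ρ₁ ^ 2 + a₁ ^ 2 - ρ₁ ^ 2 * Real.tanh (k₁ * x) ^ 2))
    (hφ₂ : φ₂ = fun x =>
      ρ₂ * a₂ * Real.tanh (k₂ * x) /
        Real.sqrt (ρ₂ ^ 2 + a₂ ^ 2 - ρ₂ ^ 2 * Real.tanh (k₂ * x) ^ 2)) :
    φ₁ 0 = 0 ∧ φ₂ 0 = 0 ∧ ∀ x : ℝ, 0 < x → φ₁ x < φ₂ x := by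
  have hR₁ : |g₁| < Real.sqrt (g₁ ^ 2 + 4 * lam₁ ^ 2) :=
    Real.lt_sqrt_of_sq_lt (by rw [sq_abs]; linarith [pow_pos hlam₁ 2])
  have hR : Real.sqrt (g₁ ^ 2 + 4 * lam₁ ^ 2) < Real.sqrt (g₁ ^ 2 + 4 * lam₂ ^ 2) := by gcongr
  generalize Real.sqrt (g₁ ^ 2 + 4 * lam₁ ^ 2) = R₁ at *
  generalize Real.sqrt (g₁ ^ 2 + 4 * lam₂ ^ 2) = R₂ at *
  obtain ⟨hg, hg'⟩ := abs_lt.mp hR₁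
  have hsq₁ : ρ₁ ^ 2 = (R₁ - g₁) / 2 := by rw [hρ₁, Real.sq_sqrt (by linarith)]
  have hsq₂ : ρ₂ ^ 2 = (R₂ - g₁) / 2 := by rw [hρ₂, Real.sq_sqrt (by linarith)]
  have hρ₁_pos : 0 < ρ₁ := hρ₁ ▸ Real.sqrt_pos.mpr (by linarith)
  have hρ : ρ₁ < ρ₂ := by
    rw [hρ₁, hρ₂]; exact Real.sqrt_lt_sqrt (by linarith) (by linarith)
  have ha₁_pos : 0 < a₁ := ha₁ ▸ Real.sqrt_pos.mpr (by linarith)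
  have ha : a₁ < a₂ := by
    rw [ha₁, ha₂]; exact Real.sqrt_lt_sqrt (by linarith) (by linarith)
  have hk₁_pos : 0 < k₁ := hk₁ ▸ mul_pos hρ₁_pos (Real.sqrt_pos.mpr (by linarith))
  have hk : k₁ < k₂ := by
    rw [hk₁, hk₂]
    exact mul_lt_mul'' hρ (Real.sqrt_lt_sqrt (by linarith) (by linarith)) hρ₁_pos.le
      (Real.sqrt_nonneg _)
  subst hφ₁ hφ₂
  refine ⟨by simp, by simp, fun x hx => ?_⟩
  have ht₁ : 0 < Real.tanh (k₁ * x) := by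
    simpa using Real.tanh_lt_tanh (mul_pos hk₁_pos hx)
  exact solitonProfile_lt hρ₁_pos ha₁_pos ht₁ hρ ha
    (Real.tanh_lt_tanh (mul_lt_mul_of_pos_right hk hx)) (Real.tanh_lt_one _)
end

section
/- Fix real constants g₁, ω, L > 0 and a continuous L-periodic function V : ℝ → ℝ with V_min ≤ V(x) ≤ V_max for all x. Assume ω > −V_min, set Ṽ(x) = ω + V(x), λ_1 = √(ω + V_min), λ_2 = √(ω + V_max), and ρ_j = √((√(g₁² + 4λ_j²) − g₁)/2) for j = 1, 2. Then there exists an L-periodic C² solution φ₊ : ℝ → ℝ of φ'' + Ṽ(x)φ − g₁φ³ − φ⁵ = 0 satisfying ρ₁ ≤ φ₊(x) ≤ ρ₂ for all x; in particular φ₊ is positive, and φ₋ := −φ₊ is a negative L-periodic solution. -/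
open MeasureTheory Set Filter Topology

/-- One-sided exponential average `∫_0^∞ exp (-k s) h (x + s) ds`. -/
noncomputable def expAvg (k : ℝ) (h : ℝ → ℝ) (x : ℝ) : ℝ :=
  ∫ s in Ioi (0 : ℝ), Real.exp (-k * s) * h (x + s)

lemma integrableOn_exp_mul_of_bounded {k C : ℝ} (hk : 0 < k) {h : ℝ → ℝ} (hm : Measurable h)
    (hb : ∀ x, |h x| ≤ C) (a : ℝ) :
    IntegrableOn (fun s => Real.exp (-k * s) * h s) (Ioi a) :=
  Integrable.mul_bdd (c := C) (exp_neg_integrableOn_Ioi a hk) hm.aestronglyMeasurable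
    (ae_of_all _ fun x => by simpa using hb x)

lemma expAvg_integrableOn {k C : ℝ} (hk : 0 < k) {h : ℝ → ℝ} (hm : Measurable h)
    (hb : ∀ x, |h x| ≤ C) (x : ℝ) :
    IntegrableOn (fun s => Real.exp (-k * s) * h (x + s)) (Ioi 0) :=
  integrableOn_exp_mul_of_bounded hk (hm.comp (measurable_const_add x)) (fun s => hb (x + s)) 0

lemma expAvg_const {k : ℝ} (hk : 0 < k) (c x : ℝ) : expAvg k (fun _ => c) x = c / k := by
  rw [expAvg, integral_mul_const, integral_exp_mul_Ioi (neg_lt_zero.mpr hk)]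
  simp
  field_simp

lemma expAvg_mono {k C D : ℝ} (hk : 0 < k) {f g : ℝ → ℝ} (hf : Measurable f) (hg : Measurable g)
    (hfb : ∀ x, |f x| ≤ C) (hgb : ∀ x, |g x| ≤ D) (hfg : ∀ x, f x ≤ g x) (x : ℝ) :
    expAvg k f x ≤ expAvg k g x :=
  setIntegral_mono (expAvg_integrableOn hk hf hfb x) (expAvg_integrableOn hk hg hgb x)
    fun s => mul_le_mul_of_nonneg_left (hfg (x + s)) (Real.exp_pos _).le

lemma expAvg_tendsto {k C : ℝ} (hk : 0 < k) {f : ℕ → ℝ → ℝ} {g : ℝ → ℝ}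
    (hf : ∀ n, Measurable (f n)) (hb : ∀ n x, |f n x| ≤ C)
    (hlim : ∀ x, Tendsto (fun n => f n x) atTop (𝓝 (g x))) (x : ℝ) :
    Tendsto (fun n => expAvg k (f n) x) atTop (𝓝 (expAvg k g x)) := by
  refine tendsto_integral_of_dominated_convergence (fun s => Real.exp (-k * s) * C) (fun n => ?_)
    ((exp_neg_integrableOn_Ioi 0 hk).mul_const C) (fun n => ae_of_all _ fun s => ?_)
    (ae_of_all _ fun s => (hlim (x + s)).const_mul _)
  · exact (expAvg_integrableOn hk (hf n) (hb n) x).aestronglyMeasurable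
  · rw [norm_mul, Real.norm_eq_abs, Real.abs_exp, Real.norm_eq_abs]
    exact mul_le_mul_of_nonneg_left (hb n _) (Real.exp_pos _).le

lemma expAvg_eq {k C : ℝ} (hk : 0 < k) {h : ℝ → ℝ} (hm : Measurable h)
    (hb : ∀ x, |h x| ≤ C) (x : ℝ) :
    expAvg k h x = Real.exp (k * x) * ((∫ s in Ioi (0 : ℝ), Real.exp (-k * s) * h s) -
      ∫ s in (0 : ℝ)..x, Real.exp (-k * s) * h s) := by
  have hi := integrableOn_exp_mul_of_bounded hk hm hb
  rw [← intervalIntegral.integral_Ioi_sub_Ioi' (hi 0) (hi x), sub_sub_cancel,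
    ← integral_const_mul, ← integral_indicator measurableSet_Ioi,
    ← integral_add_right_eq_self _ x, expAvg, ← integral_indicator measurableSet_Ioi]
  congr 1 with s
  by_cases hs : 0 < s
  · rw [indicator_of_mem (mem_Ioi.mpr hs), indicator_of_mem (by simpa using hs), ← mul_assoc,
      ← Real.exp_add, add_comm s x]
    ring_nf
  · rw [indicator_of_notMem (by simpa using hs), indicator_of_notMem (by simpa using hs)]

lemma intervalIntegrable_exp_mul {k C : ℝ} {h : ℝ → ℝ} (hm : Measurable h)
    (hb : ∀ x, |h x| ≤ C) (a b : ℝ) :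
    IntervalIntegrable (fun s => Real.exp (-k * s) * h s) volume a b := by
  have hc : IntervalIntegrable (fun s => Real.exp (-k * s)) volume a b :=
    (by fun_prop : Continuous fun s => Real.exp (-k * s)).intervalIntegrable a b
  rw [intervalIntegrable_iff] at hc ⊢
  exact Integrable.mul_bdd (c := C) hc hm.aestronglyMeasurable
    (ae_of_all _ fun x => by simpa using hb x)

lemma expAvg_continuous {k C : ℝ} (hk : 0 < k) {h : ℝ → ℝ} (hm : Measurable h)
    (hb : ∀ x, |h x| ≤ C) : Continuous (expAvg k h) := by
  have hc := intervalIntegral.continuous_primitive (intervalIntegrable_exp_mul (k := k) hm hb) 0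
  rw [funext (expAvg_eq hk hm hb)]
  fun_prop

lemma expAvg_hasDerivAt {k C : ℝ} (hk : 0 < k) {h : ℝ → ℝ} (hc : Continuous h)
    (hb : ∀ x, |h x| ≤ C) (x : ℝ) : HasDerivAt (expAvg k h) (k * expAvg k h x - h x) x := by
  have hcont : Continuous fun s => Real.exp (-k * s) * h s := by fun_prop
  have h1 := hcont.integral_hasStrictDerivAt 0 x |>.hasDerivAt
  have h2 : HasDerivAt (fun x : ℝ => Real.exp (k * x)) (Real.exp (k * x) * k) x := by
    simpa using ((hasDerivAt_id x).const_mul k).exp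
  have h3 := h2.mul (h1.const_sub (∫ s in Ioi (0 : ℝ), Real.exp (-k * s) * h s))
  rw [funext (expAvg_eq hk hc.measurable hb)]
  refine h3.congr_deriv ?_
  have h4 : Real.exp (k * x) * Real.exp (-k * x) = 1 := by
    rw [← Real.exp_add]; simp
  linear_combination (-h x) * h4

/-- The bounded solution operator of `k² u - u'' = h` on the line. -/
noncomputable def resolventLine (k : ℝ) (h : ℝ → ℝ) (x : ℝ) : ℝ :=
  (expAvg k h x + expAvg k (fun y => h (-y)) (-x)) / (2 * k)

lemma resolventLine_const {k : ℝ} (hk : 0 < k) (c x : ℝ) :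
    resolventLine k (fun _ => k ^ 2 * c) x = c := by
  rw [resolventLine, expAvg_const hk, expAvg_const hk]
  field_simp
  ring

lemma resolventLine_mono {k C D : ℝ} (hk : 0 < k) {f g : ℝ → ℝ} (hf : Measurable f)
    (hg : Measurable g) (hfb : ∀ x, |f x| ≤ C) (hgb : ∀ x, |g x| ≤ D) (hfg : ∀ x, f x ≤ g x)
    (x : ℝ) : resolventLine k f x ≤ resolventLine k g x := by
  have h1 := expAvg_mono hk hf hg hfb hgb hfg x
  have h2 := expAvg_mono hk (hf.comp measurable_neg) (hg.comp measurable_neg)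
    (fun y => hfb (-y)) (fun y => hgb (-y)) (fun y => hfg (-y)) (-x)
  exact div_le_div_of_nonneg_right (add_le_add h1 h2) (by positivity)

lemma resolventLine_tendsto {k C : ℝ} (hk : 0 < k) {f : ℕ → ℝ → ℝ} {g : ℝ → ℝ}
    (hf : ∀ n, Measurable (f n)) (hb : ∀ n x, |f n x| ≤ C)
    (hlim : ∀ x, Tendsto (fun n => f n x) atTop (𝓝 (g x))) (x : ℝ) :
    Tendsto (fun n => resolventLine k (f n) x) atTop (𝓝 (resolventLine k g x)) :=
  ((expAvg_tendsto hk hf hb hlim x).add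
    (expAvg_tendsto hk (fun n => (hf n).comp measurable_neg) (fun n y => hb n (-y))
      (fun y => hlim (-y)) (-x))).div_const _

lemma resolventLine_continuous {k C : ℝ} (hk : 0 < k) {h : ℝ → ℝ} (hm : Measurable h)
    (hb : ∀ x, |h x| ≤ C) : Continuous (resolventLine k h) :=
  ((expAvg_continuous hk hm hb).add ((expAvg_continuous hk (hm.comp measurable_neg)
    (fun y => hb (-y))).comp continuous_neg)).div_const _

lemma resolventLine_periodic {k L : ℝ} {h : ℝ → ℝ} (hp : Function.Periodic h L) :
    Function.Periodic (resolventLine k h) L := by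
  intro x
  have h1 (s : ℝ) : h (x + L + s) = h (x + s) := by rw [add_right_comm, hp]
  have h2 (s : ℝ) : h (-(-(x + L) + s)) = h (-(-x + s)) := by
    rw [show -(-(x + L) + s) = -(-x + s) + L by ring, hp]
  simp only [resolventLine, expAvg, h1, h2]

lemma resolventLine_ode {k C : ℝ} (hk : 0 < k) {h : ℝ → ℝ} (hc : Continuous h)
    (hb : ∀ x, |h x| ≤ C) :
    ContDiff ℝ 2 (resolventLine k h) ∧
      ∀ x, deriv (deriv (resolventLine k h)) x = k ^ 2 * resolventLine k h x - h x := by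
  have hc' : Continuous fun y => h (-y) := hc.comp continuous_neg
  have hb' : ∀ y, |h (-y)| ≤ C := fun y => hb (-y)
  have h1 := expAvg_hasDerivAt hk hc hb
  have h2 (x : ℝ) : HasDerivAt (fun x => expAvg k (fun y => h (-y)) (-x))
      (-(k * expAvg k (fun y => h (-y)) (-x) - h x)) x := by
    refine ((expAvg_hasDerivAt hk hc' hb' (-x)).comp x (hasDerivAt_neg x)).congr_deriv ?_
    simp
  have d1 (x : ℝ) : HasDerivAt (resolventLine k h)
      ((expAvg k h x - expAvg k (fun y => h (-y)) (-x)) / 2) x := by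
    refine (((h1 x).add (h2 x)).div_const (2 * k)).congr_deriv ?_
    field_simp
    ring
  have e1 : deriv (resolventLine k h) =
      fun x => (expAvg k h x - expAvg k (fun y => h (-y)) (-x)) / 2 :=
    funext fun x => (d1 x).deriv
  have d2 (x : ℝ) : HasDerivAt (deriv (resolventLine k h))
      (k ^ 2 * resolventLine k h x - h x) x := by
    rw [e1]
    refine (((h1 x).sub (h2 x)).div_const 2).congr_deriv ?_
    rw [resolventLine]
    field_simp
    ring
  refine ⟨?_, fun x => (d2 x).deriv⟩
  rw [show (2 : WithTop ℕ∞) = 1 + 1 by norm_num, contDiff_succ_iff_deriv]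
  refine ⟨fun x => (d1 x).differentiableAt, by simp, contDiff_one_iff_deriv.mpr
    ⟨fun x => (d2 x).differentiableAt, ?_⟩⟩
  rw [funext fun x => (d2 x).deriv]
  exact ((resolventLine_continuous hk hc.measurable hb).const_mul _).sub hc

/-- Monotone iteration between constant ordered sub- and supersolutions. -/
theorem exists_periodic_solution_between {k L a b : ℝ} (hk : 0 < k) (hab : a ≤ b)
    {F : ℝ → ℝ → ℝ} (hF : Continuous (Function.uncurry F))
    (hper : ∀ x u, F (x + L) u = F x u) (hmono : ∀ x, MonotoneOn (F x) (Icc a b))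
    (hsub : ∀ x, k ^ 2 * a ≤ F x a) (hsup : ∀ x, F x b ≤ k ^ 2 * b) :
    ∃ u : ℝ → ℝ, ContDiff ℝ 2 u ∧ (∀ x, deriv (deriv u) x = k ^ 2 * u x - F x (u x)) ∧
      Function.Periodic u L ∧ ∀ x, u x ∈ Icc a b := by
  set T : (ℝ → ℝ) → ℝ → ℝ := fun u => resolventLine k fun y => F y (u y) with hT
  have hmeas {u : ℝ → ℝ} (hu : Measurable u) : Measurable fun y => F y (u y) :=
    hF.measurable.comp (measurable_id.prodMk hu)
  have hge {u : ℝ → ℝ} (hu : ∀ x, u x ∈ Icc a b) (y : ℝ) : k ^ 2 * a ≤ F y (u y) :=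
    (hsub y).trans (hmono y ⟨le_rfl, hab⟩ (hu y) (hu y).1)
  have hle {u : ℝ → ℝ} (hu : ∀ x, u x ∈ Icc a b) (y : ℝ) : F y (u y) ≤ k ^ 2 * b :=
    (hmono y (hu y) ⟨hab, le_rfl⟩ (hu y).2).trans (hsup y)
  have hbd {u : ℝ → ℝ} (hu : ∀ x, u x ∈ Icc a b) (y : ℝ) :
      |F y (u y)| ≤ max |k ^ 2 * a| |k ^ 2 * b| :=
    abs_le_max_abs_abs (hge hu y) (hle hu y)
  have hmem {u : ℝ → ℝ} (hum : Measurable u) (hu : ∀ x, u x ∈ Icc a b) (x : ℝ) :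
      T u x ∈ Icc a b := by
    constructor
    · have := resolventLine_mono hk measurable_const (hmeas hum) (fun _ => le_rfl) (hbd hu)
        (hge hu) x
      rwa [resolventLine_const hk] at this
    · have := resolventLine_mono hk (hmeas hum) measurable_const (hbd hu) (fun _ => le_rfl)
        (hle hu) x
      rwa [resolventLine_const hk] at this
  set v : ℕ → ℝ → ℝ := fun n => T^[n] fun _ => a with hv
  have hvs (n : ℕ) : v (n + 1) = T (v n) := Function.iterate_succ_apply' T n _
  have hvI (n : ℕ) : Measurable (v n) ∧ (∀ x, v n x ∈ Icc a b) ∧ Function.Periodic (v n) L := by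
    induction n with
    | zero => exact ⟨measurable_const, fun _ => ⟨le_rfl, hab⟩, fun _ => rfl⟩
    | succ n ih =>
      obtain ⟨hm, hI, hp⟩ := ih
      rw [hvs]
      exact ⟨(resolventLine_continuous hk (hmeas hm) (hbd hI)).measurable, hmem hm hI,
        resolventLine_periodic fun y => by rw [hp, hper]⟩
  have hstep (n : ℕ) (x : ℝ) : v n x ≤ v (n + 1) x := by
    induction n generalizing x with
    | zero => exact ((hvI 1).2.1 x).1
    | succ n ih =>
      rw [hvs, hvs (n + 1)]
      exact resolventLine_mono hk (hmeas (hvI n).1) (hmeas (hvI (n + 1)).1) (hbd (hvI n).2.1)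
        (hbd (hvI (n + 1)).2.1) (fun y => hmono y ((hvI n).2.1 y) ((hvI (n + 1)).2.1 y) (ih y)) x
  set u : ℝ → ℝ := fun x => ⨆ n, v n x with hu
  have hlim (x : ℝ) : Tendsto (fun n => v n x) atTop (𝓝 (u x)) :=
    tendsto_atTop_ciSup (monotone_nat_of_le_succ fun n => hstep n x)
      ⟨b, by rintro _ ⟨n, rfl⟩; exact ((hvI n).2.1 x).2⟩
  have huI (x : ℝ) : u x ∈ Icc a b :=
    isClosed_Icc.mem_of_tendsto (hlim x) (Eventually.of_forall fun n => (hvI n).2.1 x)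
  have hum : Measurable u :=
    measurable_of_tendsto_metrizable (fun n => (hvI n).1) (tendsto_pi_nhds.mpr hlim)
  have hfix : u = T u := by
    funext x
    refine tendsto_nhds_unique ((tendsto_add_atTop_iff_nat 1).mpr (hlim x)) ?_
    simp only [hvs]
    refine resolventLine_tendsto hk (fun n => hmeas (hvI n).1) (fun n => hbd (hvI n).2.1)
      (fun y => ?_) x
    exact (hF.comp (Continuous.prodMk_right y)).continuousAt.tendsto.comp (hlim y)
  have huc : Continuous u := by
    rw [hfix]
    exact resolventLine_continuous hk (hmeas hum) (hbd huI)
  have hode := resolventLine_ode hk (hF.comp (continuous_id.prodMk huc)) (hbd huI)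
  change ContDiff ℝ 2 (T u) ∧ ∀ x, deriv (deriv (T u)) x = k ^ 2 * T u x - F x (u x) at hode
  rw [← hfix] at hode
  refine ⟨u, hode.1, hode.2, fun x => ?_, huI⟩
  simp only [hu, (hvI _).2.2 x]

lemma equilibrium_pos_and_eq (g : ℝ) {lam : ℝ} (hlam : 0 < lam) {ρ : ℝ}
    (hρ : ρ = Real.sqrt ((Real.sqrt (g ^ 2 + 4 * lam) - g) / 2)) :
    0 < ρ ∧ ρ ^ 4 + g * ρ ^ 2 = lam := by
  have h1 : g < Real.sqrt (g ^ 2 + 4 * lam) :=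
    Real.lt_sqrt_of_sq_lt (by linarith)
  have h2 : Real.sqrt (g ^ 2 + 4 * lam) ^ 2 = g ^ 2 + 4 * lam := Real.sq_sqrt (by positivity)
  have h3 : ρ ^ 2 = (Real.sqrt (g ^ 2 + 4 * lam) - g) / 2 := by
    rw [hρ, Real.sq_sqrt (by linarith)]
  refine ⟨hρ ▸ Real.sqrt_pos.mpr (by linarith), ?_⟩
  rw [show ρ ^ 4 = (ρ ^ 2) ^ 2 by ring, h3]
  linear_combination h2 / 4

lemma monotoneOn_cubicQuintic {g b w K : ℝ} (hw : 0 ≤ w) (hb : 0 ≤ b)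
    (hK : 3 * |g| * b ^ 2 + 5 * b ^ 4 ≤ K) :
    MonotoneOn (fun u => K * u + w * u - g * u ^ 3 - u ^ 5) (Icc 0 b) := by
  intro u hu v hv huv
  obtain ⟨hu0, hub⟩ := hu
  obtain ⟨hv0, hvb⟩ := hv
  have q1 : u ^ 2 + u * v + v ^ 2 ≤ 3 * b ^ 2 := by nlinarith
  have q0 : 0 ≤ u ^ 2 + u * v + v ^ 2 := by positivity
  have p1 : g * (u ^ 2 + u * v + v ^ 2) ≤ |g| * (3 * b ^ 2) :=
    mul_le_mul (le_abs_self g) q1 q0 (abs_nonneg g)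
  have m (i j : ℕ) : u ^ i * v ^ j ≤ b ^ i * b ^ j := by gcongr
  have p2 : u ^ 4 + u ^ 3 * v + u ^ 2 * v ^ 2 + u * v ^ 3 + v ^ 4 ≤ 5 * b ^ 4 := by
    have := m 4 0
    have := m 3 1
    have := m 2 2
    have := m 1 3
    have := m 0 4
    ring_nf at *
    linarith
  have := mul_nonneg (sub_nonneg.mpr huv) (show 0 ≤ K + w - g * (u ^ 2 + u * v + v ^ 2) -
    (u ^ 4 + u ^ 3 * v + u ^ 2 * v ^ 2 + u * v ^ 3 + v ^ 4) by linarith)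
  change K * u + w * u - g * u ^ 3 - u ^ 5 ≤ K * v + w * v - g * v ^ 3 - v ^ 5
  linarith


/-- Existence of a positive L-periodic solution φ₊ of the stationary
cubic-quintic equation with ρ₁ ≤ φ₊ ≤ ρ₂; by symmetry φ₋ = −φ₊ is a negative
L-periodic solution. -/
theorem stmt_10 (g₁ ω L Vmin Vmax : ℝ) (hL : 0 < L) (V : ℝ → ℝ)
    (hV : Continuous V) (hper : ∀ x, V (x + L) = V x)
    (hbd : ∀ x, Vmin ≤ V x ∧ V x ≤ Vmax)
    (hω : ω > -Vmin) (ρ₁ ρ₂ : ℝ)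
    (hρ₁ : ρ₁ = Real.sqrt ((Real.sqrt (g₁ ^ 2 + 4 * (ω + Vmin)) - g₁) / 2))
    (hρ₂ : ρ₂ = Real.sqrt ((Real.sqrt (g₁ ^ 2 + 4 * (ω + Vmax)) - g₁) / 2)) :
    ∃ φp : ℝ → ℝ, ContDiff ℝ 2 φp ∧
      (∀ x, deriv (deriv φp) x + (ω + V x) * φp x - g₁ * φp x ^ 3 - φp x ^ 5 = 0) ∧
      (∀ x, φp (x + L) = φp x) ∧
      (∀ x, ρ₁ ≤ φp x ∧ φp x ≤ ρ₂) ∧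
      (∀ x, 0 < φp x) ∧
      (∀ x, deriv (deriv (fun y => -φp y)) x + (ω + V x) * (-φp x) -
        g₁ * (-φp x) ^ 3 - (-φp x) ^ 5 = 0) ∧
      (∀ x, -φp x < 0) := by
  have hw (x : ℝ) : 0 < ω + V x := by linarith [(hbd x).1]
  obtain ⟨h1, e1⟩ := equilibrium_pos_and_eq g₁ (by linarith) hρ₁
  obtain ⟨h2, e2⟩ := equilibrium_pos_and_eq g₁ (by linarith [hbd 0]) hρ₂
  have hle : ρ₁ ≤ ρ₂ := by
    rw [hρ₁, hρ₂]
    gcongr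
    exact (hbd 0).1.trans (hbd 0).2
  set k : ℝ := Real.sqrt (3 * |g₁| * ρ₂ ^ 2 + 5 * ρ₂ ^ 4) with hk
  have hk0 : 0 < k := Real.sqrt_pos.mpr (by positivity)
  have hk2 : k ^ 2 = 3 * |g₁| * ρ₂ ^ 2 + 5 * ρ₂ ^ 4 := Real.sq_sqrt (by positivity)
  obtain ⟨u, hu, hode, hp, hI⟩ := exists_periodic_solution_between (L := L) hk0 hle
    (F := fun x u => k ^ 2 * u + (ω + V x) * u - g₁ * u ^ 3 - u ^ 5)
    (by unfold Function.uncurry; fun_prop) (fun x u => by rw [hper])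
    (fun x => (monotoneOn_cubicQuintic (hw x).le h2.le hk2.ge).mono (Icc_subset_Icc_left h1.le))
    (fun x => by
      have := mul_nonneg h1.le (sub_nonneg.mpr (hbd x).1)
      linear_combination this + ρ₁ * e1)
    (fun x => by
      have := mul_nonneg h2.le (sub_nonneg.mpr (hbd x).2)
      linear_combination this - ρ₂ * e2)
  have hpos (x : ℝ) : 0 < u x := h1.trans_le (hI x).1
  refine ⟨u, hu, fun x => ?_, hp, hI, hpos, fun x => ?_, fun x => neg_neg_of_pos (hpos x)⟩
  · rw [hode]
    ring
  · have hn : deriv (deriv fun y => -u y) x = -deriv (deriv u) x := by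
      rw [show deriv (fun y => -u y) = fun y => -deriv u y from funext fun y => deriv.fun_neg]
      exact deriv.fun_neg
    rw [hn, hode]
    ring
end

section
/- Fix real constants g₁, ω, L > 0 and a continuous L-periodic function V : ℝ → ℝ with V_min ≤ V(x) ≤ V_max. Assume ω > −V_min, set Ṽ(x) = ω + V(x), λ_j and ρ_j as usual, and suppose λ₁² < Ṽ(x) < λ₂² for all x (i.e. V_min < V(x) < V_max everywhere). Let φ₁, φ₂ be the explicit heteroclinics φ_j(x) = ρ_j α_j tanh(k_j x)/√(ρ_j² + α_j² − ρ_j² tanh²(k_j x)) with α_j = √(2ρ_j² + (3/2)g₁), k_j = ρ_j√(ρ_j² + g₁/2). Then for all x > 0: φ₁''(x) > g₁φ₁(x)³ + φ₁(x)⁵ − Ṽ(x)φ₁(x) and φ₂''(x) < g₁φ₂(x)³ + φ₂(x)⁵ − Ṽ(x)φ₂(x); i.e., φ₁ and φ₂ are respectively a lower and an upper solution of the stationary equation φ'' = g₁φ³ + φ⁵ − Ṽ(x)φ on (0, +∞). -/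
/-- First and second derivatives of the `tanh` profile with amplitude `c` and speed `k`. -/
theorem deriv_deriv_tanhProfile (c k r M : ℝ) (hM : r ^ 2 < M) (x : ℝ) :
    deriv (deriv fun x => c * Real.tanh (k * x) /
        Real.sqrt (M - r ^ 2 * Real.tanh (k * x) ^ 2)) x =
      c * k ^ 2 * M * (1 - Real.tanh (k * x) ^ 2) * Real.tanh (k * x) *
        (3 * r ^ 2 * (1 - Real.tanh (k * x) ^ 2) -
          2 * (M - r ^ 2 * Real.tanh (k * x) ^ 2)) /
        Real.sqrt (M - r ^ 2 * Real.tanh (k * x) ^ 2) ^ 5 := by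
  have hpos : ∀ y, 0 < M - r ^ 2 * Real.tanh (k * y) ^ 2 := fun y => by
    have := Real.tanh_sq_lt_one (k * y)
    nlinarith [sq_nonneg r]
  have ht : ∀ y, HasDerivAt (fun x => Real.tanh (k * x))
      (k * (1 - Real.tanh (k * y) ^ 2)) y := fun y => by
    have hc := (Real.cosh_pos (k * y)).ne'
    have hl : HasDerivAt (fun x => k * x) k y := by
      simpa using (hasDerivAt_id y).const_mul k
    have h := (hl.sinh).div (hl.cosh) hc
    have he : (fun x => Real.tanh (k * x)) =
        (fun x => Real.sinh (k * x)) / fun x => Real.cosh (k * x) := by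
      funext z
      simp [Real.tanh_eq_sinh_div_cosh]
    rw [he]
    refine h.congr_deriv ?_
    rw [Real.tanh_eq_sinh_div_cosh]
    field_simp
  have hw : ∀ y, HasDerivAt (fun x => Real.sqrt (M - r ^ 2 * Real.tanh (k * x) ^ 2))
      (-(r ^ 2 * Real.tanh (k * y) * (k * (1 - Real.tanh (k * y) ^ 2))) /
        Real.sqrt (M - r ^ 2 * Real.tanh (k * y) ^ 2)) y := fun y => by
    have h := ((((ht y).fun_pow 2).const_mul (r ^ 2)).const_sub M).sqrt (hpos y).ne'
    refine h.congr_deriv ?_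
    have := (Real.sqrt_pos.2 (hpos y)).ne'
    push_cast
    field_simp
  have h1 : (deriv fun x => c * Real.tanh (k * x) /
        Real.sqrt (M - r ^ 2 * Real.tanh (k * x) ^ 2)) =
      fun y => c * k * M * (1 - Real.tanh (k * y) ^ 2) /
        Real.sqrt (M - r ^ 2 * Real.tanh (k * y) ^ 2) ^ 3 := by
    funext y
    have hs := (Real.sqrt_pos.2 (hpos y)).ne'
    have hq := Real.sq_sqrt (hpos y).le
    refine (((ht y).const_mul c).fun_div (hw y) hs).deriv.trans ?_
    generalize Real.sqrt (M - r ^ 2 * Real.tanh (k * y) ^ 2) = w at *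
    generalize Real.tanh (k * y) = t at *
    field_simp
    linear_combination c * k * (1 - t ^ 2) * hq
  rw [h1]
  have hs := (Real.sqrt_pos.2 (hpos x)).ne'
  have hq := Real.sq_sqrt (hpos x).le
  refine (((((ht x).fun_pow 2).const_sub 1).const_mul (c * k * M)).fun_div
    ((hw x).fun_pow 3) (pow_ne_zero 3 hs)).deriv.trans ?_
  generalize Real.sqrt (M - r ^ 2 * Real.tanh (k * x) ^ 2) = w at *
  generalize Real.tanh (k * x) = t at *
  rw [← hq]
  field_simp
  push_cast
  ring

/-- The explicit heteroclinic is positive on `(0, ∞)` and solves the constant-coefficient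
cubic-quintic equation. -/
theorem heteroclinic_pos_and_deriv_deriv (g Λ r a k : ℝ) (hΛ : 0 < Λ)
    (hr : r = Real.sqrt ((Real.sqrt (g ^ 2 + 4 * Λ) - g) / 2))
    (ha : a = Real.sqrt (2 * r ^ 2 + 3 / 2 * g))
    (hk : k = r * Real.sqrt (r ^ 2 + g / 2)) (φ : ℝ → ℝ)
    (hφ : φ = fun x => r * a * Real.tanh (k * x) /
        Real.sqrt (r ^ 2 + a ^ 2 - r ^ 2 * Real.tanh (k * x) ^ 2)) (x : ℝ) (hx : 0 < x) :
    0 < φ x ∧ deriv (deriv φ) x = g * φ x ^ 3 + φ x ^ 5 - Λ * φ x := by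
  have hS : |g| < Real.sqrt (g ^ 2 + 4 * Λ) := by
    apply Real.lt_sqrt_of_sq_lt
    rw [sq_abs]
    linarith
  have hS2 : Real.sqrt (g ^ 2 + 4 * Λ) ^ 2 = g ^ 2 + 4 * Λ := Real.sq_sqrt (by positivity)
  generalize Real.sqrt (g ^ 2 + 4 * Λ) = S at *
  obtain ⟨hS3, hS4⟩ := abs_lt.1 hS
  have hr0 : 0 < r := hr ▸ Real.sqrt_pos.2 (by linarith)
  have hr2 : r ^ 2 = (S - g) / 2 := by rw [hr, Real.sq_sqrt (by linarith)]
  have ha0 : 0 < a := ha ▸ Real.sqrt_pos.2 (by linarith)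
  have ha2 : a ^ 2 = 2 * r ^ 2 + 3 / 2 * g := by rw [ha, Real.sq_sqrt (by linarith)]
  have hk0 : 0 < k := hk ▸ mul_pos hr0 (Real.sqrt_pos.2 (by linarith))
  have hk2 : k ^ 2 = r ^ 2 * (r ^ 2 + g / 2) := by
    rw [hk, mul_pow, Real.sq_sqrt (by linarith)]
  have hΛr : Λ = r ^ 4 + g * r ^ 2 := by
    rw [show r ^ 4 = (r ^ 2) ^ 2 by ring, hr2]
    linarith
  have hM : r ^ 2 < r ^ 2 + a ^ 2 := by linarith [pow_pos ha0 2]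
  have ht0 : 0 < Real.tanh (k * x) := by
    rw [Real.tanh_eq_sinh_div_cosh]
    exact div_pos (Real.sinh_pos_iff.2 (by positivity)) (Real.cosh_pos _)
  have ht1 := Real.tanh_sq_lt_one (k * x)
  have hD : 0 < r ^ 2 + a ^ 2 - r ^ 2 * Real.tanh (k * x) ^ 2 := by
    nlinarith [sq_nonneg r]
  have hw := Real.sqrt_pos.2 hD
  have hq := Real.sq_sqrt hD.le
  rw [hφ, deriv_deriv_tanhProfile (r * a) k r (r ^ 2 + a ^ 2) hM]
  dsimp only
  rw [hk2, hΛr]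
  generalize Real.sqrt (r ^ 2 + a ^ 2 - r ^ 2 * Real.tanh (k * x) ^ 2) = w at *
  generalize Real.tanh (k * x) = t at *
  refine ⟨by positivity, ?_⟩
  have key : r ^ 2 * (r ^ 2 + g / 2) * (r ^ 2 + a ^ 2) * (1 - t ^ 2) *
        (3 * r ^ 2 * (1 - t ^ 2) - 2 * (r ^ 2 + a ^ 2 - r ^ 2 * t ^ 2)) =
      g * (r * a * t) ^ 2 * w ^ 2 + (r * a * t) ^ 4 - (r ^ 4 + g * r ^ 2) * (w ^ 2) ^ 2 := by
    rw [hq, show (r * a * t) ^ 4 = r ^ 4 * (a ^ 2) ^ 2 * t ^ 4 by ring, mul_pow, mul_pow, ha2]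
    ring
  have hw' := hw.ne'
  rw [div_eq_iff (by positivity)]
  have e : (g * (r * a * t / w) ^ 3 + (r * a * t / w) ^ 5 -
      (r ^ 4 + g * r ^ 2) * (r * a * t / w)) * w ^ 5 =
      r * a * t * (g * (r * a * t) ^ 2 * w ^ 2 + (r * a * t) ^ 4 -
        (r ^ 4 + g * r ^ 2) * (w ^ 2) ^ 2) := by
    field_simp
  rw [e, ← key]
  ring

/-- When λ₁² < Ṽ(x) < λ₂² for all x, the explicit heteroclinics φ₁, φ₂ of the
constant-coefficient comparison equations are respectively lower and upper
solutions of φ'' = g₁φ³ + φ⁵ − Ṽ(x)φ on (0,∞). -/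
theorem stmt_11 (g₁ ω L Vmin Vmax : ℝ) (hL : 0 < L) (V : ℝ → ℝ)
    (hV : Continuous V) (hper : ∀ x, V (x + L) = V x)
    (hbd : ∀ x, Vmin ≤ V x ∧ V x ≤ Vmax)
    (hω : ω > -Vmin)
    (hstrict : ∀ x, Vmin < V x ∧ V x < Vmax)
    (ρ₁ ρ₂ a₁ a₂ k₁ k₂ : ℝ)
    (hρ₁ : ρ₁ = Real.sqrt ((Real.sqrt (g₁ ^ 2 + 4 * (ω + Vmin)) - g₁) / 2))
    (hρ₂ : ρ₂ = Real.sqrt ((Real.sqrt (g₁ ^ 2 + 4 * (ω + Vmax)) - g₁) / 2))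
    (ha₁ : a₁ = Real.sqrt (2 * ρ₁ ^ 2 + 3 / 2 * g₁))
    (ha₂ : a₂ = Real.sqrt (2 * ρ₂ ^ 2 + 3 / 2 * g₁))
    (hk₁ : k₁ = ρ₁ * Real.sqrt (ρ₁ ^ 2 + g₁ / 2))
    (hk₂ : k₂ = ρ₂ * Real.sqrt (ρ₂ ^ 2 + g₁ / 2))
    (φ₁ φ₂ : ℝ → ℝ)
    (hφ₁ : φ₁ = fun x =>
      ρ₁ * a₁ * Real.tanh (k₁ * x) /
        Real.sqrt (ρ₁ ^ 2 + a₁ ^ 2 - ρ₁ ^ 2 * Real.tanh (k₁ * x) ^ 2))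
    (hφ₂ : φ₂ = fun x =>
      ρ₂ * a₂ * Real.tanh (k₂ * x) /
        Real.sqrt (ρ₂ ^ 2 + a₂ ^ 2 - ρ₂ ^ 2 * Real.tanh (k₂ * x) ^ 2)) :
    ∀ x : ℝ, 0 < x →
      deriv (deriv φ₁) x > g₁ * φ₁ x ^ 3 + φ₁ x ^ 5 - (ω + V x) * φ₁ x ∧
      deriv (deriv φ₂) x < g₁ * φ₂ x ^ 3 + φ₂ x ^ 5 - (ω + V x) * φ₂ x := by
  intro x hx
  obtain ⟨hl, hu⟩ := hstrict x
  obtain ⟨p₁, e₁⟩ := heteroclinic_pos_and_deriv_deriv g₁ (ω + Vmin) ρ₁ a₁ k₁ (by linarith)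
    hρ₁ ha₁ hk₁ φ₁ hφ₁ x hx
  obtain ⟨p₂, e₂⟩ := heteroclinic_pos_and_deriv_deriv g₁ (ω + Vmax) ρ₂ a₂ k₂ (by linarith)
    hρ₂ ha₂ hk₂ φ₂ hφ₂ x hx
  rw [e₁, e₂]
  constructor
  · linarith [mul_lt_mul_of_pos_right hl p₁]
  · linarith [mul_lt_mul_of_pos_right hu p₂]
end

section
/- Let g₁ ∈ ℝ and V_min ≤ V_max be real numbers. For ω > −V_min set λ₁² = ω + V_min, λ₂² = ω + V_max and ρ_j² = (√(g₁² + 4λ_j²) − g₁)/2 for j = 1, 2. Then there exists ω₀ ∈ ℝ (depending only on g₁, V_min, V_max) such that for every ω > ω₀ one has 5y⁴ + 3g₁y² − λ₂² > 0 for all y ∈ [ρ₁, ρ₂]; in particular, for every ω > ω₀ the cubic–quintic equation φ'' + (ω + V(x))φ − g₁φ³ − φ⁵ = 0 satisfies the positivity condition min{5y⁴ + 3g₁y² − (ω + V(x))} > 0 over y ∈ [ρ₁, ρ₂] and x ∈ ℝ, for any continuous V with V_min ≤ V ≤ V_max. -/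
open Set

/-- If `L` is large compared to `g` and `D`, then `5 y ^ 4 + 3 g y ^ 2 - (L + D)` is positive for
all `y` above the positive root of `y ^ 4 + g y ^ 2 = L`. -/
theorem quintic_derivative_pos {g L D y : ℝ} (hD : 0 ≤ D)
    (hL : (1 + D + |g|) ^ 2 + |g| * (1 + D + |g|) < L)
    (hy : Real.sqrt ((Real.sqrt (g ^ 2 + 4 * L) - g) / 2) ≤ y) :
    0 < 5 * y ^ 4 + 3 * g * y ^ 2 - (L + D) := by
  have hg := le_abs_self g
  have hg' := neg_abs_le g
  have hg₀ := abs_nonneg g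
  have hL₀ : 0 ≤ L := le_trans (by positivity) hL.le
  obtain ⟨r, hr⟩ : ∃ r, r = (Real.sqrt (g ^ 2 + 4 * L) - g) / 2 := ⟨_, rfl⟩
  have hrL : r ^ 2 + g * r = L := by
    have hs := Real.sq_sqrt (show 0 ≤ g ^ 2 + 4 * L by positivity)
    rw [hr]
    linarith
  have hKr : 1 + D + |g| ≤ r := by
    have h : 2 * (1 + D + |g|) + g ≤ Real.sqrt (g ^ 2 + 4 * L) :=
      Real.le_sqrt_of_sq_le (by nlinarith)
    linarith
  have hry : r ≤ y ^ 2 := (Real.sqrt_le_iff.mp (hr ▸ hy)).2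
  have hmono : 0 ≤ (y ^ 2 - r) * (5 * (y ^ 2 + r) + 3 * g) :=
    mul_nonneg (by linarith) (by linarith)
  have hbase : 0 < 4 * r ^ 2 + 2 * g * r - D := by
    have h₁ : 0 ≤ (r + g) * r := mul_nonneg (by linarith) (by linarith)
    have h₂ : (1 + D) * 1 ≤ r * r :=
      mul_le_mul (by linarith) (by linarith) (by norm_num) (by linarith)
    linarith
  linarith

/-- There is an explicitly computable threshold ω₀ (depending only on g₁,
V_min, V_max) such that for every ω > ω₀ the positivity condition
5y⁴ + 3g₁y² − (ω + V(x)) > 0 holds on [ρ₁,ρ₂] × ℝ for any continuous V with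
V_min ≤ V ≤ V_max. -/
theorem stmt_17 (g₁ Vmin Vmax : ℝ) (hV : Vmin ≤ Vmax) :
    ∃ ω₀ : ℝ, ∀ ω : ℝ, ω > ω₀ →
      ω > -Vmin ∧
      (∀ y ∈ Icc (Real.sqrt ((Real.sqrt (g₁ ^ 2 + 4 * (ω + Vmin)) - g₁) / 2))
          (Real.sqrt ((Real.sqrt (g₁ ^ 2 + 4 * (ω + Vmax)) - g₁) / 2)),
        5 * y ^ 4 + 3 * g₁ * y ^ 2 - (ω + Vmax) > 0) ∧
      (∀ V : ℝ → ℝ, Continuous V → (∀ x, Vmin ≤ V x ∧ V x ≤ Vmax) →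
        ∀ y ∈ Icc (Real.sqrt ((Real.sqrt (g₁ ^ 2 + 4 * (ω + Vmin)) - g₁) / 2))
            (Real.sqrt ((Real.sqrt (g₁ ^ 2 + 4 * (ω + Vmax)) - g₁) / 2)),
          ∀ x : ℝ, 5 * y ^ 4 + 3 * g₁ * y ^ 2 - (ω + V x) > 0) := by
  have hD : 0 ≤ Vmax - Vmin := sub_nonneg.mpr hV
  refine ⟨(1 + (Vmax - Vmin) + |g₁|) ^ 2 + |g₁| * (1 + (Vmax - Vmin) + |g₁|) - Vmin,
    fun ω hω => ?_⟩
  have hpos : ∀ y ∈ Icc (Real.sqrt ((Real.sqrt (g₁ ^ 2 + 4 * (ω + Vmin)) - g₁) / 2))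
      (Real.sqrt ((Real.sqrt (g₁ ^ 2 + 4 * (ω + Vmax)) - g₁) / 2)),
      5 * y ^ 4 + 3 * g₁ * y ^ 2 - (ω + Vmax) > 0 := fun y hy => by
    have := quintic_derivative_pos hD (by linarith) hy.1
    linarith
  refine ⟨?_, hpos, fun V _ hVx y hy x => ?_⟩
  · have : 0 ≤ (1 + (Vmax - Vmin) + |g₁|) ^ 2 + |g₁| * (1 + (Vmax - Vmin) + |g₁|) := by
      positivity
    linarith
  · linarith [hpos y hy, (hVx x).2]
end

section
/- Fix real constants g₁, ω, L > 0 and a continuous L-periodic function V : ℝ → ℝ with V_min ≤ V(x) ≤ V_max. Assume ω > −V_min, set Ṽ(x) = ω + V(x), λ_j and ρ_j as usual, and suppose 5y⁴ + 3g₁y² − Ṽ(x) > 0 for all y ∈ [ρ₁, ρ₂] and all x. Then the stationary equation φ'' + Ṽ(x)φ − g₁φ³ − φ⁵ = 0 has exactly one L-periodic C² solution φ with ρ₁ ≤ φ(x) ≤ ρ₂ for all x. -/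
open Set MeasureTheory Filter Topology

/-- Convolution of `h` with the one-sided exponential kernel `s ↦ exp (-k * s)` on `(0, ∞)`. -/
noncomputable def expTail (k : ℝ) (h : ℝ → ℝ) (x : ℝ) : ℝ :=
  ∫ s in Ioi (0 : ℝ), Real.exp (-k * s) * h (x - s)

section expTail

variable {k : ℝ} {h g : ℝ → ℝ}

theorem integrableOn_expTail (hk : 0 < k) (hc : Continuous h) {C : ℝ} (hC : ∀ x, |h x| ≤ C)
    (x : ℝ) : IntegrableOn (fun s => Real.exp (-k * s) * h (x - s)) (Ioi 0) :=
  Integrable.mul_bdd (c := C) (exp_neg_integrableOn_Ioi 0 hk)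
    (by fun_prop) (Eventually.of_forall fun s => hC (x - s))

theorem expTail_const (hk : 0 < k) (c x : ℝ) : expTail k (fun _ => c) x = c / k := by
  unfold expTail
  rw [integral_mul_const, integral_exp_mul_Ioi (by linarith)]
  simp
  field_simp

theorem expTail_mono (hk : 0 < k) (hh : Continuous h) (hg : Continuous g) {C D : ℝ}
    (hC : ∀ x, |h x| ≤ C) (hD : ∀ x, |g x| ≤ D) (hle : ∀ x, h x ≤ g x) (x : ℝ) :
    expTail k h x ≤ expTail k g x :=
  integral_mono (integrableOn_expTail hk hh hC x) (integrableOn_expTail hk hg hD x)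
    fun s => mul_le_mul_of_nonneg_left (hle (x - s)) (Real.exp_pos _).le

theorem expTail_add_const (hk : 0 < k) (hg : Continuous g) {D : ℝ} (hD : ∀ x, |g x| ≤ D)
    (c x : ℝ) : expTail k (fun t => g t + c) x = expTail k g x + c / k := by
  rw [← expTail_const hk c x]
  unfold expTail
  rw [← integral_add (integrableOn_expTail hk hg hD x)
    (integrableOn_expTail hk continuous_const (C := |c|) (fun _ => le_rfl) x)]
  simp only [mul_add]

theorem expTail_eq_integral_Iic (x : ℝ) :
    expTail k h x = Real.exp (-k * x) * ∫ t in Iic x, Real.exp (k * t) * h t := by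
  unfold expTail
  rw [integral_Iic_eq_integral_Iio, ← integral_const_mul, ← integral_indicator measurableSet_Ioi,
    ← integral_indicator measurableSet_Iio,
    ← integral_sub_left_eq_self (fun t => (Iio x).indicator _ t) volume x]
  congr 1 with s
  by_cases hs : 0 < s
  · rw [indicator_of_mem (by simpa using hs), indicator_of_mem (by simpa using hs), ← mul_assoc,
      ← Real.exp_add]
    ring_nf
  · rw [indicator_of_notMem (by simpa using hs), indicator_of_notMem (by simpa using hs)]

theorem integrableOn_Iic_exp_mul (hk : 0 < k) (hc : Continuous h) {C : ℝ} (hC : ∀ x, |h x| ≤ C)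
    (x : ℝ) : IntegrableOn (fun t => Real.exp (k * t) * h t) (Iic x) :=
  Integrable.mul_bdd (c := C) (integrableOn_exp_mul_Iic hk x)
    (by fun_prop) (Eventually.of_forall fun s => hC s)

theorem hasDerivAt_expTail (hk : 0 < k) (hc : Continuous h) {C : ℝ} (hC : ∀ x, |h x| ≤ C)
    (x : ℝ) : HasDerivAt (expTail k h) (h x - k * expTail k h x) x := by
  have hcont : Continuous fun t => Real.exp (k * t) * h t := by fun_prop
  have heq : expTail k h = fun y => Real.exp (-k * y) *
      ((∫ t in Iic 0, Real.exp (k * t) * h t) + ∫ t in (0 : ℝ)..y, Real.exp (k * t) * h t) := by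
    ext y
    rw [expTail_eq_integral_Iic, ← intervalIntegral.integral_Iic_sub_Iic
      (integrableOn_Iic_exp_mul hk hc hC 0) (integrableOn_Iic_exp_mul hk hc hC y)]
    ring
  have hexp : HasDerivAt (fun y => Real.exp (-k * y)) (Real.exp (-k * x) * -k) x := by
    simpa using ((hasDerivAt_id x).const_mul (-k)).exp
  have hprod := hexp.mul ((intervalIntegral.integral_hasDerivAt_right
    (hcont.intervalIntegrable 0 x) (hcont.stronglyMeasurableAtFilter _ _) hcont.continuousAt).const_add
      (∫ t in Iic 0, Real.exp (k * t) * h t))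
  have hone : Real.exp (-k * x) * Real.exp (k * x) = 1 := by
    rw [← Real.exp_add]; simp
  rw [heq]
  convert! hprod using 1
  linear_combination -(h x) * hone

end expTail

/-- The bounded solution of `deriv (deriv u) = k ^ 2 * u - h`, as a convolution of `h` with the
Green function `exp (-k * |x|) / (2 * k)`. -/
noncomputable def greenConv (k : ℝ) (h : ℝ → ℝ) (x : ℝ) : ℝ :=
  (expTail k h x + expTail k (fun t => h (-t)) (-x)) / (2 * k)

section greenConv

variable {k : ℝ} {h g : ℝ → ℝ}

theorem greenConv_const (hk : 0 < k) (c x : ℝ) : greenConv k (fun _ => c) x = c / k ^ 2 := by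
  unfold greenConv
  rw [expTail_const hk, expTail_const hk]
  field_simp
  ring

theorem greenConv_mono (hk : 0 < k) (hh : Continuous h) (hg : Continuous g) {C D : ℝ}
    (hC : ∀ x, |h x| ≤ C) (hD : ∀ x, |g x| ≤ D) (hle : ∀ x, h x ≤ g x) (x : ℝ) :
    greenConv k h x ≤ greenConv k g x := by
  unfold greenConv
  gcongr
  · exact expTail_mono hk hh hg hC hD hle x
  · exact expTail_mono hk (by fun_prop) (by fun_prop) (fun _ => hC _) (fun _ => hD _)
      (fun _ => hle _) _

theorem greenConv_add_const (hk : 0 < k) (hg : Continuous g) {D : ℝ} (hD : ∀ x, |g x| ≤ D)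
    (c x : ℝ) : greenConv k (fun t => g t + c) x = greenConv k g x + c / k ^ 2 := by
  unfold greenConv
  rw [expTail_add_const hk hg hD,
    expTail_add_const hk (g := fun t => g (-t)) (by fun_prop) (fun _ => hD _)]
  field_simp
  ring

theorem abs_greenConv_sub_le (hk : 0 < k) (hh : Continuous h) (hg : Continuous g) {C D d : ℝ}
    (hC : ∀ x, |h x| ≤ C) (hD : ∀ x, |g x| ≤ D) (hd : ∀ x, |h x - g x| ≤ d) (x : ℝ) :
    |greenConv k h x - greenConv k g x| ≤ d / k ^ 2 := by
  have key : ∀ {h g : ℝ → ℝ} {C D : ℝ}, Continuous h → Continuous g → (∀ x, |h x| ≤ C) →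
      (∀ x, |g x| ≤ D) → (∀ x, h x ≤ g x + d) →
      greenConv k h x ≤ greenConv k g x + d / k ^ 2 := by
    intro h g C D hh hg hC hD hle
    rw [← greenConv_add_const hk hg hD]
    exact greenConv_mono hk hh (by fun_prop) hC (D := D + |d|)
      (fun x => (abs_add_le _ _).trans (by gcongr; exact hD x)) hle x
  rw [abs_le]
  have h₁ := key hh hg hC hD fun x => by linarith [(abs_le.1 (hd x)).2]
  have h₂ := key hg hh hD hC fun x => by linarith [(abs_le.1 (hd x)).1]
  constructor <;> linarith

theorem greenConv_comp_add_right (L x : ℝ) :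
    greenConv k (fun t => h (t + L)) x = greenConv k h (x + L) := by
  have h₁ : ∀ s, x - s + L = x + L - s := fun s => by ring
  have h₂ : ∀ s, -(-x - s) + L = -(-(x + L) - s) := fun s => by ring
  simp only [greenConv, expTail, h₁, h₂]

theorem hasDerivAt_greenConv (hk : 0 < k) (hc : Continuous h) {C : ℝ} (hC : ∀ x, |h x| ≤ C)
    (x : ℝ) : HasDerivAt (greenConv k h)
      ((expTail k (fun t => h (-t)) (-x) - expTail k h x) / 2) x := by
  have h₁ := hasDerivAt_expTail hk hc hC x
  have h₂ := (hasDerivAt_expTail hk (h := fun t => h (-t)) (by fun_prop) (fun _ => hC _)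
    (-x)).comp x (hasDerivAt_neg x)
  convert! (h₁.add h₂).div_const (2 * k) using 1
  rw [neg_neg]
  field_simp
  ring

theorem deriv_deriv_greenConv (hk : 0 < k) (hc : Continuous h) {C : ℝ} (hC : ∀ x, |h x| ≤ C) :
    deriv (deriv (greenConv k h)) = fun x => k ^ 2 * greenConv k h x - h x := by
  rw [funext fun x => (hasDerivAt_greenConv hk hc hC x).deriv]
  ext x
  have h₁ := hasDerivAt_expTail hk hc hC x
  have h₂ := (hasDerivAt_expTail hk (h := fun t => h (-t)) (by fun_prop) (fun _ => hC _)
    (-x)).comp x (hasDerivAt_neg x)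
  refine ((h₂.sub h₁).div_const 2).deriv.trans ?_
  rw [neg_neg, greenConv]
  field_simp
  ring

theorem contDiff_greenConv (hk : 0 < k) (hc : Continuous h) {C : ℝ} (hC : ∀ x, |h x| ≤ C) :
    ContDiff ℝ 2 (greenConv k h) := by
  have hd : Differentiable ℝ (greenConv k h) := fun x =>
    (hasDerivAt_greenConv hk hc hC x).differentiableAt
  rw [show (2 : WithTop ℕ∞) = 1 + 1 by norm_num, contDiff_succ_iff_deriv]
  refine ⟨hd, by simp, contDiff_one_iff_deriv.2 ⟨?_, ?_⟩⟩
  · rw [funext fun x => (hasDerivAt_greenConv hk hc hC x).deriv]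
    intro x
    have h₁ := hasDerivAt_expTail hk hc hC x
    have h₂ := (hasDerivAt_expTail hk (h := fun t => h (-t)) (by fun_prop) (fun _ => hC _)
      (-x)).comp x (hasDerivAt_neg x)
    exact ((h₂.sub h₁).div_const 2).differentiableAt
  · rw [deriv_deriv_greenConv hk hc hC]
    have := hd.continuous
    fun_prop

end greenConv

/-- A bounded nonlinearity whose Lipschitz constant in the second variable is less than `k ^ 2`
gives a periodic solution of `deriv (deriv φ) x = k ^ 2 * φ x - F x (φ x)`. -/
theorem exists_periodic_of_lipschitz {F : ℝ → ℝ → ℝ} {k q a b L : ℝ} (hk : 0 < k) (hq : 0 ≤ q)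
    (hqk : q < k ^ 2) (hF : Continuous (Function.uncurry F)) (hper : ∀ x, F (x + L) = F x)
    (hlip : ∀ x y z, |F x y - F x z| ≤ q * |y - z|)
    (hmem : ∀ x y, F x y ∈ Icc (k ^ 2 * a) (k ^ 2 * b)) :
    ∃ φ : ℝ → ℝ, ContDiff ℝ 2 φ ∧ (∀ x, deriv (deriv φ) x = k ^ 2 * φ x - F x (φ x)) ∧
      (∀ x, φ (x + L) = φ x) ∧ ∀ x, φ x ∈ Icc a b := by
  obtain ⟨C, hC⟩ : ∃ C, ∀ x y, |F x y| ≤ C :=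
    ⟨max |k ^ 2 * a| |k ^ 2 * b|, fun x y => abs_le_max_abs_abs (hmem x y).1 (hmem x y).2⟩
  have hcont : ∀ {u : ℝ → ℝ}, Continuous u → Continuous fun t => F t (u t) := fun hu =>
    hF.comp (continuous_id.prodMk hu)
  have hrange : ∀ {u : ℝ → ℝ}, Continuous u → ∀ x,
      greenConv k (fun t => F t (u t)) x ∈ Icc a b := by
    intro u hu x
    have h₁ := greenConv_mono hk continuous_const (hcont hu) (fun _ => le_rfl)
      (fun t => hC t (u t)) (fun t => (hmem t (u t)).1) x
    have h₂ := greenConv_mono hk (hcont hu) continuous_const (fun t => hC t (u t))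
      (fun _ => le_rfl) (fun t => (hmem t (u t)).2) x
    rw [greenConv_const hk, mul_div_cancel_left₀ _ (by positivity)] at h₁ h₂
    exact ⟨h₁, h₂⟩
  let T : BoundedContinuousFunction ℝ ℝ → BoundedContinuousFunction ℝ ℝ := fun u =>
    BoundedContinuousFunction.ofNormedAddCommGroup (greenConv k fun t => F t (u t))
      (contDiff_greenConv hk (hcont u.continuous) fun t => hC t (u t)).continuous
      (max |a| |b|) fun x => abs_le_max_abs_abs (hrange u.continuous x).1 (hrange u.continuous x).2
  have hT : ∀ u x, T u x = greenConv k (fun t => F t (u t)) x := fun _ _ => rfl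
  have hcontr : ContractingWith (NNReal.mk (q / k ^ 2) (by positivity)) T := by
    refine ⟨?_, LipschitzWith.of_dist_le_mul fun u v => ?_⟩
    · rw [← NNReal.coe_lt_coe]
      exact (div_lt_one (by positivity)).2 hqk
    · refine (BoundedContinuousFunction.dist_le (by positivity)).2 fun x => ?_
      rw [Real.dist_eq, hT, hT]
      refine (abs_greenConv_sub_le hk (hcont u.continuous) (hcont v.continuous)
        (fun t => hC t (u t)) (fun t => hC t (v t)) (d := q * dist u v) (fun t => ?_) x).trans_eq ?_
      · refine (hlip t _ _).trans (mul_le_mul_of_nonneg_left ?_ hq)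
        exact (Real.dist_eq _ _).symm.trans_le (BoundedContinuousFunction.dist_coe_le_dist t)
      · rw [NNReal.coe_mk]
        ring
  let φ := ContractingWith.fixedPoint T hcontr
  have hφ : T φ = φ := hcontr.fixedPoint_isFixedPt
  have hφ' : ⇑φ = greenConv k fun t => F t (φ t) := (congrArg _ hφ).symm
  let ψ := φ.compContinuous ⟨fun x => x + L, by fun_prop⟩
  have hψ : T ψ = ψ := by
    ext x
    have h₁ : (fun t => F t (ψ t)) = fun t => (fun s => F s (φ s)) (t + L) := by
      ext t
      exact (congrFun (hper t) _).symm
    rw [hT, h₁, greenConv_comp_add_right (h := fun s => F s (φ s)), ← hφ']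
    rfl
  have hψφ : ψ = φ := hcontr.fixedPoint_unique' hψ hφ
  refine ⟨φ, ?_, fun x => ?_, fun x => DFunLike.congr_fun hψφ x, fun x => ?_⟩
  · rw [hφ']
    exact contDiff_greenConv hk (hcont φ.continuous) fun t => hC t (φ t)
  · have := congrFun (deriv_deriv_greenConv hk (hcont φ.continuous) fun t => hC t (φ t)) x
    rwa [← hφ'] at this
  · rw [hφ']
    exact hrange φ.continuous x

/-- The method of lower and upper solutions, for constant lower and upper solutions `a ≤ b` and a
nonlinearity that increases strictly between them. -/
theorem exists_periodic_of_lower_upper {f : ℝ → ℝ → ℝ} {a b m K L : ℝ} (hab : a ≤ b) (hm : 0 < m)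
    (hmK : m ≤ K) (hf : Continuous (Function.uncurry f)) (hper : ∀ x, f (x + L) = f x)
    (ha : ∀ x, f x a ≤ 0) (hb : ∀ x, 0 ≤ f x b)
    (hlow : ∀ x, MonotoneOn (fun y => f x y - m * y) (Icc a b))
    (hup : ∀ x, MonotoneOn (fun y => K * y - f x y) (Icc a b)) :
    ∃ φ : ℝ → ℝ, ContDiff ℝ 2 φ ∧ (∀ x, deriv (deriv φ) x = f x (φ x)) ∧
      (∀ x, φ (x + L) = φ x) ∧ ∀ x, φ x ∈ Icc a b := by
  let p : ℝ → ℝ := fun y => projIcc a b hab y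
  have hp : ∀ y, p y ∈ Icc a b := fun y => (projIcc a b hab y).2
  have hpc : Continuous p := continuous_subtype_val.comp continuous_projIcc
  have hk : √K ^ 2 = K := Real.sq_sqrt (by linarith)
  have hlip : ∀ x y z, |K * p y - f x (p y) - (K * p z - f x (p z))| ≤ (K - m) * |y - z| := by
    intro x y z
    wlog hyz : z ≤ y generalizing y z
    · rw [abs_sub_comm, abs_sub_comm y]
      exact this z y (le_of_not_ge hyz)
    have hpm : p z ≤ p y := monotone_projIcc hab hyz
    have h₁ := hlow x (hp z) (hp y) hpm
    have h₂ := hup x (hp z) (hp y) hpm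
    have h₃ : p y - p z ≤ |y - z| := (le_abs_self _).trans (abs_projIcc_sub_projIcc hab)
    simp only at h₁ h₂
    rw [abs_of_nonneg (by linarith)]
    refine le_trans ?_ (mul_le_mul_of_nonneg_left h₃ (by linarith))
    linarith
  have hmem : ∀ x y, K * p y - f x (p y) ∈ Icc (√K ^ 2 * a) (√K ^ 2 * b) := by
    intro x y
    have h₁ := hup x (left_mem_Icc.2 hab) (hp y) (hp y).1
    have h₂ := hup x (hp y) (right_mem_Icc.2 hab) (hp y).2
    simp only at h₁ h₂
    rw [hk]
    exact ⟨by linarith [ha x], by linarith [hb x]⟩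
  obtain ⟨φ, h₁, h₂, h₃, h₄⟩ := exists_periodic_of_lipschitz
    (F := fun x y => K * p y - f x (p y)) (L := L)
    (Real.sqrt_pos.2 (by linarith)) (by linarith) (by rw [hk]; linarith)
    ((by fun_prop : Continuous fun z : ℝ × ℝ => K * p z.2).sub
      (hf.comp (continuous_fst.prodMk (hpc.comp continuous_snd))))
    (fun x => by simp only [hper]) hlip hmem
  refine ⟨φ, h₁, fun x => ?_, h₃, h₄⟩
  have hpφ : p (φ x) = φ x := by simp only [p, projIcc_of_mem hab (h₄ x)]
  rw [h₂, hk, hpφ]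
  ring

/-- Comparison of two periodic solutions of `deriv (deriv φ) x = f x (φ x)`, where `f x` is
strictly increasing. -/
theorem le_of_periodic_of_strictMonoOn {f : ℝ → ℝ → ℝ} {s : Set ℝ} {L : ℝ} (hL : 0 < L)
    (hf : ∀ x, StrictMonoOn (f x) s) {φ ψ : ℝ → ℝ} (hφ : ContDiff ℝ 2 φ) (hψ : ContDiff ℝ 2 ψ)
    (hφf : ∀ x, deriv (deriv φ) x = f x (φ x)) (hψf : ∀ x, deriv (deriv ψ) x = f x (ψ x))
    (hφL : ∀ x, φ (x + L) = φ x) (hψL : ∀ x, ψ (x + L) = ψ x)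
    (hφs : ∀ x, φ x ∈ s) (hψs : ∀ x, ψ x ∈ s) (x : ℝ) : φ x ≤ ψ x := by
  by_contra! hx
  set w : ℝ → ℝ := fun x => φ x - ψ x with hw
  have hwc : Continuous w := hφ.continuous.sub hψ.continuous
  have hwL : Function.Periodic w L := fun x => by simp only [hw, hφL, hψL]
  obtain ⟨c, -, hc⟩ := isCompact_Icc.exists_isMaxOn (nonempty_Icc.2 hL.le) hwc.continuousOn
  have hmax : ∀ y, w y ≤ w c := fun y => by
    obtain ⟨z, hz, hyz⟩ := hwL.exists_mem_Ico₀ hL y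
    exact hyz.trans_le (hc (Ico_subset_Icc_self hz))
  have hwpos : 0 < w c := (sub_pos.2 hx).trans_le (hmax x)
  have hdiff : ∀ {u : ℝ → ℝ}, ContDiff ℝ 2 u → Differentiable ℝ u ∧ Differentiable ℝ (deriv u) :=
    fun hu => ⟨hu.differentiable (by norm_num),
      (hu.iterate_deriv' 1 1).differentiable (by norm_num)⟩
  have hd : deriv w = fun x => deriv φ x - deriv ψ x :=
    funext fun x => deriv_fun_sub ((hdiff hφ).1 x) ((hdiff hψ).1 x)
  have hdd : 0 < deriv (deriv w) c := by
    rw [hd, deriv_fun_sub ((hdiff hφ).2 c) ((hdiff hψ).2 c), hφf, hψf, sub_pos]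
    exact hf c (hψs c) (hφs c) (sub_pos.1 hwpos)
  have hlmax : IsLocalMax w c := Eventually.of_forall hmax
  have hlmin := isLocalMin_of_deriv_deriv_pos hdd hlmax.deriv_eq_zero hwc.continuousAt
  have hconst : w =ᶠ[𝓝 c] fun _ => w c := by
    filter_upwards [hlmin] with y hy using le_antisymm (hmax y) hy
  rw [hconst.deriv.deriv_eq] at hdd
  simp at hdd

theorem sqrt_root_pow_four {g A ρ : ℝ} (hA : 0 < A)
    (hρ : ρ = √((√(g ^ 2 + 4 * A) - g) / 2)) : ρ ^ 4 + g * ρ ^ 2 = A := by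
  have hs : √(g ^ 2 + 4 * A) ^ 2 = g ^ 2 + 4 * A := Real.sq_sqrt (by positivity)
  have hle : g ≤ √(g ^ 2 + 4 * A) := Real.le_sqrt_of_sq_le (by linarith)
  have hρ2 : ρ ^ 2 = (√(g ^ 2 + 4 * A) - g) / 2 := by
    rw [hρ, Real.sq_sqrt (by linarith)]
  rw [show ρ ^ 4 = (ρ ^ 2) ^ 2 by ring, hρ2]
  linear_combination hs / 4

/-- Under the positivity of ∂f/∂y on [ρ₁,ρ₂] × ℝ, the stationary cubic-quintic
equation has exactly one L-periodic C² solution with values in [ρ₁,ρ₂]. -/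
theorem stmt_18 (g₁ ω L Vmin Vmax : ℝ) (hL : 0 < L) (V : ℝ → ℝ)
    (hV : Continuous V) (hper : ∀ x, V (x + L) = V x)
    (hbd : ∀ x, Vmin ≤ V x ∧ V x ≤ Vmax)
    (hω : ω > -Vmin) (ρ₁ ρ₂ : ℝ)
    (hρ₁ : ρ₁ = Real.sqrt ((Real.sqrt (g₁ ^ 2 + 4 * (ω + Vmin)) - g₁) / 2))
    (hρ₂ : ρ₂ = Real.sqrt ((Real.sqrt (g₁ ^ 2 + 4 * (ω + Vmax)) - g₁) / 2))
    (hpos : ∀ y ∈ Icc ρ₁ ρ₂, ∀ x : ℝ,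
      5 * y ^ 4 + 3 * g₁ * y ^ 2 - (ω + V x) > 0) :
    ∃! φ : ℝ → ℝ, ContDiff ℝ 2 φ ∧
      (∀ x, deriv (deriv φ) x + (ω + V x) * φ x - g₁ * φ x ^ 3 - φ x ^ 5 = 0) ∧
      (∀ x, φ (x + L) = φ x) ∧
      (∀ x, φ x ∈ Icc ρ₁ ρ₂) := by
  have hVV : Vmin ≤ Vmax := (hbd 0).1.trans (hbd 0).2
  have hroot₁ := sqrt_root_pow_four (by linarith) hρ₁
  have hroot₂ := sqrt_root_pow_four (by linarith) hρ₂
  have hρ₁0 : 0 ≤ ρ₁ := hρ₁ ▸ Real.sqrt_nonneg _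
  have hρ₂0 : 0 ≤ ρ₂ := hρ₂ ▸ Real.sqrt_nonneg _
  have hρ : ρ₁ ≤ ρ₂ := by
    rw [hρ₁, hρ₂]
    gcongr
  let f : ℝ → ℝ → ℝ := fun x y => y ^ 5 + g₁ * y ^ 3 - (ω + V x) * y
  let d : ℝ × ℝ → ℝ := fun z => 5 * z.1 ^ 4 + 3 * g₁ * z.1 ^ 2 - (ω + V z.2)
  have hfd : ∀ x y, HasDerivAt (f x) (d (y, x)) y := fun x y => by
    convert! ((hasDerivAt_pow 5 y).add ((hasDerivAt_pow 3 y).const_mul g₁)).sub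
      ((hasDerivAt_id y).const_mul (ω + V x)) using 1
    simp only [d]
    push_cast
    ring
  have hdc : Continuous d := by fun_prop
  have hcomp : IsCompact (Icc ρ₁ ρ₂ ×ˢ Icc 0 L) := isCompact_Icc.prod isCompact_Icc
  have hne : (Icc ρ₁ ρ₂ ×ˢ Icc 0 L).Nonempty := (nonempty_Icc.2 hρ).prod (nonempty_Icc.2 hL.le)
  obtain ⟨⟨y₀, x₀⟩, hmem₀, hmin⟩ := hcomp.exists_isMinOn hne hdc.continuousOn
  obtain ⟨⟨y₁, x₁⟩, hmem₁, hmax⟩ := hcomp.exists_isMaxOn hne hdc.continuousOn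
  have hm : 0 < d (y₀, x₀) := hpos y₀ hmem₀.1 x₀
  have hbounds : ∀ x, ∀ y ∈ Icc ρ₁ ρ₂, d (y₀, x₀) ≤ d (y, x) ∧ d (y, x) ≤ d (y₁, x₁) := by
    intro x y hy
    obtain ⟨z, hz, hxz⟩ := Function.Periodic.exists_mem_Ico₀ hper hL x
    have hdz : d (y, x) = d (y, z) := by simp only [d, hxz]
    rw [hdz]
    exact ⟨hmin ⟨hy, Ico_subset_Icc_self hz⟩, hmax ⟨hy, Ico_subset_Icc_self hz⟩⟩
  have hlow : ∀ x, MonotoneOn (fun y => f x y - d (y₀, x₀) * y) (Icc ρ₁ ρ₂) := fun x => by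
    have hder : ∀ y, HasDerivAt (fun y => f x y - d (y₀, x₀) * y) (d (y, x) - d (y₀, x₀)) y :=
      fun y => by simpa using (hfd x y).fun_sub ((hasDerivAt_id' y).const_mul (d (y₀, x₀)))
    refine monotoneOn_of_deriv_nonneg (convex_Icc _ _)
      (fun y _ => (hder y).continuousAt.continuousWithinAt)
      (fun y _ => (hder y).differentiableAt.differentiableWithinAt) fun y hy => ?_
    rw [(hder y).deriv, sub_nonneg]
    exact (hbounds x y (interior_subset hy)).1
  have hup : ∀ x, MonotoneOn (fun y => d (y₁, x₁) * y - f x y) (Icc ρ₁ ρ₂) := fun x => by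
    have hder : ∀ y, HasDerivAt (fun y => d (y₁, x₁) * y - f x y) (d (y₁, x₁) - d (y, x)) y :=
      fun y => by simpa using ((hasDerivAt_id' y).const_mul (d (y₁, x₁))).fun_sub (hfd x y)
    refine monotoneOn_of_deriv_nonneg (convex_Icc _ _)
      (fun y _ => (hder y).continuousAt.continuousWithinAt)
      (fun y _ => (hder y).differentiableAt.differentiableWithinAt) fun y hy => ?_
    rw [(hder y).deriv, sub_nonneg]
    exact (hbounds x y (interior_subset hy)).2
  have hstrict : ∀ x, StrictMonoOn (f x) (Icc ρ₁ ρ₂) := fun x y hy z hz hyz => by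
    have h₁ := hlow x hy hz hyz.le
    have h₂ := mul_lt_mul_of_pos_left hyz hm
    simp only at h₁
    linarith
  have hfc : Continuous (Function.uncurry f) := by
    change Continuous fun z : ℝ × ℝ => z.2 ^ 5 + g₁ * z.2 ^ 3 - (ω + V z.1) * z.2
    fun_prop
  have hf₁ : ∀ x, f x ρ₁ ≤ 0 := fun x => by
    have h₁ : f x ρ₁ = ρ₁ * (Vmin - V x) := by
      simp only [f]
      linear_combination ρ₁ * hroot₁
    rw [h₁]
    exact mul_nonpos_of_nonneg_of_nonpos hρ₁0 (sub_nonpos.2 (hbd x).1)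
  have hf₂ : ∀ x, 0 ≤ f x ρ₂ := fun x => by
    have h₂ : f x ρ₂ = ρ₂ * (Vmax - V x) := by
      simp only [f]
      linear_combination ρ₂ * hroot₂
    rw [h₂]
    exact mul_nonneg hρ₂0 (sub_nonneg.2 (hbd x).2)
  have hode : ∀ (φ : ℝ → ℝ) x, deriv (deriv φ) x = f x (φ x) ↔
      deriv (deriv φ) x + (ω + V x) * φ x - g₁ * φ x ^ 3 - φ x ^ 5 = 0 := fun φ x => by
    simp only [f]
    constructor <;> intro h <;> linear_combination h
  simp only [← hode]
  obtain ⟨φ, hφ⟩ := exists_periodic_of_lower_upper (L := L) hρ hm (hbounds x₁ y₁ hmem₁.1).1 hfc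
    (fun x => by simp only [f, hper]) hf₁ hf₂ hlow hup
  refine ⟨φ, hφ, fun ψ hψ => funext fun x => ?_⟩
  obtain ⟨hφ₁, hφ₂, hφ₃, hφ₄⟩ := hφ
  obtain ⟨hψ₁, hψ₂, hψ₃, hψ₄⟩ := hψ
  exact le_antisymm
    (le_of_periodic_of_strictMonoOn hL hstrict hψ₁ hφ₁ hψ₂ hφ₂ hψ₃ hφ₃ hψ₄ hφ₄ x)
    (le_of_periodic_of_strictMonoOn hL hstrict hφ₁ hψ₁ hφ₂ hψ₂ hφ₃ hψ₃ hφ₄ hψ₄ x)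
end
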